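/- arXiv:1612.09057 — 4 statements merged into one kernel-verified Lean document; each statement's English description precedes it below -/
import Mathlib

section
/- Fix 0 < h0 < h1 < h and assume λ < 1. Consider the IIDM together with an independent random instance I(h0,h1), and let w be a uniformly random leaf in L_T ∖ S. Then for every (possibly randomized) local algorithm, i.e. every function g that outputs a label depending only on R(w), the labeled data {(R(v), L(v)) : v ∈ S} and independent external randomness, the probability that g outputs the true label of w is at most d^{−h0} · (1 + q·λ^{h−h1}/(1 − λ^{h−h1}))^k. (Theorem 'weakness of local learning', stated with the explicit constant arising from the likelihood-ratio bound; the paper states the bound as d^{−h0}(1 + O(k·λ^{h−h1}·q)).) -/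
/-- Vertices of the rooted `d`-ary tree of depth `h`: a vertex at level `l ≤ h` is a
path of `l` child-choices from the root. -/
abbrev Vtx (d h : ℕ) := Σ l : Fin (h + 1), Fin (l : ℕ) → Fin d

/-- Leaves of the rooted `d`-ary tree of depth `h`. -/
abbrev Leaf (d h : ℕ) := Fin h → Fin d

/-- Representations: strings of length `k` over the alphabet `Fin q`. -/
abbrev RepSpace (q k : ℕ) := Fin k → Fin q

/-- The root of the tree. -/
def root (d h : ℕ) : Vtx d h := ⟨⟨0, Nat.succ_pos h⟩, fun i => (i : Fin 0).elim0⟩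

/-- The parent of a vertex (the root is its own parent). -/
def parent {d h : ℕ} (v : Vtx d h) : Vtx d h :=
  ⟨⟨(v.1 : ℕ) - 1, by have := v.1.isLt; omega⟩,
    fun i => v.2 ⟨(i : ℕ), lt_of_lt_of_le i.isLt (Nat.sub_le _ _)⟩⟩

/-- The vertex corresponding to a leaf. -/
def leafVtx {d h : ℕ} (f : Leaf d h) : Vtx d h :=
  ⟨⟨h, Nat.lt_succ_self h⟩, fun i => f i⟩

/-- Graph distance between two leaves: twice the number of levels below their deepest
common ancestor. -/
def leafDist {d h : ℕ} (u v : Leaf d h) : ℕ :=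
  2 * (Finset.univ.filter fun i : Fin h => ∃ j : Fin h, j ≤ i ∧ u j ≠ v j).card

/-- One step of the `q`-ary symmetric channel with retention parameter `λ`:
the probability that the child letter is `a` given that the parent letter is `b`. -/
noncomputable def edgeFactor (q : ℕ) (lam : ℝ) (a b : Fin q) : ℝ :=
  lam * (if a = b then 1 else 0) + (1 - lam) / q

/-- The probability mass function of the IIDM (i.i.d. symmetric Markov model) on the
`d`-ary tree of depth `h` with alphabet `Fin q`, string length `k` and retention
parameter `λ`: the root string is uniform and each letter is independently retained
with probability `λ` along each edge and otherwise rerandomized uniformly. -/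
noncomputable def iidmPMF (d h q k : ℕ) (lam : ℝ) (R : Vtx d h → RepSpace q k) : ℝ :=
  (1 / (q : ℝ) ^ k) *
    ∏ v : Vtx d h,
      if (v.1 : ℕ) = 0 then 1
      else ∏ i : Fin k, edgeFactor q lam (R v i) (R (parent v) i)

open Classical in
/-- The probability of an event under the IIDM. -/
noncomputable def iidmProb (d h q k : ℕ) (lam : ℝ)
    (E : (Vtx d h → RepSpace q k) → Prop) : ℝ :=
  ∑ R ∈ Finset.univ.filter (fun R => E R), iidmPMF d h q k lam R

/-- An instance `I(h0,h1)`: a bijective assignment of the `d^{h0}` labels to the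
depth-`h0` vertices, together with, for each depth-`h0` vertex, an (ordered) pair of
extensions down to depth `h1` (describing two depth-`h1` descendants). -/
abbrev Inst (d h0 h1 : ℕ) :=
  ((Fin h0 → Fin d) ≃ Fin (d ^ h0)) ×
    ((Fin h0 → Fin d) → (Fin (h1 - h0) → Fin d) × (Fin (h1 - h0) → Fin d))

/-- An instance is valid when, for each depth-`h0` vertex `u`, the two chosen depth-`h1`
descendants have least common ancestor `u`, i.e. the two extensions differ in their
first step. -/
def ValidInst (d h0 h1 : ℕ) (h01 : h0 < h1) (ins : Inst d h0 h1) : Prop :=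
  ∀ u : Fin h0 → Fin d,
    (ins.2 u).1 ⟨0, by omega⟩ ≠ (ins.2 u).2 ⟨0, by omega⟩

open Classical in
/-- The uniform distribution over valid instances. -/
noncomputable def instPMF (d h0 h1 : ℕ) (h01 : h0 < h1) (ins : Inst d h0 h1) : ℝ :=
  if ValidInst d h0 h1 h01 ins then
    1 / ((Finset.univ.filter fun j : Inst d h0 h1 => ValidInst d h0 h1 h01 j).card : ℝ)
  else 0

/-- The true label of a leaf: the label of its depth-`h0` ancestor. -/
def labelOf (d h h0 h1 : ℕ) (h01 : h0 < h1) (h1h : h1 < h)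
    (ins : Inst d h0 h1) (f : Leaf d h) : Fin (d ^ h0) :=
  ins.1 (fun i : Fin h0 => f ⟨(i : ℕ), by have := i.isLt; omega⟩)

/-- Membership of a leaf in the labeled set `S`: the leaf lies below one of the two
chosen depth-`h1` descendants of its depth-`h0` ancestor. -/
def InLabeledSet (d h h0 h1 : ℕ) (h01 : h0 < h1) (h1h : h1 < h)
    (ins : Inst d h0 h1) (f : Leaf d h) : Prop :=
  (fun i : Fin (h1 - h0) => f ⟨h0 + (i : ℕ), by have := i.isLt; omega⟩) =
      (ins.2 (fun i : Fin h0 => f ⟨(i : ℕ), by have := i.isLt; omega⟩)).1 ∨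
  (fun i : Fin (h1 - h0) => f ⟨h0 + (i : ℕ), by have := i.isLt; omega⟩) =
      (ins.2 (fun i : Fin h0 => f ⟨(i : ℕ), by have := i.isLt; omega⟩)).2

open Classical in
/-- The labeled data `{(R(v), L(v)) : v ∈ S}`, as a multiset of
(representation, label) pairs. -/
noncomputable def labeledData (d h q k h0 h1 : ℕ) (h01 : h0 < h1) (h1h : h1 < h)
    (ins : Inst d h0 h1) (R : Vtx d h → RepSpace q k) :
    Multiset (RepSpace q k × Fin (d ^ h0)) :=
  (Finset.univ.filter fun f : Leaf d h => InLabeledSet d h h0 h1 h01 h1h ins f).val.map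
    (fun f => (R (leafVtx f), labelOf d h h0 h1 h01 h1h ins f))

section Helpers

noncomputable def wkFac (d h q k : ℕ) (lam : ℝ) (v : Vtx d h) (R : Vtx d h → RepSpace q k) : ℝ :=
  if (v.1 : ℕ) = 0 then 1 / (q : ℝ) ^ k
  else ∏ i : Fin k, edgeFactor q lam (R v i) (R (parent v) i)

noncomputable def wkKer (d h q k : ℕ) (lam : ℝ) (v : Vtx d h) (y : RepSpace q k)
    (R : Vtx d h → RepSpace q k) : ℝ :=
  if (v.1 : ℕ) = 0 then 1 / (q : ℝ) ^ k
  else ∏ i : Fin k, edgeFactor q lam (y i) (R (parent v) i)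

open Classical in
noncomputable def wkQ (d h q k : ℕ) (lam : ℝ) (A : Finset (Vtx d h))
    (R : Vtx d h → RepSpace q k) : ℝ :=
  ∏ v : Vtx d h, if v ∈ A then wkFac d h q k lam v R else 1 / (q : ℝ) ^ k

theorem wk_level_zero {d h : ℕ} (v : Vtx d h) (hv : (v.1 : ℕ) = 0) : v = root d h := by
  obtain ⟨⟨l, hl⟩, f⟩ := v
  simp only at hv
  subst hv
  unfold root
  congr 1
  funext i
  exact i.elim0

theorem wk_pmf_eq (d h q k : ℕ) (lam : ℝ) (R : Vtx d h → RepSpace q k) :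
    iidmPMF d h q k lam R = wkQ d h q k lam Finset.univ R := by
  classical
  unfold iidmPMF wkQ wkFac
  have h1 : (1 / (q : ℝ) ^ k) = ∏ v : Vtx d h, if (v.1 : ℕ) = 0 then 1 / (q : ℝ) ^ k else 1 := by
    rw [Finset.prod_eq_single (root d h)]
    · simp [root]
    · intro b _ hb
      rw [if_neg]
      exact fun h0 => hb (wk_level_zero b h0)
    · simp
  rw [h1, ← Finset.prod_mul_distrib]
  apply Finset.prod_congr rfl
  intro v _
  by_cases hv : (v.1 : ℕ) = 0
  · simp only [hv, if_true, Finset.mem_univ, mul_one]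
    rw [← h1]
  · simp [hv]

theorem wk_parent_ne {d h : ℕ} (v : Vtx d h) (hv : (v.1 : ℕ) ≠ 0) : parent v ≠ v := by
  intro e
  have : ((parent v).1 : ℕ) = v.1 := by rw [e]
  simp only [parent] at this
  omega

theorem wk_avg {V X : Type} [Fintype V] [DecidableEq V] [Fintype X] (v : V)
    (Φ : (V → X) → ℝ) :
    ∑ R : V → X, ∑ y : X, Φ (Function.update R v y) = (Fintype.card X : ℝ) * ∑ R, Φ R := by
  classical
  let e : ((V → X) × X) ≃ ((V → X) × X) :=
    { toFun := fun p => (Function.update p.1 v p.2, p.1 v)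
      invFun := fun p => (Function.update p.1 v p.2, p.1 v)
      left_inv := fun p => by ext <;> simp
      right_inv := fun p => by ext <;> simp }
  rw [← Fintype.sum_prod_type' (f := fun R y => Φ (Function.update R v y))]
  have := Equiv.sum_comp e (fun p => Φ p.1)
  simp only [e, Equiv.coe_fn_mk] at this
  rw [this, Fintype.sum_prod_type, Finset.mul_sum]
  simp

theorem wk_step (d h q k : ℕ) (hq : 2 ≤ q) (lam : ℝ) (A : Finset (Vtx d h)) (v : Vtx d h)
    (hv : v ∉ A) (hA : ∀ u ∈ A, (u.1 : ℕ) ≠ 0 → parent u ≠ v)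
    (G : (Vtx d h → RepSpace q k) → ℝ) :
    ∑ R, wkQ d h q k lam (insert v A) R * G R =
      ∑ R, wkQ d h q k lam A R * ∑ y, wkKer d h q k lam v y R * G (Function.update R v y) := by
  classical
  have hqk : ((q : ℝ) ^ k) ≠ 0 := by positivity
  have h1 := wk_avg v (fun R => wkQ d h q k lam (insert v A) R * G R)
  have hc : (Fintype.card (RepSpace q k) : ℝ) = (q : ℝ) ^ k := by simp
  rw [hc] at h1
  apply mul_left_cancel₀ hqk
  rw [← h1, Finset.mul_sum]
  apply Finset.sum_congr rfl
  intro R _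
  rw [← mul_assoc, Finset.mul_sum]
  apply Finset.sum_congr rfl
  intro y _
  rw [← mul_assoc]
  congr 1
  unfold wkQ
  rw [← Finset.mul_prod_erase Finset.univ _ (Finset.mem_univ v),
    ← Finset.mul_prod_erase Finset.univ (fun u => if u ∈ A then wkFac d h q k lam u R else 1 / (q : ℝ) ^ k)
      (Finset.mem_univ v)]
  rw [if_pos (Finset.mem_insert_self v A), if_neg hv]
  have e1 : wkFac d h q k lam v (Function.update R v y) = wkKer d h q k lam v y R := by
    unfold wkFac wkKer
    split_ifs with h0
    · rfl
    · rw [Function.update_self, Function.update_of_ne (wk_parent_ne v h0)]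
  have e2 : ∀ u ∈ Finset.univ.erase v,
      (if u ∈ insert v A then wkFac d h q k lam u (Function.update R v y) else 1 / (q : ℝ) ^ k)
      = if u ∈ A then wkFac d h q k lam u R else 1 / (q : ℝ) ^ k := by
    intro u hu
    have huv : u ≠ v := (Finset.mem_erase.1 hu).1
    simp only [Finset.mem_insert, huv, false_or]
    split_ifs with hu1
    · unfold wkFac
      split_ifs with h0
      · rfl
      · rw [Function.update_of_ne huv, Function.update_of_ne (hA u hu1 h0)]
    · rfl
  rw [Finset.prod_congr rfl e2, e1]
  field_simp

theorem wk_edge_sum (q : ℕ) (hq : 2 ≤ q) (lam mu : ℝ) (x b : Fin q) :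
    ∑ y : Fin q, edgeFactor q lam y b * edgeFactor q mu x y = edgeFactor q (lam * mu) x b := by
  have hq0 : (q : ℝ) ≠ 0 := by positivity
  unfold edgeFactor
  simp only [add_mul, mul_add, Finset.sum_add_distrib]
  simp
  by_cases hxb : x = b
  · simp [hxb]
    field_simp
    ring
  · simp [hxb]
    field_simp
    ring

theorem wk_edge_one (q : ℕ) (hq : 2 ≤ q) (lam : ℝ) (b : Fin q) :
    ∑ y : Fin q, edgeFactor q lam y b = 1 := by
  have hq0 : (q : ℝ) ≠ 0 := by positivity
  unfold edgeFactor
  simp [Finset.sum_add_distrib]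
  field_simp
  ring

theorem wk_ker_sum (d h q k : ℕ) (hq : 2 ≤ q) (lam : ℝ) (v : Vtx d h)
    (R : Vtx d h → RepSpace q k) : ∑ y, wkKer d h q k lam v y R = 1 := by
  unfold wkKer
  split_ifs with h0
  · have : (q : ℝ) ≠ 0 := by positivity
    simp [this]
  · rw [← Fintype.prod_sum (fun i y => edgeFactor q lam y (R (parent v) i))]
    simp [wk_edge_one q hq]

theorem wk_ker_comp (d h q k : ℕ) (hq : 2 ≤ q) (lam mu : ℝ) (v : Vtx d h)
    (hv : (v.1 : ℕ) ≠ 0) (x : RepSpace q k)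
    (R : Vtx d h → RepSpace q k) :
    ∑ y : RepSpace q k, wkKer d h q k lam v y R * ∏ i, edgeFactor q mu (x i) (y i) =
      ∏ i, edgeFactor q (lam * mu) (x i) (R (parent v) i) := by
  unfold wkKer
  simp only [hv, if_false, ← Finset.prod_mul_distrib]
  rw [← Fintype.prod_sum
    (fun i y => edgeFactor q lam y (R (parent v) i) * edgeFactor q mu (x i) y)]
  simp [wk_edge_sum q hq]

/-- marginalization -/
theorem wk_marg (d h q k : ℕ) (hq : 2 ≤ q) (lam : ℝ) (n : ℕ) : ∀ (A : Finset (Vtx d h)),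
    Aᶜ.card = n →
    (∀ u ∈ A, (u.1 : ℕ) ≠ 0 → parent u ∈ A) →
    ∀ (G : (Vtx d h → RepSpace q k) → ℝ),
    (∀ R R', (∀ v ∈ A, R v = R' v) → G R = G R') →
    ∑ R, wkQ d h q k lam Finset.univ R * G R = ∑ R, wkQ d h q k lam A R * G R := by
  classical
  induction n with
  | zero =>
    intro A hA _ G _
    have : A = Finset.univ := by
      rw [Finset.card_eq_zero] at hA
      simpa using hA
    rw [this]
  | succ n ih =>
    intro A hA hcl G hG
    have hne : Aᶜ.Nonempty := by
      rw [← Finset.card_pos]; omega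
    obtain ⟨v, hv, hmin⟩ := Finset.exists_min_image Aᶜ (fun v => (v.1 : ℕ)) hne
    have hvA : v ∉ A := by simpa using hv
    have hpar : ∀ u ∈ insert v A, (u.1 : ℕ) ≠ 0 → parent u ∈ insert v A := by
      intro u hu h0
      rw [Finset.mem_insert] at hu
      apply Finset.mem_insert_of_mem
      rcases hu with rfl | hu
      · by_contra hc
        have := hmin (parent u) (by simpa using hc)
        simp only [parent] at this
        omega
      · exact hcl u hu h0
    rw [ih (insert v A) ?_ hpar G ?_]
    · rw [wk_step d h q k hq lam A v hvA ?_ G]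
      · apply Finset.sum_congr rfl
        intro R _
        congr 1
        have : ∀ y, G (Function.update R v y) = G R := by
          intro y
          apply hG
          intro u hu
          rw [Function.update_of_ne]
          rintro rfl
          exact hvA hu
        simp only [this]
        rw [← Finset.sum_mul, wk_ker_sum d h q k hq, one_mul]
      · intro u hu h0 e
        exact hvA (e ▸ hcl u hu h0)
    · have h2 := Finset.card_compl_add_card A
      have h3 := Finset.card_compl_add_card (insert v A)
      rw [Finset.card_insert_of_notMem hvA] at h3
      omega
    · intro R R' hRR
      exact hG R R' (fun u hu => hRR u (Finset.mem_insert_of_mem hu))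

theorem wk_total (d h q k : ℕ) (hq : 2 ≤ q) (lam : ℝ) :
    ∑ R, iidmPMF d h q k lam R = 1 := by
  classical
  have := wk_marg d h q k hq lam _ ∅ rfl (by simp) (fun _ => 1) (by simp)
  simp only [mul_one] at this
  simp only [wk_pmf_eq]
  rw [this]
  have hq0 : (q : ℝ) ≠ 0 := by positivity
  simp [wkQ]
  field_simp

/-- path vertices -/
def wkPath {d h : ℕ} (w : Leaf d h) (j : ℕ) (hj : j ≤ h) : Vtx d h :=
  ⟨⟨j, by omega⟩, fun i => w ⟨i, by have := i.isLt; simp at this; omega⟩⟩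

theorem wk_path_parent {d h : ℕ} (w : Leaf d h) (j : ℕ) (hj : j + 1 ≤ h) :
    parent (wkPath w (j+1) hj) = wkPath w j (by omega) := rfl

def wkDiff {d h : ℕ} (w : Leaf d h) (h1 : ℕ) (v : Vtx d h) : Prop :=
  ∃ i : ℕ, ∃ (hi : i < (v.1 : ℕ)) (hi2 : i < h), i < h1 ∧ v.2 ⟨i, hi⟩ ≠ w ⟨i, hi2⟩

open Classical in
noncomputable def wkA {d h : ℕ} (w : Leaf d h) (h1 j : ℕ) : Finset (Vtx d h) :=
  Finset.univ.filter fun v => (v.1 : ℕ) ≤ h1 ∨ wkDiff w h1 v ∨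
    ((v.1 : ℕ) ≤ j ∧ ∃ hv, v = wkPath w v.1 hv)

theorem wkA_closed {d h : ℕ} (w : Leaf d h) (h1 j : ℕ) :
    ∀ u ∈ wkA w h1 j, (u.1 : ℕ) ≠ 0 → parent u ∈ wkA w h1 j := by
  intro u hu h0
  simp only [wkA, Finset.mem_filter, Finset.mem_univ, true_and] at hu ⊢
  by_cases hl : (u.1 : ℕ) ≤ h1
  · left; simp only [parent]; omega
  rcases hu with hu | ⟨i, hi, hi2, hi3, hne⟩ | ⟨hu, hv, e⟩
  · exact absurd hu hl
  · right; left
    exact ⟨i, by simp only [parent]; omega, hi2, hi3, hne⟩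
  · right; right
    refine ⟨by simp only [parent]; omega, by simp only [parent]; omega, ?_⟩
    conv_lhs => rw [e]
    rfl

theorem wkA_succ {d h : ℕ} (w : Leaf d h) (h1 j : ℕ) (hj : h1 ≤ j) (hjh : j + 1 ≤ h) :
    wkA w h1 (j+1) = insert (wkPath w (j+1) hjh) (wkA w h1 j) ∧
      wkPath w (j+1) hjh ∉ wkA w h1 j := by
  classical
  constructor
  · ext v
    simp only [wkA, Finset.mem_filter, Finset.mem_univ, true_and, Finset.mem_insert]
    constructor
    · rintro (hu | hu | ⟨hu, hv, e⟩)
      · tauto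
      · tauto
      · by_cases hl : (v.1 : ℕ) ≤ j
        · right; right; right; exact ⟨hl, hv, e⟩
        · left
          have : (v.1 : ℕ) = j + 1 := by omega
          rw [e]
          congr 1
    · rintro (rfl | hu | hu | ⟨hu, hv, e⟩)
      · right; right
        exact ⟨le_refl _, hjh, rfl⟩
      · tauto
      · tauto
      · right; right; exact ⟨by omega, hv, e⟩
  · simp only [wkA, Finset.mem_filter, Finset.mem_univ, true_and]
    rintro (hu | ⟨i, hi, hi2, hi3, hne⟩ | ⟨hu, hv, e⟩)
    · simp only [wkPath] at hu; omega
    · exact hne rfl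
    · simp only [wkPath] at hu; omega

theorem wk_path_sum (d h q k h1 : ℕ) (hq : 2 ≤ q) (lam : ℝ) (h1h : h1 < h) (w : Leaf d h)
    (x : RepSpace q k) (F : (Vtx d h → RepSpace q k) → ℝ)
    (hF : ∀ R R', (∀ v ∈ wkA w h1 h1, R v = R' v) → F R = F R')
    (n : ℕ) : ∀ hn : h1 + n ≤ h, ∀ mu : ℝ,
    ∑ R, wkQ d h q k lam (wkA w h1 (h1 + n)) R *
        ((∏ i, edgeFactor q mu (x i) (R (wkPath w (h1 + n) hn) i)) * F R) =
      ∑ R, wkQ d h q k lam (wkA w h1 h1) R *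
        ((∏ i, edgeFactor q (lam ^ n * mu) (x i) (R (wkPath w h1 (by omega)) i)) * F R) := by
  classical
  induction n with
  | zero => intro hn mu; simp
  | succ n ih =>
    intro hn mu
    obtain ⟨e1, e2⟩ := wkA_succ w h1 (h1 + n) (by omega) hn
    have hmono : wkA w h1 h1 ⊆ wkA w h1 (h1 + n) := by
      intro v hv
      simp only [wkA, Finset.mem_filter, Finset.mem_univ, true_and] at hv ⊢
      rcases hv with hv | hv | ⟨hv, hv'⟩
      · tauto
      · tauto
      · left; exact hv
    have e1' : wkA w h1 (h1 + (n + 1)) =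
      insert (wkPath w (h1 + n + 1) hn) (wkA w h1 (h1 + n)) := e1
    rw [e1', wk_step d h q k hq lam _ _ e2]
    · have : lam ^ (n+1) * mu = lam ^ n * (lam * mu) := by ring
      rw [this, ← ih (by omega) (lam * mu)]
      apply Finset.sum_congr rfl
      intro R _
      congr 1
      rw [← wk_path_parent w (h1 + n) hn,
        ← wk_ker_comp d h q k hq lam mu (wkPath w (h1 + n + 1) hn) (by simp [wkPath]) x R,
        Finset.sum_mul]
      apply Finset.sum_congr rfl
      intro y _
      have : F (Function.update R (wkPath w (h1 + n + 1) hn) y) = F R := by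
        apply hF
        intro v hv
        rw [Function.update_of_ne]
        rintro rfl
        exact e2 (hmono hv)
      have hs : Function.update R (wkPath w (h1 + n + 1) hn) y (wkPath w (h1 + (n + 1)) hn) = y :=
        Function.update_self ..
      rw [this, hs, mul_assoc]
    · intro u hu h0 e
      exact e2 (e ▸ wkA_closed w h1 (h1+n) u hu h0)

theorem wkQ_nonneg (d h q k : ℕ) (lam : ℝ) (hlam0 : 0 ≤ lam) (hlam1 : lam < 1)
    (A : Finset (Vtx d h)) (R : Vtx d h → RepSpace q k) : 0 ≤ wkQ d h q k lam A R := by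
  unfold wkQ wkFac edgeFactor
  have : 0 ≤ 1 - lam := by linarith
  apply Finset.prod_nonneg
  intro v _
  split_ifs
  · positivity
  · apply Finset.prod_nonneg
    intro i _
    split_ifs <;> positivity
  · positivity

theorem wk_main (d h q k h1 : ℕ) (hq : 2 ≤ q) (lam : ℝ) (hlam0 : 0 ≤ lam) (hlam1 : lam < 1)
    (h1h : h1 < h) (w : Leaf d h)
    (x : RepSpace q k) (F : (Vtx d h → RepSpace q k) → ℝ) (hF0 : ∀ R, 0 ≤ F R)
    (hF : ∀ R R', (∀ v ∈ wkA w h1 h1, R v = R' v) → F R = F R') :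
    ∑ R, iidmPMF d h q k lam R * ((if R (leafVtx w) = x then 1 else 0) * F R) ≤
      (lam ^ (h - h1) + (1 - lam ^ (h - h1)) / q) ^ k * ∑ R, iidmPMF d h q k lam R * F R := by
  classical
  simp only [wk_pmf_eq]
  have hind : ∀ R : Vtx d h → RepSpace q k, (if R (leafVtx w) = x then (1:ℝ) else 0) =
      ∏ i, edgeFactor q 1 (x i) (R (leafVtx w) i) := by
    intro R
    unfold edgeFactor
    simp only [sub_self, zero_div, add_zero, one_mul]
    rw [Finset.prod_boole]
    congr 1
    simp only [Finset.mem_univ, true_imp_iff, funext_iff, eq_comm]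
  simp only [hind]
  obtain ⟨n, hn⟩ : ∃ n, h = h1 + n := ⟨h - h1, by omega⟩
  have hmono : wkA w h1 h1 ⊆ wkA w h1 h := by
    intro v hv
    simp only [wkA, Finset.mem_filter, Finset.mem_univ, true_and] at hv ⊢
    rcases hv with hv | hv | ⟨hv, hv'⟩
    · tauto
    · tauto
    · left; exact hv
  have hleaf : leafVtx w ∈ wkA w h1 h := by
    simp only [wkA, Finset.mem_filter, Finset.mem_univ, true_and]
    right; right
    exact ⟨le_refl _, le_refl _, rfl⟩
  rw [wk_marg d h q k hq lam _ (wkA w h1 h) rfl (wkA_closed w h1 h)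
    (fun R => (∏ i, edgeFactor q 1 (x i) (R (leafVtx w) i)) * F R) ?_,
    wk_marg d h q k hq lam _ (wkA w h1 h1) rfl (wkA_closed w h1 h1) F hF]
  · have := wk_path_sum d h q k h1 hq lam h1h w x F hF n (by omega) 1
    have e : ∀ m (hm : m = h) (hm' : m ≤ h), wkPath w m hm' = leafVtx w := by
      intro m hm hm'
      subst hm
      rfl
    rw [e _ hn.symm] at this
    simp only [← hn] at this
    rw [this, Finset.mul_sum]
    apply Finset.sum_le_sum
    intro R _
    have hQ := wkQ_nonneg d h q k lam hlam0 hlam1 (wkA w h1 h1) R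
    have hb : (∏ i, edgeFactor q (lam ^ n * 1) (x i) (R (wkPath w h1 h1h.le) i)) ≤
        (lam ^ (h - h1) + (1 - lam ^ (h - h1)) / q) ^ k := by
      have hnn : h - h1 = n := by omega
      rw [hnn, mul_one]
      have hp0 : 0 ≤ lam ^ n := by positivity
      have hp1 : 0 ≤ 1 - lam ^ n := by
        have := pow_le_one₀ (n := n) hlam0 hlam1.le
        linarith
      calc _ ≤ ∏ i : Fin k, (lam ^ n + (1 - lam ^ n) / q) := by
            apply Finset.prod_le_prod
            · intro i _
              unfold edgeFactor
              split_ifs <;> positivity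
            · intro i _
              unfold edgeFactor
              split_ifs <;> simp [hp0]
        _ = _ := by simp
    calc _ ≤ wkQ d h q k lam (wkA w h1 h1) R *
          ((lam ^ (h - h1) + (1 - lam ^ (h - h1)) / q) ^ k * F R) :=
          mul_le_mul_of_nonneg_left (mul_le_mul_of_nonneg_right hb (hF0 R)) hQ
      _ = _ := by ring
  · intro R R' hRR
    rw [hRR _ hleaf, hF R R' (fun v hv => hRR v (hmono hv))]


theorem wk_local (d h q k h0 h1 : ℕ) (h01 : h0 < h1) (h1h : h1 < h) (ins : Inst d h0 h1)
    (w : Leaf d h) (hw : ¬ InLabeledSet d h h0 h1 h01 h1h ins w)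
    (R R' : Vtx d h → RepSpace q k) (hR : ∀ v ∈ wkA w h1 h1, R v = R' v) :
    labeledData d h q k h0 h1 h01 h1h ins R = labeledData d h q k h0 h1 h01 h1h ins R' := by
  classical
  unfold labeledData
  apply Multiset.map_congr rfl
  intro f hf
  have hf' : InLabeledSet d h h0 h1 h01 h1h ins f := by
    simpa using hf
  rw [hR]
  simp only [wkA, Finset.mem_filter, Finset.mem_univ, true_and]
  right; left
  by_contra hc
  apply hw
  have he : ∀ i (hi : i < h), i < h1 → f ⟨i, hi⟩ = w ⟨i, hi⟩ := by
    intro i hi hi1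
    by_contra hne
    exact hc ⟨i, hi, hi, hi1, hne⟩
  have e1 : (fun i : Fin h0 => w ⟨(i : ℕ), by have := i.isLt; omega⟩) =
      (fun i : Fin h0 => f ⟨(i : ℕ), by have := i.isLt; omega⟩) := by
    funext i
    exact (he _ _ (by have := i.isLt; omega)).symm
  have e2 : (fun i : Fin (h1 - h0) => w ⟨h0 + (i : ℕ), by have := i.isLt; omega⟩) =
      (fun i : Fin (h1 - h0) => f ⟨h0 + (i : ℕ), by have := i.isLt; omega⟩) := by
    funext i
    exact (he _ _ (by have := i.isLt; omega)).symm
  unfold InLabeledSet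
  rw [e1, e2]
  exact hf'

def wkSplit (d h h0 h1 : ℕ) (h01 : h0 < h1) (h1h : h1 < h) :
    Leaf d h ≃ (Fin h0 → Fin d) × (Fin (h1 - h0) → Fin d) × (Fin (h - h1) → Fin d) where
  toFun f := (fun i => f ⟨(i : ℕ), by have := i.isLt; omega⟩,
    fun i => f ⟨h0 + (i : ℕ), by have := i.isLt; omega⟩,
    fun i => f ⟨h1 + (i : ℕ), by have := i.isLt; omega⟩)
  invFun p i := if a : (i : ℕ) < h0 then p.1 ⟨i, a⟩
    else if b : (i : ℕ) < h1 then p.2.1 ⟨i - h0, by omega⟩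
    else p.2.2 ⟨i - h1, by have := i.isLt; omega⟩
  left_inv f := by
    funext i
    dsimp only
    split_ifs with a b
    · rfl
    · congr 1; ext; simp; omega
    · congr 1; ext; simp; omega
  right_inv p := by
    obtain ⟨p1, p2, p3⟩ := p
    simp only [Prod.mk.injEq]
    refine ⟨?_, ?_, ?_⟩
    · funext i; simp
    · funext i
      have := i.isLt
      have a : ¬ (h0 + (i : ℕ) < h0) := by omega
      have b : h0 + (i : ℕ) < h1 := by omega
      simp [b]
    · funext i
      have a : ¬ (h1 + (i : ℕ) < h0) := by omega
      have b : ¬ (h1 + (i : ℕ) < h1) := by omega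
      simp [a]

open Classical in
theorem wk_fiber_card (d h h0 h1 : ℕ) (h01 : h0 < h1) (h1h : h1 < h) (ins : Inst d h0 h1)
    (hv : ValidInst d h0 h1 h01 ins) (l : Fin (d ^ h0)) :
    (Finset.univ.filter fun w : Leaf d h => ¬ InLabeledSet d h h0 h1 h01 h1h ins w ∧
      labelOf d h h0 h1 h01 h1h ins w = l).card = (d ^ (h1 - h0) - 2) * d ^ (h - h1) := by
  set u := ins.1.symm l with hu
  have hne : (ins.2 u).1 ≠ (ins.2 u).2 := fun e => hv u (by rw [e])
  rw [Finset.card_equiv (wkSplit d h h0 h1 h01 h1h)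
    (t := {u} ×ˢ (({(ins.2 u).1, (ins.2 u).2} : Finset (Fin (h1 - h0) → Fin d))ᶜ ×ˢ
      (Finset.univ : Finset (Fin (h - h1) → Fin d))))]
  · rw [Finset.card_product, Finset.card_product, Finset.card_compl, Finset.card_pair hne]
    simp
  · intro w
    simp only [Finset.mem_filter, Finset.mem_univ, true_and, Finset.mem_product,
      Finset.mem_singleton, Finset.mem_compl, Finset.mem_insert, and_true]
    have hl : labelOf d h h0 h1 h01 h1h ins w = l ↔ (wkSplit d h h0 h1 h01 h1h w).1 = u := by
      rw [hu, Equiv.eq_symm_apply]; rfl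
    have hS : InLabeledSet d h h0 h1 h01 h1h ins w ↔
      ((wkSplit d h h0 h1 h01 h1h w).2.1 = (ins.2 (wkSplit d h h0 h1 h01 h1h w).1).1 ∨
        (wkSplit d h h0 h1 h01 h1h w).2.1 = (ins.2 (wkSplit d h h0 h1 h01 h1h w).1).2) := Iff.rfl
    rw [hl, hS]
    constructor
    · rintro ⟨a, b⟩
      rw [b] at a
      exact ⟨b, a⟩
    · rintro ⟨b, a⟩
      rw [b]
      exact ⟨a, rfl⟩

open Classical in
theorem wk_label (d h h0 h1 : ℕ) (hd : 2 ≤ d) (h01 : h0 < h1) (h1h : h1 < h) (ins : Inst d h0 h1)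
    (hv : ValidInst d h0 h1 h01 ins) (l : Fin (d ^ h0)) :
    ∑ w : Leaf d h, (if InLabeledSet d h h0 h1 h01 h1h ins w then 0
           else 1 / ((Finset.univ.filter fun f : Leaf d h =>
              ¬ InLabeledSet d h h0 h1 h01 h1h ins f).card : ℝ)) *
        (if l = labelOf d h h0 h1 h01 h1h ins w then 1 else 0) ≤ 1 / (d : ℝ) ^ h0 := by
  set N := (d ^ (h1 - h0) - 2) * d ^ (h - h1) with hN
  have hc : (Finset.univ.filter fun f : Leaf d h =>
              ¬ InLabeledSet d h h0 h1 h01 h1h ins f).card = d ^ h0 * N := by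
    rw [Finset.card_eq_sum_card_fiberwise (f := labelOf d h h0 h1 h01 h1h ins)
      (t := Finset.univ) (by simp)]
    simp only [Finset.filter_filter, wk_fiber_card d h h0 h1 h01 h1h ins hv]
    simp [hN]
  rw [hc]
  have : ∀ w : Leaf d h, (if InLabeledSet d h h0 h1 h01 h1h ins w then (0 : ℝ)
           else 1 / ((d ^ h0 * N : ℕ) : ℝ)) *
        (if l = labelOf d h h0 h1 h01 h1h ins w then 1 else 0) =
      if (¬ InLabeledSet d h h0 h1 h01 h1h ins w ∧ labelOf d h h0 h1 h01 h1h ins w = l)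
        then 1 / ((d ^ h0 * N : ℕ) : ℝ) else 0 := by
    intro w
    by_cases a : InLabeledSet d h h0 h1 h01 h1h ins w
    · simp [a]
    · by_cases b : labelOf d h h0 h1 h01 h1h ins w = l
      · simp [a, b]
      · simp [a, b, Ne.symm b]
  simp only [this]
  rw [← Finset.sum_filter, Finset.sum_const, wk_fiber_card d h h0 h1 h01 h1h ins hv, ← hN,
    nsmul_eq_mul]
  push_cast
  rcases Nat.eq_zero_or_pos N with h0' | hpos
  · rw [h0']; simp
  · have : (N : ℝ) ≠ 0 := by positivity
    apply le_of_eq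
    field_simp

theorem wk_inst_sum (d h0 h1 : ℕ) (h01 : h0 < h1) : ∑ ins, instPMF d h0 h1 h01 ins ≤ 1 := by
  classical
  unfold instPMF
  rw [← Finset.sum_filter, Finset.sum_const, nsmul_eq_mul, mul_one_div]
  convert div_self_le_one _
  infer_instance

theorem wk_fixed (d h q k h0 h1 : ℕ) (lam : ℝ) (hq : 2 ≤ q)
    (h01 : h0 < h1) (h1h : h1 < h)
    (hlam0 : 0 ≤ lam) (hlam1 : lam < 1)
    (g : RepSpace q k → Multiset (RepSpace q k × Fin (d ^ h0)) → Fin (d ^ h0))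
    (ins : Inst d h0 h1) (w : Leaf d h) (hw : ¬ InLabeledSet d h h0 h1 h01 h1h ins w)
    (l : Fin (d ^ h0)) :
    ∑ R, iidmPMF d h q k lam R *
      (if g (R (leafVtx w)) (labeledData d h q k h0 h1 h01 h1h ins R) = l then 1 else 0) ≤
    (lam ^ (h - h1) + (1 - lam ^ (h - h1)) / q) ^ k * ∑ x : RepSpace q k,
      ∑ R, iidmPMF d h q k lam R *
        (if g x (labeledData d h q k h0 h1 h01 h1h ins R) = l then 1 else 0) := by
  classical
  have e : ∀ R : Vtx d h → RepSpace q k, iidmPMF d h q k lam R *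
      (if g (R (leafVtx w)) (labeledData d h q k h0 h1 h01 h1h ins R) = l then (1 : ℝ) else 0) =
      ∑ x : RepSpace q k, iidmPMF d h q k lam R * ((if R (leafVtx w) = x then 1 else 0) *
        (if g x (labeledData d h q k h0 h1 h01 h1h ins R) = l then (1 : ℝ) else 0)) := by
    intro R
    rw [← Finset.mul_sum]
    congr 1
    rw [Finset.sum_eq_single (R (leafVtx w))]
    · simp
    · intro b _ hb
      simp [hb.symm]
    · simp
  simp only [e]
  rw [Finset.sum_comm, Finset.mul_sum]
  apply Finset.sum_le_sum
  intro x _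
  apply wk_main d h q k h1 hq lam hlam0 hlam1 h1h w x
  · intro R; split_ifs <;> simp
  · intro R R' hR
    rw [wk_local d h q k h0 h1 h01 h1h ins w hw R R' hR]

end Helpers

open Classical in
/-- Weakness of local learning: for the IIDM together with an independent random
instance `I(h0,h1)` and a uniformly random unlabeled leaf `w`, any (possibly randomized)
local algorithm `g` — a function of `R(w)`, the labeled data `{(R(v), L(v)) : v ∈ S}`
and independent external randomness — outputs the true label of `w` with probability at
most `d^{−h0}·(1 + q·λ^{h−h1}/(1 − λ^{h−h1}))^k`. -/
theorem weakness_of_local_algorithms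
    (d h q k h0 h1 : ℕ) (lam : ℝ)
    (hd : 2 ≤ d) (hq : 2 ≤ q) (hk : 1 ≤ k)
    (hh0 : 0 < h0) (h01 : h0 < h1) (h1h : h1 < h)
    (hlam0 : 0 ≤ lam) (hlam1 : lam < 1)
    (Z : Type) [Fintype Z] (ζ : Z → ℝ) (hζ0 : ∀ z, 0 ≤ ζ z) (hζ1 : ∑ z, ζ z = 1)
    (g : RepSpace q k → Multiset (RepSpace q k × Fin (d ^ h0)) → Z → Fin (d ^ h0)) :
    (∑ R : Vtx d h → RepSpace q k, ∑ ins : Inst d h0 h1, ∑ w : Leaf d h, ∑ z : Z,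
        iidmPMF d h q k lam R * instPMF d h0 h1 h01 ins *
          (if InLabeledSet d h h0 h1 h01 h1h ins w then 0
           else 1 / ((Finset.univ.filter fun f : Leaf d h =>
              ¬ InLabeledSet d h h0 h1 h01 h1h ins f).card : ℝ)) *
          ζ z *
          (if g (R (leafVtx w)) (labeledData d h q k h0 h1 h01 h1h ins R) z =
              labelOf d h h0 h1 h01 h1h ins w then 1 else 0)) ≤
      (1 / (d : ℝ) ^ h0) * (1 + q * lam ^ (h - h1) / (1 - lam ^ (h - h1))) ^ k := by
  have hp : ∀ R, 0 ≤ iidmPMF d h q k lam R := fun R => by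
    rw [wk_pmf_eq]; exact wkQ_nonneg d h q k lam hlam0 hlam1 _ R
  have hI : ∀ ins, 0 ≤ instPMF d h0 h1 h01 ins := fun ins => by
    unfold instPMF; split_ifs <;> positivity
  set c : Inst d h0 h1 → Leaf d h → ℝ := fun ins w =>
    (if InLabeledSet d h h0 h1 h01 h1h ins w then 0
           else 1 / ((Finset.univ.filter fun f : Leaf d h =>
              ¬ InLabeledSet d h h0 h1 h01 h1h ins f).card : ℝ)) with hc
  have hc0 : ∀ ins w, 0 ≤ c ins w := fun ins w => by
    simp only [hc]; split_ifs <;> positivity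
  set B : ℝ := (lam ^ (h - h1) + (1 - lam ^ (h - h1)) / q) ^ k with hB
  have hm0 : 0 ≤ lam ^ (h - h1) := by positivity
  have hm1 : lam ^ (h - h1) < 1 := pow_lt_one₀ hlam0 hlam1 (by omega)
  have hm1' : 0 < 1 - lam ^ (h - h1) := by linarith
  have hq0 : (0 : ℝ) < q := by positivity
  have hB0 : 0 ≤ B := by positivity
  have hd0 : (0 : ℝ) < d := by positivity
  set χ : (Vtx d h → RepSpace q k) → Inst d h0 h1 → RepSpace q k → Leaf d h → Z → ℝ :=
    fun R ins x w z => (if g x (labeledData d h q k h0 h1 h01 h1h ins R) z =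
              labelOf d h h0 h1 h01 h1h ins w then 1 else 0) with hχ
  calc _ = ∑ ins, ∑ z, ∑ w, instPMF d h0 h1 h01 ins * ζ z * (c ins w *
          ∑ R, iidmPMF d h q k lam R * χ R ins (R (leafVtx w)) w z) := by
        rw [Finset.sum_comm]
        apply Finset.sum_congr rfl
        intro ins _
        simp only [Finset.mul_sum]
        rw [Finset.sum_comm, Finset.sum_comm (s := (Finset.univ : Finset Z))]
        apply Finset.sum_congr rfl
        intro w _
        rw [Finset.sum_comm]
        apply Finset.sum_congr rfl
        intro z _
        apply Finset.sum_congr rfl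
        intro R _
        simp only [hc, hχ]
        ring
    _ ≤ ∑ ins, ∑ z, ∑ w, instPMF d h0 h1 h01 ins * ζ z * (c ins w *
          (B * ∑ x : RepSpace q k, ∑ R, iidmPMF d h q k lam R * χ R ins x w z)) := by
        apply Finset.sum_le_sum; intro ins _
        apply Finset.sum_le_sum; intro z _
        apply Finset.sum_le_sum; intro w _
        apply mul_le_mul_of_nonneg_left _ (mul_nonneg (hI ins) (hζ0 z))
        by_cases hw : InLabeledSet d h h0 h1 h01 h1h ins w
        · simp [hc, hw]
        · apply mul_le_mul_of_nonneg_left _ (hc0 ins w)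
          have := wk_fixed d h q k h0 h1 lam hq h01 h1h hlam0 hlam1 (fun x D => g x D z) ins w hw
            (labelOf d h h0 h1 h01 h1h ins w)
          simp only [hχ, hB]
          convert this
    _ = ∑ ins, ∑ z, instPMF d h0 h1 h01 ins * ζ z * (B * ∑ x : RepSpace q k, ∑ R,
          iidmPMF d h q k lam R * ∑ w, c ins w * χ R ins x w z) := by
        apply Finset.sum_congr rfl; intro ins _
        apply Finset.sum_congr rfl; intro z _
        rw [← Finset.mul_sum]
        congr 1
        simp only [Finset.mul_sum]
        rw [Finset.sum_comm]
        apply Finset.sum_congr rfl; intro x _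
        rw [Finset.sum_comm]
        apply Finset.sum_congr rfl; intro R _
        apply Finset.sum_congr rfl; intro w _
        ring
    _ ≤ ∑ ins, ∑ z, instPMF d h0 h1 h01 ins * ζ z * (B * ∑ x : RepSpace q k, ∑ R,
          iidmPMF d h q k lam R * (1 / (d : ℝ) ^ h0)) := by
        apply Finset.sum_le_sum; intro ins _
        apply Finset.sum_le_sum; intro z _
        by_cases hv : ValidInst d h0 h1 h01 ins
        · apply mul_le_mul_of_nonneg_left _ (mul_nonneg (hI ins) (hζ0 z))
          apply mul_le_mul_of_nonneg_left _ hB0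
          apply Finset.sum_le_sum; intro x _
          apply Finset.sum_le_sum; intro R _
          apply mul_le_mul_of_nonneg_left _ (hp R)
          exact wk_label d h h0 h1 hd h01 h1h ins hv _
        · simp [instPMF, hv]
    _ = (∑ ins, instPMF d h0 h1 h01 ins) * ((1 / (d : ℝ) ^ h0) * (B * (q : ℝ) ^ k)) := by
        simp only [← Finset.sum_mul, wk_total d h q k hq lam, ← Finset.mul_sum, hζ1]
        simp
        left
        ring
    _ ≤ 1 * ((1 / (d : ℝ) ^ h0) * (B * (q : ℝ) ^ k)) :=
        mul_le_mul_of_nonneg_right (wk_inst_sum d h0 h1 h01) (by positivity)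
    _ ≤ _ := by
        rw [one_mul]
        apply mul_le_mul_of_nonneg_left _ (by positivity)
        rw [hB, ← mul_pow]
        apply pow_le_pow_left₀ (by positivity)
        set m := lam ^ (h - h1)
        have e1 : (m + (1 - m) / q) * q = q * m + (1 - m) := by field_simp
        have e2 : q * m ≤ q * m / (1 - m) := by
          rw [le_div_iff₀ hm1']
          have : 0 ≤ (q : ℝ) * m := by positivity
          nlinarith
        rw [e1]
        linarith
end

section
/- Fix 0 < h0 < h1 < h and assume d·λ² < 1. Let A = (A_1,…,A_m) with each A_j ⊆ {1,…,k} of size at most s. Then there exist constants c > 0 and C > 0, depending only on d, q, λ and s (but not on h, h0, h1, m or k), such that for the IIDM together with an independent random instance I(h0,h1), every (possibly randomized) shallow algorithm, i.e. every function g whose output label for a uniformly random leaf w of L_T ∖ S depends only on the compression C_A(D) and independent external randomness, labels w correctly with probability at most d^{−h0} + C·m·d^{h0}·exp(−c·(h−h1)). (Theorem 'weakness of shallow learning'.) -/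
open Classical in
/-- The unlabeled part of the data: the representations `R(v)` of the leaves
`v ∈ L_T ∖ S` (given uncompressed). -/
noncomputable def unlabeledData (d h q k h0 h1 : ℕ) (h01 : h0 < h1) (h1h : h1 < h)
    (ins : Inst d h0 h1) (R : Vtx d h → RepSpace q k) :
    Leaf d h → Option (RepSpace q k) :=
  fun f => if InLabeledSet d h h0 h1 h01 h1h ins f then none else some (R (leafVtx f))

open Classical in
/-- The count part of the compression `C_A(D)`: for each `j ≤ m`, each
`x ∈ (Fin q)^{A_j}` and each label `ℓ`, the number
`n_D(A_j, x, ℓ) = #{v ∈ S : L(v) = ℓ, R(v)|_{A_j} = x}`. -/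
noncomputable def countsOf (d h q k h0 h1 m : ℕ) (h01 : h0 < h1) (h1h : h1 < h)
    (A : Fin m → Finset (Fin k)) (ins : Inst d h0 h1) (R : Vtx d h → RepSpace q k) :
    (j : Fin m) → ({i // i ∈ A j} → Fin q) → Fin (d ^ h0) → ℕ :=
  fun j x ℓ =>
    (Finset.univ.filter fun f : Leaf d h =>
      InLabeledSet d h h0 h1 h01 h1h ins f ∧
      labelOf d h h0 h1 h01 h1h ins f = ℓ ∧
      ∀ i : {i // i ∈ A j}, R (leafVtx f) i.1 = x i).card

theorem wsa_mass {ι β : Type*} [Fintype ι] [DecidableEq ι] [Fintype β]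
    (K : ι → β → ℝ) (hK : ∀ i, ∑ y, K i y = 1) :
    ∑ X : ι → β, ∏ i, K i (X i) = 1 := by
  classical
  rw [← Fintype.piFinset_univ, ← Finset.prod_univ_sum]
  simp [hK]

theorem wsa_resample {ι β : Type*} [Fintype ι] [DecidableEq ι] [Fintype β]
    (K : ι → β → ℝ) (i : ι) (K' : β → ℝ) (hK : ∑ y, K i y = 1) (F : (ι → β) → ℝ) :
    ∑ X : ι → β, (∏ j, (Function.update K i K') j (X j)) * F X =
      ∑ X : ι → β, (∏ j, K j (X j)) * ∑ y, K' y * F (Function.update X i y) := by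
  have e1 : ∑ X : ι → β, (∏ j, (Function.update K i K') j (X j)) * F X
      = ∑ p : (ι → β) × β, (∏ j, (Function.update K i K') j (p.1 j)) * F p.1 * K i p.2 := by
    rw [Fintype.sum_prod_type]
    simp_rw [← Finset.mul_sum, hK, mul_one]
  have e2 : ∑ X : ι → β, (∏ j, K j (X j)) * ∑ y, K' y * F (Function.update X i y)
      = ∑ p : (ι → β) × β, (∏ j, K j (p.1 j)) * (K' p.2 * F (Function.update p.1 i p.2)) := by
    rw [Fintype.sum_prod_type]
    simp_rw [← Finset.mul_sum]
  rw [e1, e2]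
  have inv : Function.Involutive
      (fun p : (ι → β) × β => (Function.update p.1 i p.2, p.1 i)) := by
    intro p; simp
  refine Fintype.sum_equiv inv.toPerm _ _ ?_
  rintro ⟨X, y⟩
  simp only [Function.Involutive.coe_toPerm, Function.update_idem, Function.update_eq_self]
  have h1 : ∏ j, (Function.update K i K') j (X j)
      = K' (X i) * ∏ j ∈ Finset.univ.erase i, K j (X j) := by
    rw [← Finset.mul_prod_erase _ _ (Finset.mem_univ i)]
    congr 1
    · simp
    · refine Finset.prod_congr rfl fun j hj => ?_
      rw [Function.update_of_ne (Finset.ne_of_mem_erase hj)]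
  have h2 : ∏ j, K j (Function.update X i y j)
      = K i y * ∏ j ∈ Finset.univ.erase i, K j (X j) := by
    rw [← Finset.mul_prod_erase _ _ (Finset.mem_univ i)]
    congr 1
    · simp
    · refine Finset.prod_congr rfl fun j hj => ?_
      rw [Function.update_of_ne (Finset.ne_of_mem_erase hj)]
  rw [h1, h2]; ring

theorem wsa_lip {ι α β : Type*} [Fintype ι] [DecidableEq ι] [Fintype β] [DecidableEq α]
    (K : α → β → ℝ) (hK0 : ∀ a y, 0 ≤ K a y) (hK : ∀ a, ∑ y, K a y = 1)
    (F : (ι → β) → ℝ) (δ : ι → ℝ) (Y Y' : ι → α)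
    (hδ : ∀ i, Y i ≠ Y' i → ∀ X a b,
      |∑ y, (K a y - K b y) * F (Function.update X i y)| ≤ δ i) :
    |∑ X : ι → β, (∏ i, K (Y i) (X i)) * F X - ∑ X : ι → β, (∏ i, K (Y' i) (X i)) * F X|
      ≤ ∑ i, if Y i ≠ Y' i then δ i else 0 := by
  have key : ∀ s : Finset ι,
      |∑ X : ι → β, (∏ i, K (Y i) (X i)) * F X
        - ∑ X : ι → β, (∏ i, K (if i ∈ s then Y' i else Y i) (X i)) * F X|
      ≤ ∑ i ∈ s, if Y i ≠ Y' i then δ i else 0 := by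
    intro s
    induction s using Finset.induction_on with
    | empty => simp
    | insert a s ha ih =>
      rw [Finset.sum_insert ha]
      by_cases hY : Y a = Y' a
      · have : ∀ i, (if i ∈ insert a s then Y' i else Y i) = (if i ∈ s then Y' i else Y i) := by
          intro i
          by_cases h : i = a
          · subst h; simp [ha, hY]
          · simp [h]
        simp_rw [this]
        simpa [hY] using ih
      · set L : ι → β → ℝ := fun i => K (if i ∈ s then Y' i else Y i) with hL
        have h1 : ∑ X : ι → β, (∏ i, K (if i ∈ s then Y' i else Y i) (X i)) * F X
            = ∑ X : ι → β, (∏ j, L j (X j)) * ∑ y, L a y * F (Function.update X a y) := by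
          rw [← wsa_resample L a (L a) (hK _) F, Function.update_eq_self]
        have h2 : ∑ X : ι → β, (∏ i, K (if i ∈ insert a s then Y' i else Y i) (X i)) * F X
            = ∑ X : ι → β, (∏ j, L j (X j)) * ∑ y, K (Y' a) y * F (Function.update X a y) := by
          rw [← wsa_resample L a (K (Y' a)) (hK _) F]
          refine Finset.sum_congr rfl fun X _ => ?_
          congr 1
          refine Finset.prod_congr rfl fun j _ => ?_
          by_cases h : j = a
          · subst h; simp
          · simp [h, hL]
        have h3 : |∑ X : ι → β, (∏ i, K (if i ∈ s then Y' i else Y i) (X i)) * F X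
            - ∑ X : ι → β, (∏ i, K (if i ∈ insert a s then Y' i else Y i) (X i)) * F X| ≤ δ a := by
          rw [h1, h2, ← Finset.sum_sub_distrib]
          calc _ ≤ ∑ X : ι → β, |(∏ j, L j (X j)) * ∑ y, L a y * F (Function.update X a y) -
                (∏ j, L j (X j)) * ∑ y, K (Y' a) y * F (Function.update X a y)| :=
                Finset.abs_sum_le_sum_abs _ _
            _ ≤ ∑ X : ι → β, (∏ j, L j (X j)) * δ a := by
                refine Finset.sum_le_sum fun X _ => ?_
                rw [← mul_sub, abs_mul, abs_of_nonneg (Finset.prod_nonneg fun j _ => hK0 _ _)]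
                refine mul_le_mul_of_nonneg_left ?_ (Finset.prod_nonneg fun j _ => hK0 _ _)
                rw [← Finset.sum_sub_distrib]
                simp_rw [← sub_mul]
                exact hδ a hY X _ _
            _ = δ a := by
                rw [← Finset.sum_mul, wsa_mass L (fun i => hK _), one_mul]
        rw [if_pos hY]
        calc _ ≤ _ := abs_sub_le _ (∑ X : ι → β, (∏ i, K (if i ∈ s then Y' i else Y i) (X i)) * F X) _
          _ ≤ _ := by linarith
  simpa using key Finset.univ

/-- push-forward of a product -/
theorem wsa_push {ι β Ω : Type*} [Fintype ι] [DecidableEq ι] [Fintype β] [DecidableEq β] [Fintype Ω]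
    (K : ι → β → ℝ) (w : Ω → ℝ) (r : ι → Ω → β)
    (hK : ∀ i y, K i y = ∑ o, if r i o = y then w o else 0) (F : (ι → β) → ℝ) :
    ∑ X : ι → β, (∏ i, K i (X i)) * F X =
      ∑ ω : ι → Ω, (∏ i, w (ω i)) * F (fun i => r i (ω i)) := by
  classical
  simp_rw [hK, Finset.prod_univ_sum, Fintype.piFinset_univ, Finset.sum_mul]
  rw [Finset.sum_comm]
  refine Finset.sum_congr rfl fun ω _ => ?_
  rw [Finset.sum_eq_single (fun i => r i (ω i))]
  · simp
  · intro X _ hX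
    have : ∃ i, r i (ω i) ≠ X i := by
      by_contra h
      push Not at h
      exact hX (funext fun i => (h i).symm)
    obtain ⟨i, hi⟩ := this
    rw [Finset.prod_eq_zero (Finset.mem_univ i) (by rw [if_neg hi]), zero_mul]
  · simp
noncomputable def wsaW (q : ℕ) (lam : ℝ) (o : Bool × Fin q) : ℝ :=
  (if o.1 then 1 - lam else lam) / q

def wsaG {q : ℕ} (x x' : Fin q) (o : Bool × Fin q) : ℝ :=
  if o.1 then (if o.2 = x then 1 else 0) - (if o.2 = x' then 1 else 0) else 0

def wsaR {q : ℕ} (z : Fin q) (o : Bool × Fin q) : Fin q := if o.1 then o.2 else z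

theorem wsaW_nonneg (q : ℕ) (lam : ℝ) (h0 : 0 ≤ lam) (h1 : lam ≤ 1) (o : Bool × Fin q) :
    0 ≤ wsaW q lam o := by
  unfold wsaW
  split_ifs
  · exact div_nonneg (by linarith) (by positivity)
  · positivity

theorem wsaW_sum (q : ℕ) (hq : 0 < q) (lam : ℝ) : ∑ o, wsaW q lam o = 1 := by
  have : (q : ℝ) ≠ 0 := by positivity
  rw [Fintype.sum_prod_type]
  simp [wsaW]
  field_simp
  ring

theorem wsa_edge_push (q : ℕ) (hq : 0 < q) (lam : ℝ) (z y : Fin q) :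
    edgeFactor q lam y z = ∑ o, if wsaR z o = y then wsaW q lam o else 0 := by
  have : (q : ℝ) ≠ 0 := by positivity
  rw [Fintype.sum_prod_type]
  simp [wsaW, wsaR, edgeFactor]
  by_cases h : y = z
  · subst h; simp; field_simp; ring
  · have h' : ¬ z = y := fun e => h e.symm
    simp [h, h']

theorem wsa_slot_exp {q : ℕ} (hq : 0 < q) (lam : ℝ) (h0 : 0 ≤ lam) (h1 : lam ≤ 1)
    (x x' : Fin q) (b : Bool) (a θ : ℝ) (ha : |a| ≤ θ) :
    ∑ y, wsaW q lam (b, y) * Real.exp (a * wsaG x x' (b, y)) ≤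
      (if b then 1 - lam else lam) * Real.exp (θ ^ 2 / 2) := by
  have hq' : (q : ℝ) ≠ 0 := by positivity
  have hexp : Real.exp (a ^ 2 / 2) ≤ Real.exp (θ ^ 2 / 2) := by
    apply Real.exp_le_exp.mpr
    have := sq_le_sq' (by linarith [abs_le.mp ha |>.1]) (abs_le.mp ha).2
    linarith
  have hpt : ∀ y, Real.exp (a * wsaG x x' (b, y)) ≤
      Real.cosh a + wsaG x x' (b, y) * Real.sinh a := by
    intro y
    have hc : 1 ≤ Real.cosh a := Real.one_le_cosh a
    have e1 : Real.exp a = Real.cosh a + Real.sinh a := (Real.cosh_add_sinh a).symm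
    have e2 : Real.exp (-a) = Real.cosh a - Real.sinh a := (Real.cosh_sub_sinh a).symm
    unfold wsaG
    split_ifs <;> simp <;> first | exact hc | (rw [e1]) | (rw [e2]; linarith)
  have hsum : ∑ y, wsaG x x' (b, y) = 0 := by
    cases b <;> simp [wsaG]
  have hW : ∀ y, wsaW q lam (b, y) = (if b then 1 - lam else lam) / q := fun y => rfl
  have hb : 0 ≤ (if b then 1 - lam else lam) := by split_ifs <;> linarith
  calc _ ≤ ∑ y, (if b then 1 - lam else lam) / q *
        (Real.cosh a + wsaG x x' (b, y) * Real.sinh a) := by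
        refine Finset.sum_le_sum fun y _ => ?_
        rw [hW]
        exact mul_le_mul_of_nonneg_left (hpt y) (div_nonneg hb (by positivity))
    _ = (if b then 1 - lam else lam) * Real.cosh a := by
        rw [← Finset.mul_sum, Finset.sum_add_distrib, ← Finset.sum_mul, hsum]
        simp only [Finset.sum_const, Finset.card_univ, Fintype.card_fin, nsmul_eq_mul, zero_mul, add_zero]
        field_simp
    _ ≤ _ := mul_le_mul_of_nonneg_left ((Real.cosh_le_exp_half_sq a).trans hexp) hb

theorem wsa_mgf {V : Type*} [Fintype V] [DecidableEq V] {q : ℕ} (hq : 0 < q) (lam : ℝ)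
    (h0 : 0 ≤ lam) (h1 : lam ≤ 1) (x x' : Fin q) (s : V → (V → Bool) → ℝ)
    (hs : ∀ v B, |s v B| ≤ 1) (θ : ℝ) (hθ : 0 ≤ θ) :
    ∑ ω : V → Bool × Fin q, (∏ v, wsaW q lam (ω v)) *
      Real.exp (θ * ∑ v, s v (fun u => (ω u).1) * wsaG x x' (ω v)) ≤
      Real.exp (Fintype.card V * (θ ^ 2 / 2)) := by
  classical
  calc _ = ∑ p : (V → Bool) × (V → Fin q), ∏ v, (wsaW q lam (p.1 v, p.2 v) *
          Real.exp (θ * s v p.1 * wsaG x x' (p.1 v, p.2 v))) := by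
        refine Fintype.sum_equiv (Equiv.arrowProdEquivProdArrow V (fun _ => Bool) (fun _ => Fin q)) _ _ ?_
        intro ω
        rw [Finset.prod_mul_distrib, Finset.mul_sum, Real.exp_sum]
        simp [Equiv.arrowProdEquivProdArrow, mul_assoc]
    _ = ∑ B : V → Bool, ∏ v, ∑ y, (wsaW q lam (B v, y) *
          Real.exp (θ * s v B * wsaG x x' (B v, y))) := by
        rw [Fintype.sum_prod_type]
        refine Finset.sum_congr rfl fun B _ => ?_
        rw [Finset.prod_univ_sum, Fintype.piFinset_univ]
    _ ≤ ∑ B : V → Bool, ∏ v, ((if B v then 1 - lam else lam) * Real.exp (θ ^ 2 / 2)) := by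
        refine Finset.sum_le_sum fun B _ => ?_
        refine Finset.prod_le_prod (fun v _ => ?_) fun v _ => ?_
        · exact Finset.sum_nonneg fun y _ =>
            mul_nonneg (wsaW_nonneg q lam h0 h1 _) (Real.exp_pos _).le
        · refine wsa_slot_exp hq lam h0 h1 x x' _ _ _ ?_
          rw [abs_mul, abs_of_nonneg hθ]
          exact mul_le_of_le_one_right hθ (hs v B)
    _ = _ := by
        simp_rw [Finset.prod_mul_distrib]
        rw [← Finset.sum_mul, wsa_mass (fun _ (b : Bool) => if b then 1 - lam else lam)
          (by intro i; simp), one_mul]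
        simp [← Real.exp_nat_mul]

/-- the statistic -/
def wsaT {V Γ : Type*} [Fintype V] [AddCommMonoid Γ] {q : ℕ} (Φ : V → Fin q → Γ)
    (ω : V → Bool × Fin q) : Γ := ∑ v, if (ω v).1 then Φ v (ω v).2 else 0

open Classical in
noncomputable def wsaA {V Γ : Type*} [Fintype V] [DecidableEq V] [AddCommMonoid Γ] {q : ℕ} (lam : ℝ)
    (Φ : V → Fin q → Γ) (x x' : Fin q) (v : V) (B : V → Bool) (t : Γ) : ℝ :=
  ∑ ω : V → Bool × Fin q, (∏ v, wsaW q lam (ω v)) *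
    (if (fun u => (ω u).1) = B ∧ wsaT Φ ω = t then wsaG x x' (ω v) else 0)

noncomputable def wsaGam {V Γ : Type*} [Fintype V] [DecidableEq V] [AddCommMonoid Γ] {q : ℕ} (lam : ℝ)
    (Φ : V → Fin q → Γ) (Box : Finset Γ) (x x' : Fin q) (v : V) : ℝ :=
  ∑ B : V → Bool, ∑ t ∈ Box, |wsaA lam Φ x x' v B t|

theorem wsa_gam_sum {V Γ : Type*} [Fintype V] [DecidableEq V] [AddCommMonoid Γ] {q : ℕ}
    (hq : 0 < q) (lam : ℝ) (h0 : 0 ≤ lam) (h1 : lam ≤ 1)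
    (Φ : V → Fin q → Γ) (Box : Finset Γ) (hBox : ∀ ω, wsaT Φ ω ∈ Box) (x x' : Fin q)
    (hV : 0 < Fintype.card V) :
    ∑ v, wsaGam lam Φ Box x x' v ≤
      Real.sqrt (Fintype.card V) * (Real.log Box.card + 1 / 2) := by
  classical
  set s : V → (V → Bool) → Γ → ℝ := fun v B t => (SignType.sign (wsaA lam Φ x x' v B t) : ℝ) with hs
  have hs1 : ∀ v B t, |s v B t| ≤ 1 := by
    intro v B t
    simp only [hs]
    rcases lt_trichotomy (wsaA lam Φ x x' v B t) 0 with h | h | h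
    · simp [sign_neg h]
    · simp [h]
    · simp [sign_pos h]
  set S : (V → Bool × Fin q) → ℝ := fun ω =>
    ∑ v, s v (fun u => (ω u).1) (wsaT Φ ω) * wsaG x x' (ω v) with hS
  set P : (V → Bool × Fin q) → ℝ := fun ω => ∏ v, wsaW q lam (ω v) with hP
  have hP0 : ∀ ω, 0 ≤ P ω := fun ω => Finset.prod_nonneg fun v _ => wsaW_nonneg q lam h0 h1 _
  have hP1 : ∑ ω, P ω = 1 := wsa_mass (fun _ => wsaW q lam) (fun _ => wsaW_sum q hq lam)
  have hE : ∑ v, wsaGam lam Φ Box x x' v = ∑ ω, P ω * S ω := by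
    calc _ = ∑ v, ∑ B : V → Bool, ∑ t ∈ Box, ∑ ω, P ω *
          (if (fun u => (ω u).1) = B ∧ wsaT Φ ω = t then s v B t * wsaG x x' (ω v) else 0) := by
          unfold wsaGam
          refine Finset.sum_congr rfl fun v _ => Finset.sum_congr rfl fun B _ =>
            Finset.sum_congr rfl fun t _ => ?_
          rw [← sign_mul_self, wsaA, Finset.mul_sum]
          refine Finset.sum_congr rfl fun ω _ => ?_
          simp only [hs, hP, wsaA]
          split_ifs <;> ring
      _ = ∑ v, ∑ ω, P ω * (s v (fun u => (ω u).1) (wsaT Φ ω) * wsaG x x' (ω v)) := by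
          refine Finset.sum_congr rfl fun v _ => ?_
          have : ∀ B : V → Bool, ∑ t ∈ Box, ∑ ω, P ω *
              (if (fun u => (ω u).1) = B ∧ wsaT Φ ω = t then s v B t * wsaG x x' (ω v) else 0)
              = ∑ ω, ∑ t ∈ Box, P ω *
              (if (fun u => (ω u).1) = B ∧ wsaT Φ ω = t then s v B t * wsaG x x' (ω v) else 0) :=
            fun B => Finset.sum_comm
          simp_rw [this]
          rw [Finset.sum_comm]
          refine Finset.sum_congr rfl fun ω _ => ?_
          rw [Finset.sum_eq_single (fun u => (ω u).1)]
          · rw [Finset.sum_eq_single (wsaT Φ ω)]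
            · simp
            · intro t _ ht
              rw [if_neg (fun h => ht h.2.symm), mul_zero]
            · intro h; exact absurd (hBox ω) h
          · intro B _ hB
            refine Finset.sum_eq_zero fun t _ => ?_
            rw [if_neg (fun h => hB h.1.symm), mul_zero]
          · simp
      _ = _ := by
          rw [Finset.sum_comm]
          simp_rw [hS, Finset.mul_sum]
  rw [hE]
  set N : ℝ := ((Fintype.card V : ℕ) : ℝ) with hN
  have hNpos : 0 < N := by simp only [hN]; exact_mod_cast hV
  set θ : ℝ := 1 / Real.sqrt N with hθ
  have hsq : 0 < Real.sqrt N := Real.sqrt_pos.mpr hNpos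
  have hθ0 : 0 < θ := by positivity
  have hθ2 : N * (θ ^ 2 / 2) = 1 / 2 := by
    rw [hθ, div_pow, Real.sq_sqrt hNpos.le]; field_simp
  have hJ : Real.exp (θ * ∑ ω, P ω * S ω) ≤ Box.card * Real.exp (1 / 2) := by
    calc _ = Real.exp (∑ ω, P ω • (θ * S ω)) := by
          congr 1; rw [Finset.mul_sum]; refine Finset.sum_congr rfl fun ω _ => ?_
          simp only [smul_eq_mul]; ring
      _ ≤ ∑ ω, P ω • Real.exp (θ * S ω) :=
          convexOn_exp.map_sum_le (fun ω _ => hP0 ω) hP1 (fun _ _ => Set.mem_univ _)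
      _ ≤ ∑ ω, ∑ t ∈ Box, P ω *
            Real.exp (θ * ∑ v, s v (fun u => (ω u).1) t * wsaG x x' (ω v)) := by
          refine Finset.sum_le_sum fun ω _ => ?_
          simp only [hS, smul_eq_mul]
          exact Finset.single_le_sum (f := fun t => P ω *
            Real.exp (θ * ∑ v, s v (fun u => (ω u).1) t * wsaG x x' (ω v)))
            (fun t _ => mul_nonneg (hP0 ω) (Real.exp_pos _).le) (hBox ω)
      _ = ∑ t ∈ Box, ∑ ω, P ω *
            Real.exp (θ * ∑ v, s v (fun u => (ω u).1) t * wsaG x x' (ω v)) := Finset.sum_comm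
      _ ≤ ∑ t ∈ Box, Real.exp (1 / 2) := by
          refine Finset.sum_le_sum fun t _ => ?_
          rw [← hθ2]
          exact wsa_mgf hq lam h0 h1 x x' (fun v B => s v B t) (fun v B => hs1 v B t) θ hθ0.le
      _ = _ := by simp
  have hBpos : (0 : ℝ) < Box.card := by
    have : 0 < Box.card := Finset.card_pos.mpr ⟨_, hBox (fun _ => (false, ⟨0, hq⟩))⟩
    exact_mod_cast this
  have hL : θ * ∑ ω, P ω * S ω ≤ Real.log Box.card + 1 / 2 := by
    have := Real.log_le_log (Real.exp_pos _) hJ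
    rwa [Real.log_exp, Real.log_mul hBpos.ne' (Real.exp_pos _).ne', Real.log_exp] at this
  calc ∑ ω, P ω * S ω = Real.sqrt N * (θ * ∑ ω, P ω * S ω) := by
        rw [hθ]; field_simp
    _ ≤ _ := mul_le_mul_of_nonneg_left hL hsq.le

theorem wsa_gam_test {V Γ : Type*} [Fintype V] [DecidableEq V] [AddCommMonoid Γ] {q : ℕ}
    (lam : ℝ)
    (Φ : V → Fin q → Γ) (Box : Finset Γ) (hBox : ∀ ω, wsaT Φ ω ∈ Box) (x x' : Fin q)
    (v : V) (f : Γ → ℝ) (hf : ∀ t, |f t| ≤ 1) (Z : V → Fin q) :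
    |∑ ω : V → Bool × Fin q, (∏ v, wsaW q lam (ω v)) *
      (wsaG x x' (ω v) * f (∑ u, Φ u (wsaR (Z u) (ω u))))| ≤ wsaGam lam Φ Box x x' v := by
  classical
  set P : (V → Bool × Fin q) → ℝ := fun ω => ∏ v, wsaW q lam (ω v) with hP
  have hsplit : ∀ ω : V → Bool × Fin q, ∑ u, Φ u (wsaR (Z u) (ω u)) =
      wsaT Φ ω + ∑ u, if (ω u).1 then 0 else Φ u (Z u) := by
    intro ω
    rw [wsaT, ← Finset.sum_add_distrib]
    refine Finset.sum_congr rfl fun u _ => ?_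
    unfold wsaR
    split_ifs <;> simp
  set σ : (V → Bool) → Γ := fun B => ∑ u, if B u then 0 else Φ u (Z u) with hσ
  have : ∑ ω : V → Bool × Fin q, P ω *
      (wsaG x x' (ω v) * f (∑ u, Φ u (wsaR (Z u) (ω u)))) =
      ∑ B : V → Bool, ∑ t ∈ Box, f (t + σ B) * wsaA lam Φ x x' v B t := by
    unfold wsaA
    simp_rw [Finset.mul_sum]
    have e : ∀ B : V → Bool, ∑ t ∈ Box, ∑ ω, f (t + σ B) * (P ω *
              (if (fun u => (ω u).1) = B ∧ wsaT Φ ω = t then wsaG x x' (ω v) else 0))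
              = ∑ ω, ∑ t ∈ Box, f (t + σ B) * (P ω *
              (if (fun u => (ω u).1) = B ∧ wsaT Φ ω = t then wsaG x x' (ω v) else 0)) :=
            fun B => Finset.sum_comm
    refine Eq.trans ?_ (Finset.sum_congr rfl fun B _ => (e B).symm)
    rw [Finset.sum_comm]
    refine Finset.sum_congr rfl fun ω _ => ?_
    rw [Finset.sum_eq_single (fun u => (ω u).1)]
    · rw [Finset.sum_eq_single (wsaT Φ ω)]
      · rw [hsplit]; simp [hσ, hP]; ring
      · intro t _ ht
        rw [if_neg (fun h => ht h.2.symm), mul_zero, mul_zero]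
      · intro h; exact absurd (hBox ω) h
    · intro B _ hB
      refine Finset.sum_eq_zero fun t _ => ?_
      rw [if_neg (fun h => hB h.1.symm), mul_zero, mul_zero]
    · simp
  rw [this, wsaGam]
  refine (Finset.abs_sum_le_sum_abs _ _).trans (Finset.sum_le_sum fun B _ => ?_)
  refine (Finset.abs_sum_le_sum_abs _ _).trans (Finset.sum_le_sum fun t _ => ?_)
  rw [abs_mul]
  exact mul_le_of_le_one_left (abs_nonneg _) (hf _)

/-- one-step averaging along the last level -/
noncomputable def wsaH {V : Type*} [Fintype V] [DecidableEq V] {q : ℕ} (lam : ℝ)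
    (F : (V → Fin q) → ℝ) (Z : V → Fin q) : ℝ :=
  ∑ X : V → Fin q, (∏ v, edgeFactor q lam (X v) (Z v)) * F X

theorem wsa_slot {V Γ : Type*} [Fintype V] [DecidableEq V] [AddCommMonoid Γ] {q : ℕ}
    (hq : 0 < q) (lam : ℝ) (h0 : 0 ≤ lam) (h1 : lam < 1)
    (Φ : V → Fin q → Γ) (Box : Finset Γ) (hBox : ∀ ω, wsaT Φ ω ∈ Box) (x x' : Fin q)
    (v : V) (f : Γ → ℝ) (hf : ∀ t, |f t| ≤ 1) (Z : V → Fin q) :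
    |wsaH lam (fun X => f (∑ u, Φ u (X u))) (Function.update Z v x) -
      wsaH lam (fun X => f (∑ u, Φ u (X u))) (Function.update Z v x')| ≤
      lam * q / (1 - lam) * wsaGam lam Φ Box x x' v := by
  have hq' : (q : ℝ) ≠ 0 := by positivity
  have hl : 1 - lam ≠ 0 := by linarith
  set F : (V → Fin q) → (V → Bool × Fin q) → ℝ :=
    fun Z ω => f (∑ u, Φ u (wsaR (Z u) (ω u))) with hF
  have hH : ∀ Z, wsaH lam (fun X => f (∑ u, Φ u (X u))) Z =
      ∑ ω : V → Bool × Fin q, (∏ v, wsaW q lam (ω v)) * F Z ω := fun Z =>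
    wsa_push (fun v y => edgeFactor q lam y (Z v)) (wsaW q lam) (fun v => wsaR (Z v))
      (fun i y => wsa_edge_push q hq lam (Z i) y) (fun X => f (∑ u, Φ u (X u)))
  have hres : ∀ G : (V → Bool × Fin q) → ℝ,
      ∑ ω : V → Bool × Fin q, (∏ v, wsaW q lam (ω v)) * G ω =
      ∑ ω : V → Bool × Fin q, (∏ v, wsaW q lam (ω v)) *
        ∑ o, wsaW q lam o * G (Function.update ω v o) := by
    intro G
    rw [← wsa_resample (fun _ : V => wsaW q lam) v (wsaW q lam) (wsaW_sum q hq lam) G,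
      Function.update_eq_self_iff.mpr rfl]
  have hT : ∀ y z ω, F (Function.update Z v z) (Function.update ω v (true, y)) =
      F Z (Function.update ω v (true, y)) := by
    intro y z ω
    simp only [hF]
    congr 1
    refine Finset.sum_congr rfl fun u _ => ?_
    by_cases h : u = v
    · subst h; simp [wsaR]
    · simp [h]
  have hFa : ∀ y z ω, F (Function.update Z v z) (Function.update ω v (false, y)) =
      F Z (Function.update ω v (true, z)) := by
    intro y z ω
    simp only [hF]
    congr 1
    refine Finset.sum_congr rfl fun u _ => ?_
    by_cases h : u = v
    · subst h; simp [wsaR]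
    · simp [h]
  have main : wsaH lam (fun X => f (∑ u, Φ u (X u))) (Function.update Z v x) -
      wsaH lam (fun X => f (∑ u, Φ u (X u))) (Function.update Z v x') =
      lam * q / (1 - lam) * ∑ ω : V → Bool × Fin q, (∏ v, wsaW q lam (ω v)) *
      (wsaG x x' (ω v) * F Z ω) := by
    rw [hH, hH, hres (F (Function.update Z v x)), hres (F (Function.update Z v x')),
      hres (fun ω => wsaG x x' (ω v) * F Z ω), ← Finset.sum_sub_distrib, Finset.mul_sum]
    refine Finset.sum_congr rfl fun ω _ => ?_
    simp only [Fintype.sum_prod_type, Fintype.sum_bool, hT, hFa, Function.update_self]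
    simp [wsaG, wsaW, sub_mul, mul_sub, Finset.sum_sub_distrib]
    field_simp
    ring
  rw [main, abs_mul, abs_of_nonneg (div_nonneg (by positivity) (by linarith))]
  refine mul_le_mul_of_nonneg_left ?_ (div_nonneg (by positivity) (by linarith))
  exact wsa_gam_test lam Φ Box hBox x x' v f hf Z

/-- weighted Hamming Lipschitz -/
def WsaLip {V : Type*} [Fintype V] {q : ℕ} (F : (V → Fin q) → ℝ) (S : ℝ) : Prop :=
  ∃ c : V → ℝ, (∀ v, 0 ≤ c v) ∧ ∑ v, c v ≤ S ∧
    ∀ X X', |F X - F X'| ≤ ∑ v, if X v ≠ X' v then c v else 0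

theorem wsa_lip_of_slot {V : Type*} [Fintype V] [DecidableEq V] {q : ℕ}
    (F : (V → Fin q) → ℝ) (c : V → ℝ)
    (h : ∀ Z v x x', |F (Function.update Z v x) - F (Function.update Z v x')| ≤ c v)
    (X X' : V → Fin q) : |F X - F X'| ≤ ∑ v, if X v ≠ X' v then c v else 0 := by
  have hd : ∀ Y : V → Fin q,
      ∑ X : V → Fin q, (∏ i, (if X i = Y i then (1 : ℝ) else 0)) * F X = F Y := by
    intro Y
    rw [Finset.sum_eq_single Y]
    · simp
    · intro X _ hX
      obtain ⟨i, hi⟩ := Function.ne_iff.mp hX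
      rw [Finset.prod_eq_zero (Finset.mem_univ i) (by rw [if_neg hi]), zero_mul]
    · simp
  have := wsa_lip (fun (a y : Fin q) => if y = a then (1 : ℝ) else 0)
    (fun a y => by positivity) (fun a => by simp) F c X X' (by
      intro i _ Z a b
      simpa [sub_mul, Finset.sum_sub_distrib] using h Z i a b)
  simpa only [hd] using this

theorem wsa_smooth {V Γ : Type*} [Fintype V] [DecidableEq V] [AddCommMonoid Γ] {q : ℕ}
    (hq : 0 < q) (lam : ℝ) (h0 : 0 ≤ lam) (h1 : lam < 1)
    (Φ : V → Fin q → Γ) (Box : Finset Γ) (hBox : ∀ ω, wsaT Φ ω ∈ Box)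
    (hV : 0 < Fintype.card V) (f : Γ → ℝ) (hf : ∀ t, |f t| ≤ 1) :
    WsaLip (wsaH lam (fun X => f (∑ u, Φ u (X u))))
      (lam * q / (1 - lam) * (q ^ 2 *
        (Real.sqrt (Fintype.card V) * (Real.log Box.card + 1 / 2)))) := by
  have hg : ∀ x x' v, 0 ≤ wsaGam lam Φ Box x x' v := fun x x' v =>
    Finset.sum_nonneg fun _ _ => Finset.sum_nonneg fun _ _ => abs_nonneg _
  have hc : 0 ≤ lam * q / (1 - lam) := div_nonneg (by positivity) (by linarith)
  refine ⟨fun v => lam * q / (1 - lam) * ∑ x, ∑ x', wsaGam lam Φ Box x x' v, ?_, ?_, ?_⟩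
  · intro v
    exact mul_nonneg hc (Finset.sum_nonneg fun _ _ => Finset.sum_nonneg fun _ _ => hg _ _ _)
  · rw [← Finset.mul_sum]
    refine mul_le_mul_of_nonneg_left ?_ hc
    rw [Finset.sum_comm]
    calc _ = ∑ x : Fin q, ∑ x' : Fin q, ∑ v, wsaGam lam Φ Box x x' v :=
          Finset.sum_congr rfl fun x _ => Finset.sum_comm
      _ ≤ ∑ x : Fin q, ∑ x' : Fin q,
          Real.sqrt (Fintype.card V) * (Real.log Box.card + 1 / 2) :=
          Finset.sum_le_sum fun x _ => Finset.sum_le_sum fun x' _ =>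
            wsa_gam_sum hq lam h0 h1.le Φ Box hBox x x' hV
      _ = _ := by simp; ring
  · refine wsa_lip_of_slot _ _ ?_
    intro Z v x x'
    refine (wsa_slot hq lam h0 h1 Φ Box hBox x x' v f hf Z).trans ?_
    refine mul_le_mul_of_nonneg_left ?_ hc
    refine le_trans ?_ (Finset.single_le_sum (f := fun x => ∑ x', wsaGam lam Φ Box x x' v)
      (fun _ _ => Finset.sum_nonneg fun _ _ => hg _ _ _) (Finset.mem_univ x))
    exact Finset.single_le_sum (f := fun x' => wsaGam lam Φ Box x x' v)
      (fun _ _ => hg _ _ _) (Finset.mem_univ x')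
def wsaIni {d n : ℕ} (p : Fin (n + 1) → Fin d) : Fin n → Fin d := fun i => p i.castSucc

noncomputable def wsaNu (d q : ℕ) (lam : ℝ) : (n : ℕ) → Fin q → ((Fin n → Fin d) → Fin q) → ℝ
  | 0, a, x => if x = (fun _ => a) then 1 else 0
  | n + 1, a, x => ∑ y : (Fin n → Fin d) → Fin q,
      wsaNu d q lam n a y * ∏ p : Fin (n + 1) → Fin d, edgeFactor q lam (x p) (y (wsaIni p))

theorem wsa_edge_nonneg (q : ℕ) (lam : ℝ) (h0 : 0 ≤ lam) (h1 : lam ≤ 1) (a b : Fin q) :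
    0 ≤ edgeFactor q lam a b := by
  unfold edgeFactor
  have : 0 ≤ (1 - lam) / q := div_nonneg (by linarith) (by positivity)
  positivity

theorem wsa_edge_sum (q : ℕ) (hq : 0 < q) (lam : ℝ) (b : Fin q) :
    ∑ a, edgeFactor q lam a b = 1 := by
  have : (q : ℝ) ≠ 0 := by positivity
  simp [edgeFactor, Finset.sum_add_distrib]
  field_simp
  ring

theorem wsaNu_nonneg (d q : ℕ) (lam : ℝ) (h0 : 0 ≤ lam) (h1 : lam ≤ 1) (n : ℕ) (a : Fin q)
    (x : (Fin n → Fin d) → Fin q) : 0 ≤ wsaNu d q lam n a x := by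
  induction n with
  | zero => unfold wsaNu; positivity
  | succ n ih =>
    unfold wsaNu
    exact Finset.sum_nonneg fun y _ => mul_nonneg (ih y)
      (Finset.prod_nonneg fun p _ => wsa_edge_nonneg q lam h0 h1 _ _)

theorem wsaNu_succ (d q : ℕ) (lam : ℝ) (n : ℕ) (a : Fin q)
    (F : ((Fin (n + 1) → Fin d) → Fin q) → ℝ) :
    ∑ x, wsaNu d q lam (n + 1) a x * F x =
      ∑ y, wsaNu d q lam n a y * wsaH lam F (fun p => y (wsaIni p)) := by
  simp only [wsaNu, wsaH, Finset.sum_mul, Finset.mul_sum]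
  rw [Finset.sum_comm]
  refine Finset.sum_congr rfl fun y _ => Finset.sum_congr rfl fun x _ => ?_
  ring

theorem wsaNu_sum (d q : ℕ) (hq : 0 < q) (lam : ℝ) (n : ℕ) (a : Fin q) :
    ∑ x, wsaNu d q lam n a x = 1 := by
  induction n with
  | zero => simp [wsaNu]
  | succ n ih =>
    have := wsaNu_succ d q lam n a (fun _ => 1)
    simp only [mul_one] at this
    rw [this]
    refine Eq.trans (Finset.sum_congr rfl fun y _ => ?_) ih
    simp only [wsaH, mul_one]
    rw [wsa_mass (fun p x => edgeFactor q lam x (y (wsaIni p))) (fun p => wsa_edge_sum q hq lam _),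
      mul_one]

theorem wsaLip_comp {V V' : Type*} [Fintype V] [Fintype V'] [DecidableEq V'] {q : ℕ}
    (H : (V → Fin q) → ℝ) (S : ℝ) (hH : WsaLip H S) (r : V → V') :
    WsaLip (fun y : V' → Fin q => H (fun v => y (r v))) S := by
  obtain ⟨c, c0, cS, hc⟩ := hH
  refine ⟨fun p => ∑ v with r v = p, c v, fun p => Finset.sum_nonneg fun v _ => c0 v, ?_, ?_⟩
  · rw [Finset.sum_fiberwise]; exact cS
  · intro X X'
    refine (hc _ _).trans (le_of_eq ?_)
    rw [← Finset.sum_fiberwise _ r]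
    refine Finset.sum_congr rfl fun p _ => ?_
    by_cases h : X p = X' p
    · rw [if_neg (by simpa using h)]
      refine Finset.sum_eq_zero fun v hv => ?_
      rw [(Finset.mem_filter.mp hv).2]; simp [h]
    · rw [if_pos h]
      refine Finset.sum_congr rfl fun v hv => ?_
      rw [(Finset.mem_filter.mp hv).2]; simp [h]

theorem wsaLip_step {V : Type*} [Fintype V] [DecidableEq V] {q : ℕ} (hq : 0 < q) (lam : ℝ)
    (h0 : 0 ≤ lam) (h1 : lam ≤ 1) (F : (V → Fin q) → ℝ) (S : ℝ) (hF : WsaLip F S) :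
    WsaLip (wsaH lam F) (lam * S) := by
  obtain ⟨c, c0, cS, hc⟩ := hF
  refine ⟨fun v => lam * c v, fun v => mul_nonneg h0 (c0 v), ?_, ?_⟩
  · rw [← Finset.mul_sum]; exact mul_le_mul_of_nonneg_left cS h0
  · intro Y Y'
    refine wsa_lip (fun a y => edgeFactor q lam y a) (fun a y => wsa_edge_nonneg q lam h0 h1 _ _)
      (fun a => wsa_edge_sum q hq lam a) F (fun v => lam * c v) Y Y' ?_
    intro i _ X a b
    have : ∑ y, (edgeFactor q lam y a - edgeFactor q lam y b) * F (Function.update X i y)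
        = lam * (F (Function.update X i a) - F (Function.update X i b)) := by
      simp [edgeFactor, sub_mul, mul_sub, Finset.sum_sub_distrib, ite_mul]
    rw [this, abs_mul, abs_of_nonneg h0]
    refine mul_le_mul_of_nonneg_left ((hc _ _).trans ?_) h0
    rw [← Finset.sum_ite_eq' Finset.univ i c |>.trans (if_pos (Finset.mem_univ i))]
    refine Finset.sum_le_sum fun v _ => ?_
    by_cases h : v = i
    · subst h; simp; split_ifs <;> simp [c0]
    · simp [h]

theorem wsaNu_lip (d q : ℕ) (hq : 0 < q) (lam : ℝ) (h0 : 0 ≤ lam) (h1 : lam ≤ 1) (n : ℕ)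
    (a b : Fin q) (F : ((Fin n → Fin d) → Fin q) → ℝ) (S : ℝ) (hF : WsaLip F S) :
    |∑ x, wsaNu d q lam n a x * F x - ∑ x, wsaNu d q lam n b x * F x| ≤ lam ^ n * S := by
  induction n generalizing S with
  | zero =>
    obtain ⟨c, c0, cS, hc⟩ := hF
    simp [wsaNu]
    refine (hc _ _).trans (le_trans (Finset.sum_le_sum fun v _ => ?_) cS)
    split_ifs
    · exact le_rfl
    · exact c0 v
  | succ n ih =>
    rw [wsaNu_succ, wsaNu_succ]
    refine (ih _ (lam * S) (wsaLip_comp _ _ (wsaLip_step hq lam h0 h1 F S hF) wsaIni)).trans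
      (le_of_eq ?_)
    ring

theorem wsa_row (d q : ℕ) (hd : 0 < d) (hq : 0 < q) (lam : ℝ) (h0 : 0 ≤ lam) (h1 : lam < 1) (n : ℕ)
    {ι : Type*} [Fintype ι] [DecidableEq ι]
    (Φ : (Fin (n + 1) → Fin d) → Fin q → (ι → ℕ)) (hΦ : ∀ p c j, Φ p c j ≤ 1)
    (f : (ι → ℕ) → ℝ) (hf : ∀ t, |f t| ≤ 1) (a b : Fin q) :
    |∑ x, (wsaNu d q lam (n + 1) a x - wsaNu d q lam (n + 1) b x) * f (∑ p, Φ p (x p))| ≤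
      lam ^ n * (lam * q / (1 - lam) * (q ^ 2 * (Real.sqrt (d ^ (n + 1) : ℕ) *
        (Fintype.card ι * Real.log ((d ^ (n + 1) : ℕ) + 1) + 1 / 2)))) := by
  simp_rw [sub_mul]
  rw [Finset.sum_sub_distrib, wsaNu_succ d q lam n a (fun x => f (∑ p, Φ p (x p))),
    wsaNu_succ d q lam n b (fun x => f (∑ p, Φ p (x p)))]
  refine wsaNu_lip d q hq lam h0 h1.le n a b _ _ ?_
  refine wsaLip_comp _ _ ?_ wsaIni
  have hcard : Fintype.card (Fin (n + 1) → Fin d) = d ^ (n + 1) := by simp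
  have := wsa_smooth hq lam h0 h1 Φ
    (Fintype.piFinset fun _ : ι => Finset.range (d ^ (n + 1) + 1)) (by
      intro ω
      rw [Fintype.mem_piFinset]
      intro j
      rw [Finset.mem_range, Nat.lt_succ_iff, ← hcard, wsaT, Finset.sum_apply, Fintype.card,
        Finset.card_eq_sum_ones]
      refine Finset.sum_le_sum fun p _ => ?_
      split_ifs
      · exact hΦ _ _ _
      · simp) (by rw [hcard]; positivity) f hf
  rw [Fintype.card_piFinset, hcard] at this
  simpa [Finset.prod_const, Real.log_pow] using this
def wsaEmb {d h : ℕ} (v : Vtx d h) : Vtx d (h + 1) := ⟨v.1.castSucc, v.2⟩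

noncomputable def wsaVEquiv (d h : ℕ) : Vtx d h ⊕ Leaf d (h + 1) ≃ Vtx d (h + 1) :=
  Equiv.ofBijective (Sum.elim wsaEmb leafVtx) (by
    constructor
    · rintro (⟨l, p⟩ | f) (⟨l', p'⟩ | f') hh
      · have h1 : l = l' := by
          have := congrArg (fun v : Vtx d (h + 1) => (v.1 : ℕ)) hh
          exact Fin.ext this
        subst h1
        have h2 : p = p' := by
          simp only [Sum.elim_inl, wsaEmb] at hh
          exact eq_of_heq (Sigma.mk.inj hh).2
        rw [h2]
      · have := congrArg (fun v : Vtx d (h + 1) => (v.1 : ℕ)) hh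
        have h3 : (l : ℕ) = h + 1 := this
        have := l.isLt; omega
      · have := congrArg (fun v : Vtx d (h + 1) => (v.1 : ℕ)) hh
        have h3 : h + 1 = (l' : ℕ) := this
        have := l'.isLt; omega
      · have h2 : f = f' := by
          simp only [Sum.elim_inr, leafVtx] at hh
          exact eq_of_heq (Sigma.mk.inj hh).2
        rw [h2]
    · rintro ⟨l, p⟩
      revert p
      refine Fin.lastCases ?_ ?_ l
      · intro p; exact ⟨Sum.inr p, rfl⟩
      · intro l p; exact ⟨Sum.inl ⟨l, p⟩, rfl⟩)

theorem wsa_iidm_succ (d h q k : ℕ) (lam : ℝ) (F : (Leaf d (h + 1) → RepSpace q k) → ℝ) :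
    ∑ R : Vtx d (h + 1) → RepSpace q k, iidmPMF d (h + 1) q k lam R * F (fun f => R (leafVtx f)) =
    ∑ R : Vtx d h → RepSpace q k, iidmPMF d h q k lam R *
      ∑ X : Leaf d (h + 1) → RepSpace q k,
        (∏ f, ∏ i, edgeFactor q lam (X f i) (R (leafVtx (wsaIni f)) i)) * F X := by
  rw [← Equiv.sum_comp ((Equiv.sumArrowEquivProdArrow _ _ _).symm.trans
    ((wsaVEquiv d h).arrowCongr (Equiv.refl (RepSpace q k)))), Fintype.sum_prod_type]
  refine Finset.sum_congr rfl fun R _ => ?_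
  rw [Finset.mul_sum]
  refine Finset.sum_congr rfl fun X _ => ?_
  set R' : Vtx d (h + 1) → RepSpace q k := ((Equiv.sumArrowEquivProdArrow _ _ _).symm.trans
    ((wsaVEquiv d h).arrowCongr (Equiv.refl (RepSpace q k)))) (R, X) with hR'
  have hl : ∀ f, R' (leafVtx f) = X f := by
    intro f
    have : leafVtx f = wsaVEquiv d h (Sum.inr f) := rfl
    rw [this, hR']
    simp [Equiv.sumArrowEquivProdArrow]
  have he : ∀ v, R' (wsaEmb v) = R v := by
    intro v
    have : wsaEmb v = wsaVEquiv d h (Sum.inl v) := rfl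
    rw [this, hR']
    simp [Equiv.sumArrowEquivProdArrow]
  have hpe : ∀ v : Vtx d h, parent (wsaEmb v) = wsaEmb (parent v) := fun v => rfl
  have hpl : ∀ f : Leaf d (h + 1), parent (leafVtx f) = wsaEmb (leafVtx (wsaIni f)) := fun f => rfl
  have hi : iidmPMF d (h + 1) q k lam R' = iidmPMF d h q k lam R *
      ∏ f : Leaf d (h + 1), ∏ i, edgeFactor q lam (X f i) (R (leafVtx (wsaIni f)) i) := by
    unfold iidmPMF
    rw [← Equiv.prod_comp (wsaVEquiv d h), Fintype.prod_sum_type, ← mul_assoc]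
    congr 1
    · congr 1
      refine Finset.prod_congr rfl fun v _ => ?_
      have e1 : wsaVEquiv d h (Sum.inl v) = wsaEmb v := rfl
      rw [e1, hpe, he, he]
      rfl
    · refine Finset.prod_congr rfl fun f _ => ?_
      have e1 : wsaVEquiv d h (Sum.inr f) = leafVtx f := rfl
      rw [e1, hpl, he, hl, if_neg (by simp [leafVtx])]
  rw [hi, funext hl, mul_assoc]

theorem wsa_iidm_nonneg (d h q k : ℕ) (lam : ℝ) (h0 : 0 ≤ lam) (h1 : lam ≤ 1)
    (R : Vtx d h → RepSpace q k) : 0 ≤ iidmPMF d h q k lam R := by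
  unfold iidmPMF
  refine mul_nonneg (by positivity) (Finset.prod_nonneg fun v _ => ?_)
  split_ifs
  · exact zero_le_one
  · exact Finset.prod_nonneg fun i _ => wsa_edge_nonneg q lam h0 h1 _ _

theorem wsa_iidm_sum (d h q k : ℕ) (hq : 0 < q) (lam : ℝ) :
    ∑ R : Vtx d h → RepSpace q k, iidmPMF d h q k lam R = 1 := by
  induction h with
  | zero =>
    have hv : ∀ v : Vtx d 0, (v.1 : ℕ) = 0 := by rintro ⟨l, p⟩; have := l.isLt; simp
    have hc : Fintype.card (Vtx d 0) = 1 := by simp [Fintype.card_sigma]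
    simp only [iidmPMF, hv, if_true, Finset.prod_const_one, mul_one]
    rw [Finset.sum_const, Finset.card_univ, Fintype.card_fun, hc]
    have : (q : ℝ) ≠ 0 := by positivity
    simp [this]
  | succ h ih =>
    have := wsa_iidm_succ d h q k lam (fun _ => 1)
    simp only [mul_one] at this
    rw [this]
    refine Eq.trans (Finset.sum_congr rfl fun R _ => ?_) ih
    rw [wsa_mass (fun (f : Leaf d (h + 1)) (x : RepSpace q k) =>
      ∏ i, edgeFactor q lam (x i) (R (leafVtx (wsaIni f)) i)), mul_one]
    intro f
    exact wsa_mass (fun i (x : Fin q) => edgeFactor q lam x (R (leafVtx (wsaIni f)) i))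
      (fun i => wsa_edge_sum q hq lam _)

def wsaTake {d h1 n : ℕ} (f : Leaf d (h1 + n)) : Fin h1 → Fin d := fun a => f (Fin.castAdd n a)

def wsaDrop {d h1 n : ℕ} (f : Leaf d (h1 + n)) : Fin n → Fin d := fun b => f (Fin.natAdd h1 b)

def wsaAsm {d h1 n q k : ℕ} (X : (Fin h1 → Fin d) × Fin k → (Fin n → Fin d) → Fin q) :
    Leaf d (h1 + n) → RepSpace q k := fun f i => X (wsaTake f, i) (wsaDrop f)

theorem wsaTake_append {d h1 n : ℕ} (v : Fin h1 → Fin d) (p : Fin n → Fin d) :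
    wsaTake (Fin.append v p) = v := by funext a; simp [wsaTake]

theorem wsaDrop_append {d h1 n : ℕ} (v : Fin h1 → Fin d) (p : Fin n → Fin d) :
    wsaDrop (Fin.append v p) = p := by funext a; simp [wsaDrop]

theorem wsa_append_take_drop {d h1 n : ℕ} (f : Leaf d (h1 + n)) :
    Fin.append (wsaTake f) (wsaDrop f) = f := by
  funext a
  refine Fin.addCases (fun i => ?_) (fun i => ?_) a <;> simp [wsaTake, wsaDrop]

def wsaLeafEquiv (d h1 n : ℕ) : Leaf d (h1 + n) ≃ (Fin h1 → Fin d) × (Fin n → Fin d) where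
  toFun f := (wsaTake f, wsaDrop f)
  invFun p := Fin.append p.1 p.2
  left_inv f := wsa_append_take_drop f
  right_inv p := by simp [wsaTake_append, wsaDrop_append]

def wsaAsmEquiv (d h1 n q k : ℕ) :
    ((Fin h1 → Fin d) × Fin k → (Fin n → Fin d) → Fin q) ≃ (Leaf d (h1 + n) → RepSpace q k) where
  toFun := wsaAsm
  invFun Z := fun r p => Z (Fin.append r.1 p) r.2
  left_inv X := by funext r p; simp [wsaAsm, wsaTake_append, wsaDrop_append]
  right_inv Z := by funext f i; simp [wsaAsm, wsa_append_take_drop]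

theorem wsa_markov_step (d h1 n q k : ℕ) (lam : ℝ)
    (F : (Leaf d (h1 + (n + 1)) → RepSpace q k) → ℝ) (Y : (Fin h1 → Fin d) × Fin k → Fin q) :
    ∑ X : (Fin h1 → Fin d) × Fin k → (Fin n → Fin d) → Fin q,
      (∏ r, wsaNu d q lam n (Y r) (X r)) *
        ∑ X' : Leaf d (h1 + n + 1) → RepSpace q k,
        (∏ f, ∏ i, edgeFactor q lam (X' f i) (wsaAsm X (wsaIni f) i)) * F X' =
    ∑ X : (Fin h1 → Fin d) × Fin k → (Fin (n + 1) → Fin d) → Fin q,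
      (∏ r, wsaNu d q lam (n + 1) (Y r) (X r)) * F (wsaAsm X) := by
  simp only [wsaNu]
  simp_rw [Finset.prod_univ_sum, Fintype.piFinset_univ, Finset.sum_mul]
  rw [Finset.sum_comm]
  refine Finset.sum_congr rfl fun X _ => ?_
  rw [Finset.mul_sum]
  refine (Equiv.sum_comp (wsaAsmEquiv d h1 (n + 1) q k) _).symm.trans ?_
  refine Finset.sum_congr rfl fun X' _ => ?_
  have hA : (wsaAsmEquiv d h1 (n + 1) q k) X' = wsaAsm X' := rfl
  rw [hA, ← mul_assoc, Finset.prod_mul_distrib]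
  congr 2
  rw [Fintype.prod_prod_type]
  have : ∀ v : Fin h1 → Fin d, ∏ i : Fin k, ∏ p : Fin (n + 1) → Fin d,
      edgeFactor q lam (X' (v, i) p) (X (v, i) (wsaIni p)) =
      ∏ p : Fin (n + 1) → Fin d, ∏ i : Fin k,
      edgeFactor q lam (X' (v, i) p) (X (v, i) (wsaIni p)) := fun v => Finset.prod_comm
  simp_rw [this]
  rw [← Fintype.prod_prod_type' (f := fun (v : Fin h1 → Fin d) (p : Fin (n + 1) → Fin d) => ∏ i : Fin k,
      edgeFactor q lam (X' (v, i) p) (X (v, i) (wsaIni p)))]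
  exact Fintype.prod_equiv (wsaLeafEquiv d h1 (n + 1)) _ _ (fun f => rfl)

theorem wsa_markov (d h1 q k : ℕ) (hq : 0 < q) (lam : ℝ) (h0 : 0 ≤ lam) (hl1 : lam ≤ 1) :
    ∃ ρ : ((Fin h1 → Fin d) × Fin k → Fin q) → ℝ, (∀ Y, 0 ≤ ρ Y) ∧ ∑ Y, ρ Y = 1 ∧
    ∀ (n : ℕ) (F : (Leaf d (h1 + n) → RepSpace q k) → ℝ),
      ∑ R : Vtx d (h1 + n) → RepSpace q k,
        iidmPMF d (h1 + n) q k lam R * F (fun f => R (leafVtx f)) =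
      ∑ Y, ρ Y * ∑ X : (Fin h1 → Fin d) × Fin k → (Fin n → Fin d) → Fin q,
        (∏ r, wsaNu d q lam n (Y r) (X r)) * F (wsaAsm X) := by
  classical
  set m : (Vtx d h1 → RepSpace q k) → ((Fin h1 → Fin d) × Fin k → Fin q) :=
    fun R r => R (leafVtx r.1) r.2 with hm
  have hρ : ∀ G : ((Fin h1 → Fin d) × Fin k → Fin q) → ℝ,
      ∑ Y, (∑ R : Vtx d h1 → RepSpace q k, if m R = Y then iidmPMF d h1 q k lam R else 0) * G Y
      = ∑ R : Vtx d h1 → RepSpace q k, iidmPMF d h1 q k lam R * G (m R) := by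
    intro G
    simp_rw [Finset.sum_mul]
    rw [Finset.sum_comm]
    refine Finset.sum_congr rfl fun R _ => ?_
    simp [ite_mul]
  refine ⟨fun Y => ∑ R : Vtx d h1 → RepSpace q k, if m R = Y then iidmPMF d h1 q k lam R else 0,
    ?_, ?_, ?_⟩
  · intro Y
    refine Finset.sum_nonneg fun R _ => ?_
    split_ifs
    · exact wsa_iidm_nonneg d h1 q k lam h0 hl1 R
    · exact le_rfl
  · have := hρ (fun _ => 1)
    simp only [mul_one] at this
    rw [this, wsa_iidm_sum d h1 q k hq lam]
  · intro n
    induction n with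
    | zero =>
      intro F
      rw [hρ]
      refine Finset.sum_congr rfl fun R _ => ?_
      congr 1
      rw [Finset.sum_eq_single (fun r _ => m R r)]
      · simp [wsaNu]
        rfl
      · intro X _ hX
        obtain ⟨i, hi⟩ := Function.ne_iff.mp hX
        rw [Finset.prod_eq_zero (Finset.mem_univ i), zero_mul]
        simp only [wsaNu]
        rw [if_neg hi]
      · simp
    | succ n ih =>
      intro F
      have h1' := wsa_iidm_succ d (h1 + n) q k lam F
      refine h1'.trans ?_
      have h2 := ih (fun Z => ∑ X : Leaf d (h1 + n + 1) → RepSpace q k,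
        (∏ f, ∏ i, edgeFactor q lam (X f i) (Z (wsaIni f) i)) * F X)
      refine h2.trans ?_
      refine Finset.sum_congr rfl fun Y _ => ?_
      congr 1
      exact wsa_markov_step d h1 n q k lam F Y

def wsaPre {d h0 h1 : ℕ} (h01 : h0 < h1) (v : Fin h1 → Fin d) : Fin h0 → Fin d :=
  fun i => v ⟨(i : ℕ), by have := i.isLt; omega⟩

def wsaSuf {d h0 h1 : ℕ} (h01 : h0 < h1) (v : Fin h1 → Fin d) : Fin (h1 - h0) → Fin d :=
  fun i => v ⟨h0 + (i : ℕ), by have := i.isLt; omega⟩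

def wsaSplit {d h0 h1 : ℕ} (h01 : h0 < h1) :
    (Fin h1 → Fin d) ≃ (Fin h0 → Fin d) × (Fin (h1 - h0) → Fin d) where
  toFun v := (wsaPre h01 v, wsaSuf h01 v)
  invFun p := fun i => if hi : (i : ℕ) < h0 then p.1 ⟨i, hi⟩
    else p.2 ⟨(i : ℕ) - h0, by have := i.isLt; omega⟩
  left_inv v := by
    funext i
    by_cases hi : (i : ℕ) < h0
    · simp [hi, wsaPre]
    · have : h0 + ((i : ℕ) - h0) = i := by omega
      simp [hi, wsaSuf, this]
  right_inv p := by
    refine Prod.ext ?_ ?_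
    · funext i
      simp [wsaPre]
    · funext i
      simp [wsaSuf]

def wsaSel {d h0 h1 : ℕ} (h01 : h0 < h1)
    (e : (Fin h0 → Fin d) → (Fin (h1 - h0) → Fin d) × (Fin (h1 - h0) → Fin d))
    (v : Fin h1 → Fin d) : Prop :=
  wsaSuf h01 v = (e (wsaPre h01 v)).1 ∨ wsaSuf h01 v = (e (wsaPre h01 v)).2

open Classical in
noncomputable def wsaUnl (d h q k h0 h1 : ℕ) (h01 : h0 < h1) (h1h : h1 < h)
    (ins : Inst d h0 h1) (R : Leaf d h → RepSpace q k) :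
    Leaf d h → Option (RepSpace q k) :=
  fun f => if InLabeledSet d h h0 h1 h01 h1h ins f then none else some (R f)

open Classical in
noncomputable def wsaCnt (d h q k h0 h1 m : ℕ) (h01 : h0 < h1) (h1h : h1 < h)
    (A : Fin m → Finset (Fin k)) (ins : Inst d h0 h1) (R : Leaf d h → RepSpace q k) :
    (j : Fin m) → ({i // i ∈ A j} → Fin q) → Fin (d ^ h0) → ℕ :=
  fun j x ℓ =>
    (Finset.univ.filter fun f : Leaf d h =>
      InLabeledSet d h h0 h1 h01 h1h ins f ∧
      labelOf d h h0 h1 h01 h1h ins f = ℓ ∧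
      ∀ i : {i // i ∈ A j}, R f i.1 = x i).card

theorem wsa_unl_eq (d h q k h0 h1 : ℕ) (h01 : h0 < h1) (h1h : h1 < h)
    (ins : Inst d h0 h1) (R : Vtx d h → RepSpace q k) :
    unlabeledData d h q k h0 h1 h01 h1h ins R =
      wsaUnl d h q k h0 h1 h01 h1h ins (fun f => R (leafVtx f)) := rfl

theorem wsa_cnt_eq (d h q k h0 h1 m : ℕ) (h01 : h0 < h1) (h1h : h1 < h)
    (A : Fin m → Finset (Fin k)) (ins : Inst d h0 h1) (R : Vtx d h → RepSpace q k) :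
    countsOf d h q k h0 h1 m h01 h1h A ins R =
      wsaCnt d h q k h0 h1 m h01 h1h A ins (fun f => R (leafVtx f)) := rfl

theorem wsa_inl (d h0 h1 n : ℕ) (h01 : h0 < h1) (h1h : h1 < h1 + n) (ins : Inst d h0 h1)
    (f : Leaf d (h1 + n)) :
    InLabeledSet d (h1 + n) h0 h1 h01 h1h ins f ↔ wsaSel h01 ins.2 (wsaTake f) := Iff.rfl

theorem wsa_lab (d h0 h1 n : ℕ) (h01 : h0 < h1) (h1h : h1 < h1 + n) (ins : Inst d h0 h1)
    (f : Leaf d (h1 + n)) :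
    labelOf d (h1 + n) h0 h1 h01 h1h ins f = ins.1 (wsaPre h01 (wsaTake f)) := rfl

open Classical in
theorem wsa_cnt_sum (d q k h0 h1 m n : ℕ) (h01 : h0 < h1) (h1h : h1 < h1 + n)
    (A : Fin m → Finset (Fin k)) (ins : Inst d h0 h1)
    (X : (Fin h1 → Fin d) × Fin k → (Fin n → Fin d) → Fin q)
    (j : Fin m) (x : {i // i ∈ A j} → Fin q) (l : Fin (d ^ h0)) :
    wsaCnt d (h1 + n) q k h0 h1 m h01 h1h A ins (wsaAsm X) j x l =
      ∑ v : Fin h1 → Fin d, ∑ p : Fin n → Fin d,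
        if wsaSel h01 ins.2 v ∧ ins.1 (wsaPre h01 v) = l ∧
          ∀ i : {i // i ∈ A j}, X (v, i.1) p = x i then 1 else 0 := by
  unfold wsaCnt
  rw [Finset.card_filter, ← Fintype.sum_prod_type' (f := fun (v : Fin h1 → Fin d) (p : Fin n → Fin d) =>
    if wsaSel h01 ins.2 v ∧ ins.1 (wsaPre h01 v) = l ∧
          ∀ i : {i // i ∈ A j}, X (v, i.1) p = x i then 1 else 0)]
  refine Fintype.sum_equiv (wsaLeafEquiv d h1 n) _ _ fun f => ?_
  rfl

/-- symmetrization, abstract -/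
theorem wsa_sym {U L 𝒳 : Type*} [Fintype U] [DecidableEq U] [Fintype L] [DecidableEq L]
    [Fintype 𝒳] (G : (U ≃ L) → 𝒳 → L) (W : 𝒳 → ℝ) (hW : ∑ x, W x = 1)
    (u0 : U) (τ : U → Equiv.Perm 𝒳) (hτW : ∀ u x, W (τ u x) = W x)
    (hτG : ∀ u ψ x, G ((Equiv.swap u0 u).trans ψ) (τ u x) = G ψ x) :
    (Fintype.card U : ℝ) * ∑ ψ : U ≃ L, ∑ x, W x * (if G ψ x = ψ u0 then 1 else 0) =
      Fintype.card (U ≃ L) := by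
  have key : ∀ u, ∑ ψ : U ≃ L, ∑ x, W x * (if G ψ x = ψ u0 then (1:ℝ) else 0) =
      ∑ ψ : U ≃ L, ∑ x, W x * (if G ψ x = ψ u then (1:ℝ) else 0) := by
    intro u
    symm
    let E : (U ≃ L) ≃ (U ≃ L) :=
      { toFun := fun ψ => (Equiv.swap u0 u).trans ψ
        invFun := fun ψ => (Equiv.swap u0 u).trans ψ
        left_inv := fun ψ => by ext a; simp
        right_inv := fun ψ => by ext a; simp }
    refine Fintype.sum_equiv E _ _ fun ψ => ?_
    refine Fintype.sum_equiv (τ u) _ _ fun x => ?_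
    have : E ψ = (Equiv.swap u0 u).trans ψ := rfl
    rw [hτW, this, hτG]
    simp
  have h1 : (Fintype.card U : ℝ) * ∑ ψ : U ≃ L, ∑ x, W x * (if G ψ x = ψ u0 then (1:ℝ) else 0) =
      ∑ u : U, ∑ ψ : U ≃ L, ∑ x, W x * (if G ψ x = ψ u then (1:ℝ) else 0) := by
    rw [← Finset.sum_congr rfl fun u _ => key u]
    simp
  rw [h1, Finset.sum_comm]
  have h2 : ∀ ψ : U ≃ L, ∑ u : U, ∑ x, W x * (if G ψ x = ψ u then (1:ℝ) else 0) = 1 := by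
    intro ψ
    rw [Finset.sum_comm]
    refine Eq.trans ?_ hW
    refine Finset.sum_congr rfl fun x _ => ?_
    rw [← Finset.mul_sum]
    have : ∀ u, (G ψ x = ψ u) ↔ (ψ.symm (G ψ x) = u) := fun u => by
      rw [Equiv.symm_apply_eq]
    simp [this]
  rw [Finset.sum_congr rfl fun ψ _ => h2 ψ]
  simp

open Classical in
theorem wsa_alpha {U S : Type*} (e : U → S × S) (he : ∀ u, (e u).1 ≠ (e u).2)
    (σ : U → U) (hσ : ∀ u, σ (σ u) = u) :
    ∃ α : U × S → U × S, (∀ v, α (α v) = v) ∧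
      ∀ v, ((v.2 = (e v.1).1 ∨ v.2 = (e v.1).2) →
          ((α v).2 = (e (α v).1).1 ∨ (α v).2 = (e (α v).1).2) ∧ (α v).1 = σ v.1) ∧
        (¬ (v.2 = (e v.1).1 ∨ v.2 = (e v.1).2) → α v = v) := by
  refine ⟨fun v => if v.2 = (e v.1).1 then (σ v.1, (e (σ v.1)).1)
    else if v.2 = (e v.1).2 then (σ v.1, (e (σ v.1)).2) else v, ?_, ?_⟩
  · rintro ⟨u, s⟩
    by_cases h1 : s = (e u).1
    · simp [h1, hσ]
    · by_cases h2 : s = (e u).2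
      · have := he u
        have h3 := he (σ u)
        simp [h2, hσ, this.symm, h3.symm]
      · simp [h1, h2]
  · rintro ⟨u, s⟩
    by_cases h1 : s = (e u).1
    · simp [h1]
    · by_cases h2 : s = (e u).2
      · have := he u
        simp [h2, this.symm]
      · simp [h1, h2]

theorem wsa_alpha' {d h0 h1 : ℕ} (h01 : h0 < h1)
    (e : (Fin h0 → Fin d) → (Fin (h1 - h0) → Fin d) × (Fin (h1 - h0) → Fin d))
    (he : ∀ u, (e u).1 ≠ (e u).2) (σ : Equiv.Perm (Fin h0 → Fin d)) (hσ : ∀ u, σ (σ u) = u) :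
    ∃ α : Equiv.Perm (Fin h1 → Fin d), (∀ v, wsaSel h01 e (α v) ↔ wsaSel h01 e v) ∧
      (∀ v, wsaSel h01 e v → wsaPre h01 (α v) = σ (wsaPre h01 v)) ∧
      (∀ v, ¬ wsaSel h01 e v → α v = v) := by
  obtain ⟨β, hβ, hp⟩ := wsa_alpha e he σ hσ
  have hinv : Function.Involutive (fun v => (wsaSplit h01).symm (β (wsaSplit h01 v))) := by
    intro v; simp [hβ]
  have hs : ∀ v, wsaSplit h01 (hinv.toPerm _ v) = β (wsaSplit h01 v) := by
    intro v; simp [Function.Involutive.toPerm]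
  have hsel : ∀ v, wsaSel h01 e v ↔ ((wsaSplit h01 v).2 = (e (wsaSplit h01 v).1).1 ∨
    (wsaSplit h01 v).2 = (e (wsaSplit h01 v).1).2) := fun v => Iff.rfl
  have hpre : ∀ v : Fin h1 → Fin d, wsaPre h01 v = (wsaSplit h01 v).1 := fun v => rfl
  have hfix : ∀ v, ¬ wsaSel h01 e v → hinv.toPerm _ v = v := by
    intro v hv
    apply (wsaSplit h01).injective
    rw [hs]
    exact (hp _).2 ((hsel v).not.1 hv)
  refine ⟨hinv.toPerm _, ?_, ?_, hfix⟩
  · intro v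
    constructor
    · intro h
      by_contra hv
      rw [hfix v hv] at h
      exact hv h
    · intro h
      rw [hsel, hs]
      exact ((hp _).1 ((hsel v).1 h)).1
  · intro v hv
    rw [hpre, hs]
    exact ((hp _).1 ((hsel v).1 hv)).2

theorem wsa_sym_conc (d q k h0 h1 m n : ℕ) (hq : 0 < q) (lam : ℝ) (h01 : h0 < h1)
    (h1h : h1 < h1 + n) (A : Fin m → Finset (Fin k))
    (e : (Fin h0 → Fin d) → (Fin (h1 - h0) → Fin d) × (Fin (h1 - h0) → Fin d))
    (he : ∀ u, (e u).1 ≠ (e u).2)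
    (g : (Leaf d (h1 + n) → Option (RepSpace q k)) →
          ((j : Fin m) → ({i // i ∈ A j} → Fin q) → Fin (d ^ h0) → ℕ) → Fin (d ^ h0))
    (Y : (Fin h1 → Fin d) × Fin k → Fin q) (a0 : Fin q)
    (hY : ∀ v i, wsaSel h01 e v → Y (v, i) = a0) (u0 : Fin h0 → Fin d) :
    ((d ^ h0 : ℕ) : ℝ) * ∑ ψ : (Fin h0 → Fin d) ≃ Fin (d ^ h0),
      ∑ X : (Fin h1 → Fin d) × Fin k → (Fin n → Fin d) → Fin q,
        (∏ r, wsaNu d q lam n (Y r) (X r)) *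
        (if g (wsaUnl d (h1 + n) q k h0 h1 h01 h1h (ψ, e) (wsaAsm X))
          (wsaCnt d (h1 + n) q k h0 h1 m h01 h1h A (ψ, e) (wsaAsm X)) = ψ u0 then 1 else 0) =
      Fintype.card ((Fin h0 → Fin d) ≃ Fin (d ^ h0)) := by
  classical
  choose α hα1 hα2 hα3 using fun u => wsa_alpha' h01 e he (Equiv.swap u0 u)
    (fun x => Equiv.swap_apply_self u0 u x)
  let ε : (Fin h0 → Fin d) → Equiv.Perm ((Fin h1 → Fin d) × Fin k) :=
    fun u => (α u).prodCongr (Equiv.refl _)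
  have hcard : Fintype.card (Fin h0 → Fin d) = d ^ h0 := by simp
  have hc : ((d ^ h0 : ℕ) : ℝ) = (Fintype.card (Fin h0 → Fin d) : ℝ) := by rw [hcard]
  rw [hc]
  refine wsa_sym (fun ψ X => g (wsaUnl d (h1 + n) q k h0 h1 h01 h1h (ψ, e) (wsaAsm X))
          (wsaCnt d (h1 + n) q k h0 h1 m h01 h1h A (ψ, e) (wsaAsm X)))
    (fun X => ∏ r, wsaNu d q lam n (Y r) (X r)) ?_ u0
    (fun u => (ε u).symm.arrowCongr (Equiv.refl _)) ?_ ?_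
  · exact wsa_mass (fun r => wsaNu d q lam n (Y r)) (fun r => wsaNu_sum d q hq lam n (Y r))
  · intro u X
    have hYe : ∀ r, Y (ε u r) = Y r := by
      rintro ⟨v, i⟩
      have hε : ε u (v, i) = (α u v, i) := rfl
      rw [hε]
      by_cases hv : wsaSel h01 e v
      · rw [hY v i hv, hY _ i ((hα1 u v).2 hv)]
      · rw [hα3 u v hv]
    refine Fintype.prod_equiv (ε u) _ _ fun r => ?_
    rw [hYe]
    rfl
  · intro u ψ X
    have hX : ∀ v i, ((ε u).symm.arrowCongr (Equiv.refl _) X :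
        (Fin h1 → Fin d) × Fin k → (Fin n → Fin d) → Fin q) (v, i) = X (α u v, i) :=
      fun v i => rfl
    have e1 : wsaUnl d (h1 + n) q k h0 h1 h01 h1h ((Equiv.swap u0 u).trans ψ, e)
        (wsaAsm ((ε u).symm.arrowCongr (Equiv.refl _) X)) =
        wsaUnl d (h1 + n) q k h0 h1 h01 h1h (ψ, e) (wsaAsm X) := by
      funext f
      unfold wsaUnl
      simp only [wsa_inl]
      by_cases hv : wsaSel h01 e (wsaTake f)
      · simp [hv]
      · simp only [hv, if_false]
        congr 1
        funext i
        simp only [wsaAsm]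
        rw [hX, hα3 u _ hv]
    have e2 : wsaCnt d (h1 + n) q k h0 h1 m h01 h1h A ((Equiv.swap u0 u).trans ψ, e)
        (wsaAsm ((ε u).symm.arrowCongr (Equiv.refl _) X)) =
        wsaCnt d (h1 + n) q k h0 h1 m h01 h1h A (ψ, e) (wsaAsm X) := by
      funext j x l
      rw [wsa_cnt_sum, wsa_cnt_sum]
      refine Fintype.sum_equiv (α u) _ _ fun v => ?_
      refine Finset.sum_congr rfl fun p _ => ?_
      simp only [hX, hα1]
      by_cases hv : wsaSel h01 e v
      · simp only [hα2 u v hv, Equiv.trans_apply]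
        congr
      · simp [hv]
    simp only [e1, e2]

open Classical in
theorem wsa_card_sel {d h0 h1 : ℕ} (h01 : h0 < h1)
    (e : (Fin h0 → Fin d) → (Fin (h1 - h0) → Fin d) × (Fin (h1 - h0) → Fin d)) :
    (Finset.univ.filter fun v => wsaSel h01 e v).card ≤ 2 * d ^ h0 := by
  have : Fintype.card ((Fin h0 → Fin d) × Bool) = 2 * d ^ h0 := by simp [mul_comm]
  rw [← this]
  refine Finset.card_le_card_of_injOn
    (fun v => (wsaPre h01 v, decide (wsaSuf h01 v = (e (wsaPre h01 v)).1))) (by simp) ?_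
  intro v hv v' hv' hvv
  simp only [Finset.coe_filter, Finset.mem_univ, true_and, Set.mem_ofPred_eq] at hv hv'
  simp only [Prod.mk.injEq, decide_eq_decide] at hvv
  apply (wsaSplit h01).injective
  refine Prod.ext hvv.1 ?_
  change wsaSuf h01 v = wsaSuf h01 v'
  unfold wsaSel at hv hv'
  rw [← hvv.1] at hv'
  have h2 := hvv.2
  rw [← hvv.1] at h2
  rcases hv with h | h <;> rcases hv' with h' | h'
  · rw [h, h']
  · rw [h, h2.1 h]
  · rw [h', h2.2 h']
  · rw [h, h']

theorem wsa_card_A {k m s : ℕ} (A : Fin m → Finset (Fin k)) (hA : ∀ j, (A j).card ≤ s) :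
    (Finset.univ.biUnion A).card ≤ m * s := by
  refine Finset.card_biUnion_le.trans ?_
  refine (Finset.sum_le_sum fun j _ => hA j).trans ?_
  simp

theorem wsa_card_iota {k m s q : ℕ} (hq : 0 < q) (A : Fin m → Finset (Fin k))
    (hA : ∀ j, (A j).card ≤ s) :
    Fintype.card (Σ j : Fin m, ({i // i ∈ A j} → Fin q)) ≤ m * q ^ s := by
  rw [Fintype.card_sigma]
  refine (Finset.sum_le_sum (g := fun _ => q ^ s) fun j _ => ?_).trans ?_
  · simp only [Fintype.card_pi, Fintype.card_fin, Finset.prod_const, Finset.card_univ, Fintype.card_coe]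
    exact Nat.pow_le_pow_right hq (hA j)
  · simp

noncomputable def wsaDelta (d q : ℕ) (lam : ℝ) (n D : ℕ) : ℝ :=
  lam ^ n * (lam * q / (1 - lam) *
    ((q : ℝ) ^ 2 * (√((d ^ (n + 1) : ℕ) : ℝ) * (D * Real.log (((d ^ (n + 1) : ℕ) : ℝ) + 1) + 1 / 2))))

theorem wsa_repl_row (d q k h0 h1 m n : ℕ) (hd : 0 < d) (hq : 0 < q) (lam : ℝ)
    (hl0 : 0 ≤ lam) (hl1 : lam < 1) (h01 : h0 < h1)
    (h1h : h1 < h1 + (n + 1)) (A : Fin m → Finset (Fin k)) (ins : Inst d h0 h1)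
    (F : (Leaf d (h1 + (n + 1)) → Option (RepSpace q k)) →
          ((j : Fin m) → ({i // i ∈ A j} → Fin q) → Fin (d ^ h0) → ℕ) → ℝ)
    (hF : ∀ x y, |F x y| ≤ 1) (v : Fin h1 → Fin d) (hv : wsaSel h01 ins.2 v) (i : Fin k)
    (X : (Fin h1 → Fin d) × Fin k → (Fin (n + 1) → Fin d) → Fin q) (a b : Fin q) :
    |∑ y, (wsaNu d q lam (n + 1) a y - wsaNu d q lam (n + 1) b y) *
      F (wsaUnl d (h1 + (n + 1)) q k h0 h1 h01 h1h ins (wsaAsm (Function.update X (v, i) y)))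
        (wsaCnt d (h1 + (n + 1)) q k h0 h1 m h01 h1h A ins (wsaAsm (Function.update X (v, i) y)))|
      ≤ if i ∈ Finset.univ.biUnion A then
        wsaDelta d q lam n (Fintype.card (Σ j : Fin m, ({i // i ∈ A j} → Fin q))) else 0 := by
  classical
  have e1 : ∀ y, wsaUnl d (h1 + (n + 1)) q k h0 h1 h01 h1h ins
      (wsaAsm (Function.update X (v, i) y)) =
      wsaUnl d (h1 + (n + 1)) q k h0 h1 h01 h1h ins (wsaAsm X) := by
    intro y
    funext f
    unfold wsaUnl
    simp only [wsa_inl]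
    by_cases hv' : wsaSel h01 ins.2 (wsaTake f)
    · simp [hv']
    · simp only [hv', if_false]
      congr 1
      funext i'
      simp only [wsaAsm]
      rw [Function.update_of_ne]
      intro h
      rw [Prod.mk.injEq] at h
      exact hv' (h.1 ▸ hv)
  simp only [e1]
  split_ifs with hi
  · let Φ : (Fin (n + 1) → Fin d) → Fin q → ((Σ j : Fin m, ({i // i ∈ A j} → Fin q)) → ℕ) :=
      fun p c t => if ∀ i' : {i // i ∈ A t.1}, (if i'.1 = i then c else X (v, i'.1) p) = t.2 i'
        then 1 else 0
    let base : (j : Fin m) → ({i // i ∈ A j} → Fin q) → Fin (d ^ h0) → ℕ := fun j x l =>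
      ∑ v' ∈ Finset.univ.erase v, ∑ p : Fin (n + 1) → Fin d,
        if wsaSel h01 ins.2 v' ∧ ins.1 (wsaPre h01 v') = l ∧
          ∀ i : {i // i ∈ A j}, X (v', i.1) p = x i then 1 else 0
    let f : ((Σ j : Fin m, ({i // i ∈ A j} → Fin q)) → ℕ) → ℝ := fun t =>
      F (wsaUnl d (h1 + (n + 1)) q k h0 h1 h01 h1h ins (wsaAsm X))
        (fun j x l => (if ins.1 (wsaPre h01 v) = l then t ⟨j, x⟩ else 0) + base j x l)
    have e2 : ∀ y, wsaCnt d (h1 + (n + 1)) q k h0 h1 m h01 h1h A ins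
        (wsaAsm (Function.update X (v, i) y)) =
        fun j x l => (if ins.1 (wsaPre h01 v) = l then (∑ p, Φ p (y p)) ⟨j, x⟩ else 0)
          + base j x l := by
      intro y
      funext j x l
      rw [wsa_cnt_sum, ← Finset.add_sum_erase _ _ (Finset.mem_univ v)]
      congr 1
      · rw [Finset.sum_apply]
        have hu : ∀ (i' : Fin k) p, Function.update X (v, i) y (v, i') p =
            if i' = i then y p else X (v, i') p := by
          intro i' p
          by_cases h : i' = i
          · subst h; simp
          · rw [Function.update_of_ne (by simp [h])]; simp [h]
        simp only [hu, hv, true_and]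
        by_cases hl : ins.1 (wsaPre h01 v) = l
        · simp only [hl, true_and, if_true]
          rfl
        · simp [hl]
      · refine Finset.sum_congr rfl fun v' hv' => ?_
        have hne := Finset.ne_of_mem_erase hv'
        have hu : ∀ (i' : Fin k), Function.update X (v, i) y (v', i') = X (v', i') := by
          intro i'
          rw [Function.update_of_ne (by simp [hne])]
        simp only [hu]
    simp only [e2]
    exact wsa_row d q hd hq lam hl0 hl1 n Φ (by intro p c j; simp only [Φ]; split_ifs <;> simp)
      f (fun t => hF _ _) a b
  · have e2 : ∀ y, wsaCnt d (h1 + (n + 1)) q k h0 h1 m h01 h1h A ins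
        (wsaAsm (Function.update X (v, i) y)) =
        wsaCnt d (h1 + (n + 1)) q k h0 h1 m h01 h1h A ins (wsaAsm X) := by
      intro y
      funext j x l
      rw [wsa_cnt_sum, wsa_cnt_sum]
      have hu : ∀ v' (i' : {i // i ∈ A j}), Function.update X (v, i) y (v', i'.1) = X (v', i'.1) := by
        intro v' i'
        rw [Function.update_of_ne]
        intro h
        rw [Prod.mk.injEq] at h
        exact hi (Finset.mem_biUnion.2 ⟨j, Finset.mem_univ _, h.2 ▸ i'.2⟩)
      simp only [hu]
    simp only [e2]
    rw [← Finset.sum_mul, Finset.sum_sub_distrib, wsaNu_sum d q hq, wsaNu_sum d q hq]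
    simp

theorem wsaDelta_nonneg (d q : ℕ) (lam : ℝ) (hl0 : 0 ≤ lam) (hl1 : lam < 1) (n D : ℕ) :
    0 ≤ wsaDelta d q lam n D := by
  unfold wsaDelta
  have : 0 < 1 - lam := by linarith
  have h2 : 0 ≤ Real.log (((d ^ (n + 1) : ℕ) : ℝ) + 1) :=
    Real.log_nonneg (by have : (0:ℝ) ≤ ((d ^ (n + 1) : ℕ) : ℝ) := Nat.cast_nonneg _
                        linarith)
  positivity

open Classical in
theorem wsa_repl (d q k h0 h1 m n s : ℕ) (hd : 0 < d) (hq : 0 < q) (lam : ℝ)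
    (hl0 : 0 ≤ lam) (hl1 : lam < 1) (h01 : h0 < h1)
    (h1h : h1 < h1 + (n + 1)) (A : Fin m → Finset (Fin k)) (hA : ∀ j, (A j).card ≤ s)
    (ins : Inst d h0 h1)
    (F : (Leaf d (h1 + (n + 1)) → Option (RepSpace q k)) →
          ((j : Fin m) → ({i // i ∈ A j} → Fin q) → Fin (d ^ h0) → ℕ) → ℝ)
    (hF : ∀ x y, |F x y| ≤ 1) (Y : (Fin h1 → Fin d) × Fin k → Fin q) (a0 : Fin q) :
    ∑ X, (∏ r, wsaNu d q lam (n + 1) (Y r) (X r)) *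
      F (wsaUnl d (h1 + (n + 1)) q k h0 h1 h01 h1h ins (wsaAsm X))
        (wsaCnt d (h1 + (n + 1)) q k h0 h1 m h01 h1h A ins (wsaAsm X)) ≤
    ∑ X, (∏ r, wsaNu d q lam (n + 1) (if wsaSel h01 ins.2 r.1 then a0 else Y r) (X r)) *
      F (wsaUnl d (h1 + (n + 1)) q k h0 h1 h01 h1h ins (wsaAsm X))
        (wsaCnt d (h1 + (n + 1)) q k h0 h1 m h01 h1h A ins (wsaAsm X)) +
    (2 * d ^ h0 : ℕ) * (m * s : ℕ) *
      wsaDelta d q lam n (Fintype.card (Σ j : Fin m, ({i // i ∈ A j} → Fin q))) := by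
  set D := wsaDelta d q lam n (Fintype.card (Σ j : Fin m, ({i // i ∈ A j} → Fin q))) with hD
  have hD0 : 0 ≤ D := wsaDelta_nonneg d q lam hl0 hl1 n _
  have key := wsa_lip (wsaNu d q lam (n + 1)) (wsaNu_nonneg d q lam hl0 hl1.le (n + 1))
    (wsaNu_sum d q hq lam (n + 1))
    (fun X => F (wsaUnl d (h1 + (n + 1)) q k h0 h1 h01 h1h ins (wsaAsm X))
        (wsaCnt d (h1 + (n + 1)) q k h0 h1 m h01 h1h A ins (wsaAsm X)))
    (fun r => if r.2 ∈ Finset.univ.biUnion A then D else 0) Y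
    (fun r => if wsaSel h01 ins.2 r.1 then a0 else Y r) (by
      rintro ⟨v, i⟩ hr X a b
      have hv : wsaSel h01 ins.2 v := by
        by_contra hv
        simp [hv] at hr
      exact wsa_repl_row d q k h0 h1 m n hd hq lam hl0 hl1 h01 h1h A ins F hF v hv i X a b)
  have hk := (abs_le.1 key).2
  have h2 : (∑ r : (Fin h1 → Fin d) × Fin k, if Y r ≠ (if wsaSel h01 ins.2 r.1 then a0 else Y r) then
      (if r.2 ∈ Finset.univ.biUnion A then D else 0) else 0) ≤
      (2 * d ^ h0 : ℕ) * (m * s : ℕ) * D := by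
    calc _ ≤ ∑ r : (Fin h1 → Fin d) × Fin k, (if wsaSel h01 ins.2 r.1 then (1:ℝ) else 0) *
          (if r.2 ∈ Finset.univ.biUnion A then D else 0) := by
          refine Finset.sum_le_sum fun r _ => ?_
          by_cases hv : wsaSel h01 ins.2 r.1
          · simp only [hv, if_true, one_mul]
            split_ifs <;> simp [hD0]
          · simp [hv]
      _ = ((Finset.univ.filter fun v => wsaSel h01 ins.2 v).card : ℝ) *
          (((Finset.univ.biUnion A).card : ℝ) * D) := by
          rw [Fintype.sum_prod_type]
          change ∑ v : Fin h1 → Fin d, ∑ i : Fin k, (if wsaSel h01 ins.2 v then (1:ℝ) else 0) *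
            (if i ∈ Finset.univ.biUnion A then D else 0) = _
          rw [← Finset.sum_mul_sum]
          congr 1
          · simp
          · rw [Finset.sum_ite_mem]; simp
      _ ≤ _ := by
          rw [mul_assoc]
          have a1 := wsa_card_sel h01 ins.2
          have a2 := wsa_card_A A hA
          gcongr
  linarith

theorem wsa_assemble {Ψ E T 𝒴 : Type*} [Fintype Ψ] [Fintype E] [Fintype T] [Fintype 𝒴]
    (coef : Ψ × E → T → ℝ) (h0 : ∀ i t, 0 ≤ coef i t)
    (hconst : ∀ ψ ψ' e t, coef (ψ, e) t = coef (ψ', e) t)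
    (hsum : ∑ i, ∑ t, coef i t ≤ 1)
    (ρ : 𝒴 → ℝ) (hρ0 : ∀ Y, 0 ≤ ρ Y) (hρ : ∑ Y, ρ Y = 1)
    (B B0 : Ψ × E → T → 𝒴 → ℝ) (Δ M : ℝ) (hΔ : 0 ≤ Δ) (hM : 0 < M)
    (hB : ∀ i t Y, B i t Y ≤ B0 i t Y + Δ)
    (hB0 : ∀ ψ e t Y, coef (ψ, e) t ≠ 0 → M * ∑ ψ, B0 (ψ, e) t Y = Fintype.card Ψ) :
    ∑ i, ∑ t, coef i t * ∑ Y, ρ Y * B i t Y ≤ 1 / M + Δ := by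
  have s1 : ∀ i t, coef i t * ∑ Y, ρ Y * B i t Y ≤
      coef i t * ∑ Y, ρ Y * B0 i t Y + coef i t * Δ := by
    intro i t
    rw [← mul_add]
    refine mul_le_mul_of_nonneg_left ?_ (h0 i t)
    calc ∑ Y, ρ Y * B i t Y ≤ ∑ Y, ρ Y * (B0 i t Y + Δ) :=
          Finset.sum_le_sum fun Y _ => mul_le_mul_of_nonneg_left (hB i t Y) (hρ0 Y)
      _ = _ := by simp_rw [mul_add]; rw [Finset.sum_add_distrib, ← Finset.sum_mul, hρ, one_mul]
  have s2 : ∑ i, ∑ t, coef i t * ∑ Y, ρ Y * B0 i t Y = 1 / M * ∑ i, ∑ t, coef i t := by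
    rw [Fintype.sum_prod_type, Finset.sum_comm, Fintype.sum_prod_type]
    rw [Finset.sum_comm (s := (Finset.univ : Finset Ψ)), Finset.mul_sum]
    refine Finset.sum_congr rfl fun e _ => ?_
    rw [Finset.sum_comm, Finset.sum_comm (s := (Finset.univ : Finset Ψ)), Finset.mul_sum]
    refine Finset.sum_congr rfl fun t _ => ?_
    rcases isEmpty_or_nonempty Ψ with hE | ⟨⟨ψ0⟩⟩
    · simp
    · have hc : ∀ ψ, coef (ψ, e) t = coef (ψ0, e) t := fun ψ => hconst ψ ψ0 e t
      simp_rw [hc]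
      by_cases hz : coef (ψ0, e) t = 0
      · simp [hz]
      · rw [← Finset.mul_sum, Finset.sum_comm]
        simp_rw [← Finset.mul_sum]
        have : ∀ Y, ∑ ψ, B0 (ψ, e) t Y = Fintype.card Ψ / M := by
          intro Y
          rw [eq_div_iff hM.ne', mul_comm]
          exact hB0 ψ0 e t Y hz
        simp_rw [this]
        rw [← Finset.sum_mul, hρ]
        simp
        ring
  calc _ ≤ ∑ i, ∑ t, (coef i t * ∑ Y, ρ Y * B0 i t Y + coef i t * Δ) :=
        Finset.sum_le_sum fun i _ => Finset.sum_le_sum fun t _ => s1 i t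
    _ = 1 / M * ∑ i, ∑ t, coef i t + (∑ i, ∑ t, coef i t) * Δ := by
        rw [← s2]
        simp_rw [Finset.sum_add_distrib, Finset.sum_mul]
    _ ≤ 1 / M * 1 + 1 * Δ := by gcongr
    _ = _ := by ring

theorem wsa_pow_bound (r r' : ℝ) (h0 : 0 ≤ r) (h : r < r') :
    ∃ B : ℝ, 0 ≤ B ∧ ∀ N : ℕ, (N : ℝ) * r ^ N ≤ B * r' ^ N := by
  have hr' : 0 < r' := lt_of_le_of_lt h0 h
  have ht := tendsto_self_mul_const_pow_of_lt_one (r := r / r') (by positivity)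
    ((div_lt_one hr').2 h)
  obtain ⟨B, hB⟩ := ht.bddAbove_range
  refine ⟨B, ?_, fun N => ?_⟩
  · have := hB ⟨0, rfl⟩
    simpa using this
  · have := hB ⟨N, rfl⟩
    simp only [div_pow] at this
    rw [← mul_div_assoc, div_le_iff₀ (by positivity)] at this
    exact this

theorem wsa_analytic (d q s : ℕ) (hd : 0 < d) (hq : 0 < q) (lam : ℝ) (hl0 : 0 ≤ lam)
    (hl1 : lam < 1) (hKS : (d : ℝ) * lam ^ 2 < 1) :
    ∃ c : ℝ, 0 < c ∧ ∃ C : ℝ, 1 ≤ C ∧ ∀ n m D : ℕ, D ≤ m * q ^ s → 1 ≤ m →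
      2 * (m * s) * wsaDelta d q lam n D ≤ C * (m * Real.exp (-c * (n + 1))) ^ 2 := by
  set r := lam * √(d : ℝ) with hr
  have hr0 : 0 ≤ r := by positivity
  have hr1 : r < 1 := by
    have : r ^ 2 < 1 := by
      rw [hr, mul_pow, Real.sq_sqrt (Nat.cast_nonneg _), mul_comm]; exact hKS
    nlinarith
  obtain ⟨B, hB0, hB⟩ := wsa_pow_bound r ((r + 1) / 2) hr0 (by linarith)
  set r' := (r + 1) / 2 with hr'
  have hr'0 : 0 < r' := by rw [hr']; linarith
  have hr'1 : r' < 1 := by rw [hr']; linarith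
  have hl : 0 < 1 - lam := by linarith
  have hlog : 0 ≤ Real.log ((d : ℝ) + 1) := Real.log_nonneg (by
    have : (0 : ℝ) ≤ d := Nat.cast_nonneg _
    linarith)
  set K := (q : ℝ) ^ 3 / (1 - lam) * ((q : ℝ) ^ s * Real.log ((d : ℝ) + 1) + 1) with hK
  have hK0 : 0 ≤ K := by positivity
  refine ⟨-Real.log r' / 2, by have := Real.log_neg hr'0 hr'1; linarith,
    max 1 (2 * s * K * B), le_max_left _ _, fun n m D hD hm => ?_⟩
  have hm' : (1 : ℝ) ≤ m := by exact_mod_cast hm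
  have hexp : Real.exp (-(-Real.log r' / 2) * ((n : ℝ) + 1)) ^ 2 = r' ^ (n + 1) := by
    rw [← Real.exp_nat_mul]
    have : ((2 : ℕ) : ℝ) * (-(-Real.log r' / 2) * ((n : ℝ) + 1)) = ((n + 1 : ℕ) : ℝ) * Real.log r' := by
      push_cast; ring
    rw [this, Real.exp_nat_mul, Real.exp_log hr'0]
  have hdelta : wsaDelta d q lam n D ≤ K * m * (((n + 1 : ℕ) : ℝ) * r ^ (n + 1)) := by
    have hl2 : Real.log (((d ^ (n + 1) : ℕ) : ℝ) + 1) ≤ ((n + 1 : ℕ) : ℝ) * Real.log ((d : ℝ) + 1) := by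
      rw [← Real.log_pow]
      apply Real.log_le_log (by positivity)
      have : d ^ (n + 1) + 1 ≤ (d + 1) ^ (n + 1) :=
        Nat.lt_iff_add_one_le.1 (Nat.pow_lt_pow_left (Nat.lt_succ_self d) (by omega))
      exact_mod_cast this
    have hs : √((d ^ (n + 1) : ℕ) : ℝ) = √(d : ℝ) ^ (n + 1) := by
      push_cast
      rw [Real.sqrt_eq_iff_mul_self_eq (by positivity) (by positivity), ← mul_pow,
        Real.mul_self_sqrt (Nat.cast_nonneg _)]
    have hD' : (D : ℝ) ≤ m * (q : ℝ) ^ s := by exact_mod_cast hD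
    have hn1 : (1 : ℝ) ≤ ((n + 1 : ℕ) : ℝ) := by exact_mod_cast Nat.succ_le_succ (Nat.zero_le n)
    have hin : (D : ℝ) * Real.log (((d ^ (n + 1) : ℕ) : ℝ) + 1) + 1 / 2 ≤
        m * ((n + 1 : ℕ) : ℝ) * ((q : ℝ) ^ s * Real.log ((d : ℝ) + 1) + 1) := by
      have a1 : (D : ℝ) * Real.log (((d ^ (n + 1) : ℕ) : ℝ) + 1) ≤
          (m * (q : ℝ) ^ s) * (((n + 1 : ℕ) : ℝ) * Real.log ((d : ℝ) + 1)) := by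
        have := Real.log_nonneg (x := ((d ^ (n + 1) : ℕ) : ℝ) + 1) (le_add_of_nonneg_left (Nat.cast_nonneg _))
        gcongr
      have a2 : (1 : ℝ) ≤ m * ((n + 1 : ℕ) : ℝ) := by nlinarith
      nlinarith
    unfold wsaDelta
    rw [hs]
    calc _ ≤ lam ^ n * (lam * q / (1 - lam) * ((q : ℝ) ^ 2 * (√(d : ℝ) ^ (n + 1) *
          (m * ((n + 1 : ℕ) : ℝ) * ((q : ℝ) ^ s * Real.log ((d : ℝ) + 1) + 1))))) := by gcongr
      _ = _ := by
        rw [hK, hr, mul_pow]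
        field_simp
        ring
  calc 2 * (m * s) * wsaDelta d q lam n D
      ≤ 2 * (m * s) * (K * m * (((n + 1 : ℕ) : ℝ) * r ^ (n + 1))) := by gcongr
    _ ≤ 2 * (m * s) * (K * m * (B * r' ^ (n + 1))) := by
        have := hB (n + 1)
        gcongr
    _ = (2 * s * K * B) * ((m : ℝ) ^ 2 * r' ^ (n + 1)) := by ring
    _ ≤ max 1 (2 * s * K * B) * ((m : ℝ) ^ 2 * r' ^ (n + 1)) := by
        gcongr
        exact le_max_right _ _
    _ = _ := by rw [mul_pow, hexp]

open Classical in
theorem wsa_coef_sum (d h h0 h1 : ℕ) (h01 : h0 < h1) (h1h : h1 < h) (Z : Type) [Fintype Z]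
    (ζ : Z → ℝ) (hζ : ∑ z, ζ z = 1) :
    ∑ ins : Inst d h0 h1, ∑ t : Leaf d h × Z, instPMF d h0 h1 h01 ins *
      (if InLabeledSet d h h0 h1 h01 h1h ins t.1 then 0
               else 1 / ((Finset.univ.filter fun f : Leaf d h =>
                  ¬ InLabeledSet d h h0 h1 h01 h1h ins f).card : ℝ)) * ζ t.2 ≤ 1 := by
  have e1 : ∀ ins : Inst d h0 h1, ∑ t : Leaf d h × Z, instPMF d h0 h1 h01 ins *
      (if InLabeledSet d h h0 h1 h01 h1h ins t.1 then 0
               else 1 / ((Finset.univ.filter fun f : Leaf d h =>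
                  ¬ InLabeledSet d h h0 h1 h01 h1h ins f).card : ℝ)) * ζ t.2 ≤
      instPMF d h0 h1 h01 ins := by
    intro ins
    have hp : 0 ≤ instPMF d h0 h1 h01 ins := by unfold instPMF; split_ifs <;> positivity
    rw [Fintype.sum_prod_type]
    change ∑ w : Leaf d h, ∑ z : Z, instPMF d h0 h1 h01 ins *
      (if InLabeledSet d h h0 h1 h01 h1h ins w then 0
               else 1 / ((Finset.univ.filter fun f : Leaf d h =>
                  ¬ InLabeledSet d h h0 h1 h01 h1h ins f).card : ℝ)) * ζ z ≤ _
    simp_rw [← Finset.mul_sum, hζ, mul_one]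
    rw [← Finset.mul_sum]
    refine mul_le_of_le_one_right hp ?_
    have : ∑ w : Leaf d h, (if InLabeledSet d h h0 h1 h01 h1h ins w then 0
               else 1 / ((Finset.univ.filter fun f : Leaf d h =>
                  ¬ InLabeledSet d h h0 h1 h01 h1h ins f).card : ℝ)) =
        ∑ w ∈ Finset.univ.filter (fun f : Leaf d h => ¬ InLabeledSet d h h0 h1 h01 h1h ins f),
          1 / ((Finset.univ.filter fun f : Leaf d h =>
                  ¬ InLabeledSet d h h0 h1 h01 h1h ins f).card : ℝ) := by
      rw [Finset.sum_filter]
      refine Finset.sum_congr rfl fun w _ => ?_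
      by_cases hw : InLabeledSet d h h0 h1 h01 h1h ins w <;> simp [hw]
    rw [this, Finset.sum_const, nsmul_eq_mul, mul_one_div]
    exact div_self_le_one _
  refine (Finset.sum_le_sum fun ins _ => e1 ins).trans ?_
  have : ∑ ins, instPMF d h0 h1 h01 ins = ∑ ins ∈ Finset.univ.filter
      (fun j : Inst d h0 h1 => ValidInst d h0 h1 h01 j),
      1 / ((Finset.univ.filter fun j : Inst d h0 h1 => ValidInst d h0 h1 h01 j).card : ℝ) := by
    rw [Finset.sum_filter]
    rfl
  rw [this, Finset.sum_const, nsmul_eq_mul, mul_one_div]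
  exact div_self_le_one _

open Classical in
theorem wsa_main (d q s : ℕ) (lam : ℝ) (hd : 0 < d) (hq : 0 < q) (hlam0 : 0 ≤ lam) (hlam1 : lam < 1)
    (n h0 h1 k m : ℕ) (h01 : h0 < h1) (h1h : h1 < h1 + (n + 1))
    (A : Fin m → Finset (Fin k)) (hA : ∀ j, (A j).card ≤ s)
    (Z : Type) [Fintype Z] (ζ : Z → ℝ) (hζ0 : ∀ z, 0 ≤ ζ z) (hζ : ∑ z, ζ z = 1)
    (g : Leaf d (h1 + (n + 1)) → (Leaf d (h1 + (n + 1)) → Option (RepSpace q k)) →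
          ((j : Fin m) → ({i // i ∈ A j} → Fin q) → Fin (d ^ h0) → ℕ) →
          Z → Fin (d ^ h0)) (S : ℝ)
    (hS : S = ∑ R : Vtx d (h1 + (n + 1)) → RepSpace q k, ∑ ins : Inst d h0 h1,
          ∑ w : Leaf d (h1 + (n + 1)), ∑ z : Z,
            iidmPMF d (h1 + (n + 1)) q k lam R * instPMF d h0 h1 h01 ins *
              (if InLabeledSet d (h1 + (n + 1)) h0 h1 h01 h1h ins w then 0
               else 1 / ((Finset.univ.filter fun f : Leaf d (h1 + (n + 1)) =>
                  ¬ InLabeledSet d (h1 + (n + 1)) h0 h1 h01 h1h ins f).card : ℝ)) *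
              ζ z *
              (if g w (unlabeledData d (h1 + (n + 1)) q k h0 h1 h01 h1h ins R)
                    (countsOf d (h1 + (n + 1)) q k h0 h1 m h01 h1h A ins R) z =
                  labelOf d (h1 + (n + 1)) h0 h1 h01 h1h ins w then 1 else 0)) :
    S ≤ 1 ∧ ∃ D : ℕ, D ≤ m * q ^ s ∧
      S ≤ 1 / ((d ^ h0 : ℕ) : ℝ) + (2 * d ^ h0 : ℕ) * (m * s : ℕ) * wsaDelta d q lam n D := by
  set coef : Inst d h0 h1 → Leaf d (h1 + (n + 1)) × Z → ℝ := fun ins t =>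
    instPMF d h0 h1 h01 ins *
      (if InLabeledSet d (h1 + (n + 1)) h0 h1 h01 h1h ins t.1 then 0
               else 1 / ((Finset.univ.filter fun f : Leaf d (h1 + (n + 1)) =>
                  ¬ InLabeledSet d (h1 + (n + 1)) h0 h1 h01 h1h ins f).card : ℝ)) * ζ t.2 with hcoef
  have hc0 : ∀ i t, 0 ≤ coef i t := by
    intro ins t
    have hp : 0 ≤ instPMF d h0 h1 h01 ins := by unfold instPMF; split_ifs <;> positivity
    refine mul_nonneg (mul_nonneg hp ?_) (hζ0 _)
    split_ifs <;> positivity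
  have hcs : ∑ i, ∑ t, coef i t ≤ 1 := wsa_coef_sum d (h1 + (n + 1)) h0 h1 h01 h1h Z ζ hζ
  set F : Inst d h0 h1 → Leaf d (h1 + (n + 1)) × Z → (Leaf d (h1 + (n + 1)) → Option (RepSpace q k)) →
          ((j : Fin m) → ({i // i ∈ A j} → Fin q) → Fin (d ^ h0) → ℕ) → ℝ := fun ins t x y =>
      if g t.1 x y t.2 = ins.1 (wsaPre h01 (wsaTake t.1)) then 1 else 0 with hF
  have hF0 : ∀ i t x y, 0 ≤ F i t x y := by
    intro i t x y; simp only [hF]; split_ifs <;> norm_num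
  have hF1 : ∀ i t x y, F i t x y ≤ 1 := by
    intro i t x y; simp only [hF]; split_ifs <;> norm_num
  have hS' : S = ∑ ins, ∑ t, coef ins t * ∑ R : Vtx d (h1 + (n + 1)) → RepSpace q k,
      iidmPMF d (h1 + (n + 1)) q k lam R *
        F ins t (wsaUnl d (h1 + (n + 1)) q k h0 h1 h01 h1h ins (fun f => R (leafVtx f)))
          (wsaCnt d (h1 + (n + 1)) q k h0 h1 m h01 h1h A ins (fun f => R (leafVtx f))) := by
    rw [hS, Finset.sum_comm]
    refine Finset.sum_congr rfl fun ins _ => ?_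
    simp_rw [Finset.mul_sum]
    rw [Finset.sum_comm (s := (Finset.univ : Finset (Leaf d (h1 + (n + 1)) × Z)))]
    refine Finset.sum_congr rfl fun R _ => ?_
    rw [Fintype.sum_prod_type]
    refine Finset.sum_congr rfl fun w _ => ?_
    refine Finset.sum_congr rfl fun z _ => ?_
    have hring : ∀ a b c d e : ℝ, a * b * c * d * e = b * c * d * (a * e) := by intros; ring
    exact hring _ _ _ _ _
  constructor
  · rw [hS']
    refine le_trans ?_ hcs
    refine Finset.sum_le_sum fun ins _ => Finset.sum_le_sum fun t _ => ?_
    refine mul_le_of_le_one_right (hc0 _ _) ?_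
    rw [← wsa_iidm_sum d (h1 + (n + 1)) q k hq lam]
    refine Finset.sum_le_sum fun R _ => ?_
    exact mul_le_of_le_one_right (wsa_iidm_nonneg d _ q k lam hlam0 hlam1.le R) (hF1 _ _ _ _)
  · obtain ⟨ρ, hρ0, hρ, hmk⟩ := wsa_markov d h1 q k hq lam hlam0 hlam1.le
    have hS2 : S = ∑ ins, ∑ t, coef ins t * ∑ Y, ρ Y *
        ∑ X : (Fin h1 → Fin d) × Fin k → (Fin (n + 1) → Fin d) → Fin q,
        (∏ r, wsaNu d q lam (n + 1) (Y r) (X r)) *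
        F ins t (wsaUnl d (h1 + (n + 1)) q k h0 h1 h01 h1h ins (wsaAsm X))
          (wsaCnt d (h1 + (n + 1)) q k h0 h1 m h01 h1h A ins (wsaAsm X)) := by
      rw [hS']
      refine Finset.sum_congr rfl fun ins _ => Finset.sum_congr rfl fun t _ => ?_
      congr 1
      exact hmk (n + 1) (fun D => F ins t (wsaUnl d (h1 + (n + 1)) q k h0 h1 h01 h1h ins D)
          (wsaCnt d (h1 + (n + 1)) q k h0 h1 m h01 h1h A ins D))
    rw [hS2]
    refine ⟨_, wsa_card_iota hq A hA, ?_⟩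
    refine wsa_assemble coef hc0 (fun ψ ψ' e t => rfl) hcs ρ hρ0 hρ _
      (fun ins t Y => ∑ X : (Fin h1 → Fin d) × Fin k → (Fin (n + 1) → Fin d) → Fin q,
        (∏ r, wsaNu d q lam (n + 1) (if wsaSel h01 ins.2 r.1 then ⟨0, hq⟩ else Y r) (X r)) *
        F ins t (wsaUnl d (h1 + (n + 1)) q k h0 h1 h01 h1h ins (wsaAsm X))
          (wsaCnt d (h1 + (n + 1)) q k h0 h1 m h01 h1h A ins (wsaAsm X)))
      _ _ ?_ (by positivity) ?_ ?_
    · have := wsaDelta_nonneg d q lam hlam0 hlam1 n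
        (Fintype.card (Σ j : Fin m, ({i // i ∈ A j} → Fin q)))
      positivity
    · intro ins t Y
      exact wsa_repl d q k h0 h1 m n s hd hq lam hlam0 hlam1 h01 h1h A hA ins (F ins t)
        (fun x y => abs_le.2 ⟨by linarith [hF0 ins t x y], hF1 ins t x y⟩) Y ⟨0, hq⟩
    · intro ψ0 e t Y hne
      have hval : ValidInst d h0 h1 h01 (ψ0, e) := by
        by_contra hv
        apply hne
        simp [hcoef, instPMF, hv]
      have he : ∀ u, (e u).1 ≠ (e u).2 := by
        intro u hu
        apply hval u
        change (e u).1 _ = (e u).2 _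
        rw [hu]
      exact wsa_sym_conc d q k h0 h1 m (n + 1) hq lam h01 h1h A e he
        (fun x y => g t.1 x y t.2)
        (fun r => if wsaSel h01 e r.1 then ⟨0, hq⟩ else Y r) ⟨0, hq⟩
        (fun v i hv => by simp [hv]) (wsaPre h01 (wsaTake t.1))

open Classical in
/-- Weakness of shallow learning: if `d·λ² < 1`, then there are constants `c, C > 0`
depending only on `d, q, λ, s` such that for every depth parameters `h0 < h1 < h`,
every `A = (A₁,…,A_m)` with `|A_j| ≤ s`, and the IIDM together with an independent
random instance `I(h0,h1)`, every (possibly randomized) shallow algorithm — a function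
of the queried leaf and of the compression `C_A(D)` (the uncompressed unlabeled data
together with the counts `n_D(A_j, x, ℓ)`) and of independent external randomness —
labels a uniformly random unlabeled leaf correctly with probability at most
`d^{−h0} + C·m·d^{h0}·exp(−c·(h−h1))`. -/
theorem weakness_of_shallow_algorithms
    (d q s : ℕ) (lam : ℝ)
    (hd : 2 ≤ d) (hq : 2 ≤ q)
    (hlam0 : 0 ≤ lam) (hlam1 : lam ≤ 1)
    (hKS : (d : ℝ) * lam ^ 2 < 1) :
    ∃ c : ℝ, 0 < c ∧ ∃ C : ℝ, 0 < C ∧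
      ∀ (h h0 h1 k m : ℕ), 1 ≤ k → 0 < h0 → ∀ (h01 : h0 < h1) (h1h : h1 < h),
      ∀ A : Fin m → Finset (Fin k), (∀ j, (A j).card ≤ s) →
      ∀ (Z : Type) (_ : Fintype Z) (ζ : Z → ℝ), (∀ z, 0 ≤ ζ z) → (∑ z, ζ z = 1) →
      ∀ g : Leaf d h → (Leaf d h → Option (RepSpace q k)) →
          ((j : Fin m) → ({i // i ∈ A j} → Fin q) → Fin (d ^ h0) → ℕ) →
          Z → Fin (d ^ h0),
        (∑ R : Vtx d h → RepSpace q k, ∑ ins : Inst d h0 h1, ∑ w : Leaf d h, ∑ z : Z,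
            iidmPMF d h q k lam R * instPMF d h0 h1 h01 ins *
              (if InLabeledSet d h h0 h1 h01 h1h ins w then 0
               else 1 / ((Finset.univ.filter fun f : Leaf d h =>
                  ¬ InLabeledSet d h h0 h1 h01 h1h ins f).card : ℝ)) *
              ζ z *
              (if g w (unlabeledData d h q k h0 h1 h01 h1h ins R)
                    (countsOf d h q k h0 h1 m h01 h1h A ins R) z =
                  labelOf d h h0 h1 h01 h1h ins w then 1 else 0)) ≤
          1 / (d : ℝ) ^ h0 + C * m * (d : ℝ) ^ h0 * Real.exp (-c * ((h : ℝ) - h1)) := by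
  have hl1 : lam < 1 := by
    have : (2 : ℝ) ≤ d := by exact_mod_cast hd
    nlinarith
  obtain ⟨c, hc, C, hC, hb⟩ := wsa_analytic d q s (by omega) (by omega) lam hlam0 hl1 hKS
  refine ⟨c, hc, C, by linarith, ?_⟩
  intro h h0 h1 k m hk hh0 h01 h1h A hA Z _ ζ hζ0 hζ g
  obtain ⟨n, rfl⟩ : ∃ n, h = h1 + (n + 1) := ⟨h - h1 - 1, by omega⟩
  obtain ⟨a1, D, hD, a2⟩ := wsa_main d q s lam (by omega) (by omega) hlam0 hl1 n h0 h1 k m h01 h1h A hA Z ζ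
    hζ0 hζ g _ rfl
  have hcast : ((h1 + (n + 1) : ℕ) : ℝ) - h1 = n + 1 := by push_cast; ring
  rw [hcast]
  have hM : (1 : ℝ) ≤ (d : ℝ) ^ h0 := one_le_pow₀ (by
    have : (2 : ℝ) ≤ d := by exact_mod_cast hd
    linarith)
  have hM0 : 0 ≤ 1 / (d : ℝ) ^ h0 := by positivity
  rcases Nat.eq_zero_or_pos m with hm | hm
  · refine a2.trans ?_
    subst hm
    simp
  · set x := (m : ℝ) * Real.exp (-c * (n + 1)) with hx
    have hx0 : 0 ≤ x := by positivity
    have hrw : C * m * (d : ℝ) ^ h0 * Real.exp (-c * (n + 1)) = C * (d : ℝ) ^ h0 * x := by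
      rw [hx]; ring
    rw [hrw]
    rcases le_total x 1 with h | h
    · refine a2.trans ?_
      have hb' := hb n m _ hD hm
      push_cast
      refine add_le_add le_rfl ?_
      calc _ = (d : ℝ) ^ h0 * (2 * (m * s) * wsaDelta d q lam n D) := by ring
        _ ≤ (d : ℝ) ^ h0 * (C * x ^ 2) := by gcongr
        _ ≤ (d : ℝ) ^ h0 * (C * x) := by
            gcongr
            nlinarith
        _ = _ := by ring
    · refine a1.trans ?_
      have : 1 ≤ C * (d : ℝ) ^ h0 * x := one_le_mul_of_one_le_of_one_le
        (one_le_mul_of_one_le_of_one_le hC hM) h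
      linarith
end

section
/- Let T be a finite rooted tree, let v be a vertex of T, and let v1, v2 be leaves of T that are descendants of v such that the unique path from v to v1 and the unique path from v to v2 are edge-disjoint. Then for every set S' of leaves of T with v1 ∈ S', v2 ∈ S', and every leaf in S' a descendant of v, the least common ancestor of S' equals v; consequently the set of leaves descending from the least common ancestor of S' is exactly the set of leaves descending from v. (Proposition: well-represented labels are identifiable from the tree.) -/
/-- In a rooted tree given by a parent function `par`, `u` is an ancestor of `w`
(equivalently, `w` is a descendant of `u`) iff some iterate of `par` sends `w` to `u`.
Every vertex is an ancestor of itself. -/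
def IsAnc {V : Type} (par : V → V) (u w : V) : Prop :=
  ∃ n : ℕ, par^[n] w = u

/-- A leaf is a vertex with no children. -/
def IsLeaf {V : Type} (par : V → V) (v : V) : Prop :=
  ∀ u : V, par u = v → u = v

/-- `u` is a least common ancestor of the set `S'`: it is a common ancestor of all of `S'`
and a descendant of every common ancestor of `S'`. -/
def IsLCA {V : Type} (par : V → V) (S' : Set V) (u : V) : Prop :=
  (∀ w ∈ S', IsAnc par u w) ∧ ∀ u' : V, (∀ w ∈ S', IsAnc par u' w) → IsAnc par u' u

/-- The set of edges (identified with their lower endpoints) on the downward path from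
`v` to its descendant `w`: vertices `a ≠ v` lying on the path, each contributing the
edge `(a, par a)`. -/
def PathEdges {V : Type} (par : V → V) (v w : V) : Set V :=
  {a | IsAnc par v a ∧ IsAnc par a w ∧ a ≠ v}

theorem IsAnc.trans' {V : Type} {par : V → V} {a b c : V}
    (h : IsAnc par a b) (h' : IsAnc par b c) : IsAnc par a c := by
  obtain ⟨n, rfl⟩ := h
  obtain ⟨m, rfl⟩ := h'
  exact ⟨n + m, Function.iterate_add_apply par n m c⟩

theorem IsAnc.comparable {V : Type} {par : V → V} {a b c : V}
    (h : IsAnc par a c) (h' : IsAnc par b c) : IsAnc par a b ∨ IsAnc par b a := by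
  obtain ⟨n, rfl⟩ := h
  obtain ⟨m, rfl⟩ := h'
  rcases le_total m n with hle | hle
  · left
    exact ⟨n - m, by rw [← Function.iterate_add_apply, Nat.sub_add_cancel hle]⟩
  · right
    exact ⟨m - n, by rw [← Function.iterate_add_apply, Nat.sub_add_cancel hle]⟩

/-- Well-represented labels are identifiable from the tree: in a finite rooted tree
(encoded by a parent map `par` fixing the root, with every vertex reaching the root),
if `v1, v2` are leaves below `v` whose paths from `v` are edge-disjoint, then for every
set `S'` of leaves containing `v1` and `v2` all of whose elements are descendants of `v`,
the least common ancestor of `S'` is exactly `v`; consequently the leaves below the least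
common ancestor of `S'` are exactly the leaves below `v`. -/
theorem well_represented_identifiable {V : Type} [Fintype V]
    (par : V → V) (root : V) (hroot : par root = root)
    (hreach : ∀ v : V, ∃ n : ℕ, par^[n] v = root)
    (v v1 v2 : V)
    (hleaf1 : IsLeaf par v1) (hleaf2 : IsLeaf par v2)
    (hdesc1 : IsAnc par v v1) (hdesc2 : IsAnc par v v2)
    (hdisj : Disjoint (PathEdges par v v1) (PathEdges par v v2))
    (S' : Set V) (hS'leaf : ∀ w ∈ S', IsLeaf par w)
    (h1 : v1 ∈ S') (h2 : v2 ∈ S') (hS'desc : ∀ w ∈ S', IsAnc par v w) :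
    IsLCA par S' v ∧
      ∀ u : V, IsLCA par S' u →
        {l : V | IsLeaf par l ∧ IsAnc par u l} = {l : V | IsLeaf par l ∧ IsAnc par v l} := by
  have key : IsLCA par S' v := by
    refine ⟨hS'desc, fun u' hu' => ?_⟩
    rcases IsAnc.comparable (hu' v1 h1) hdesc1 with h | h
    · exact h
    · by_cases he : u' = v
      · exact ⟨0, he.symm⟩
      · exact absurd ⟨h, hu' v2 h2, he⟩
          (Set.disjoint_left.mp hdisj ⟨h, hu' v1 h1, he⟩)
  refine ⟨key, fun u hu => ?_⟩
  have huv : IsAnc par u v := key.2 u hu.1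
  have hvu : IsAnc par v u := hu.2 v key.1
  ext l
  exact ⟨fun h => ⟨h.1, hvu.trans' h.2⟩, fun h => ⟨h.1, huv.trans' h.2⟩⟩
end

section
/- Assume d·λ² > 1. Then there exist λ1 > 0 and r ∈ ℕ (depending only on d, q, λ) such that the following holds for every λ2 ∈ [λ1, 1] and every λ2' ∈ [λ1, 1] per leaf (all leaf noise levels at least λ1; for the statement take a common λ2 ≥ λ1): consider the depth-r broadcast with k = 1 and root value x ∈ Fin q, and let the observation at each leaf v be R'(v), which independently equals R(v) with probability λ2 and is uniform on Fin q with probability 1 − λ2. Then there exist λ3 ≥ λ1 and a function f : (Fin q)^{L_T} → Fin q such that for every root value x ∈ Fin q and every y ∈ Fin q, P[f(R') = y | root value x] = λ3·1[y = x] + (1 − λ3)/q. (Proposition on ancestral reconstruction in the Kesten–Stigum regime.) -/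
/-- Joint probability mass function of the depth-`r` broadcast (with `k = 1`) with root
value pinned to `x`, together with noisy leaf observations: each leaf `v` is observed
through the `q`-ary symmetric channel with retention parameter `λ₂`, i.e. `R'(v) = R(v)`
with probability `λ₂` and `R'(v)` uniform otherwise, independently over leaves. -/
noncomputable def obsPMF (d r q : ℕ) (lam lam2 : ℝ) (x : Fin q)
    (RR' : (Vtx d r → Fin q) × (Leaf d r → Fin q)) : ℝ :=
  (if RR'.1 (root d r) = x then 1 else 0) *
    (∏ v : Vtx d r,
      if (v.1 : ℕ) = 0 then 1
      else edgeFactor q lam (RR'.1 v) (RR'.1 (parent v))) *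
    ∏ f : Leaf d r, edgeFactor q lam2 (RR'.2 f) (RR'.1 (leafVtx f))


open Finset in
lemma ar_sum_update {V : Type*} [Fintype V] [DecidableEq V] {q : ℕ} (v : V)
    (F : (V → Fin q) → ℝ) :
    ∑ R : V → Fin q, ∑ a : Fin q, F (Function.update R v a) = q * ∑ R, F R := by
  have key : ∀ H : (V → Fin q) → ℝ, ∑ R, H R =
      ∑ y : ({j // j ≠ v} → Fin q), ∑ b, H ((Equiv.funSplitAt v (Fin q)).symm (b, y)) := by
    intro H
    rw [← (Equiv.funSplitAt v (Fin q)).symm.sum_comp, Fintype.sum_prod_type, Finset.sum_comm]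
  rw [key, key, Finset.mul_sum]
  refine Finset.sum_congr rfl fun y _ => ?_
  have : ∀ b a, Function.update ((Equiv.funSplitAt v (Fin q)).symm (b, y)) v a
      = (Equiv.funSplitAt v (Fin q)).symm (a, y) := by
    intro b a
    ext w
    by_cases h : w = v
    · subst h; simp [Equiv.funSplitAt, Equiv.piSplitAt]
    · simp [Equiv.funSplitAt, Equiv.piSplitAt, h]
  simp [this]

lemma ar_edge_sum {q : ℕ} (hq : 2 ≤ q) (lam : ℝ) (h : Fin q → ℝ) (b : Fin q) :
    ∑ a, edgeFactor q lam a b * h a = lam * h b + (1 - lam) * ((∑ a, h a) / q) := by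
  unfold edgeFactor
  simp only [add_mul, Finset.sum_add_distrib, mul_assoc, ← Finset.mul_sum]
  simp
  ring

lemma ar_edge_sum_one {q : ℕ} (hq : 2 ≤ q) (lam : ℝ) (b : Fin q) :
    ∑ a, edgeFactor q lam a b = 1 := by
  have := ar_edge_sum hq lam (fun _ => 1) b
  have hq' : (q : ℝ) ≠ 0 := by positivity
  simp only [mul_one] at this
  rw [this]; simp; field_simp; ring

lemma ar_edge_symm {q : ℕ} (lam : ℝ) (a b : Fin q) :
    edgeFactor q lam a b = edgeFactor q lam b a := by
  unfold edgeFactor; simp [eq_comm]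

open Finset in
lemma ar_tree_sum {V : Type*} [Fintype V] [DecidableEq V] {q : ℕ} (hq : 2 ≤ q) (lam : ℝ)
    (lev : V → ℕ) (p : V → V) (ρ : V) (hρ : lev ρ = 0) (x : Fin q) (n : ℕ) :
    ∀ (S : Finset V), S.card = n →
      (∀ v ∈ S, v ≠ ρ ∧ lev (p v) + 1 = lev v ∧ (p v = ρ ∨ p v ∈ S)) →
      ∀ (u : V), (u = ρ ∨ u ∈ S) → ∀ h : Fin q → ℝ,
      (q : ℝ) ^ (n + 1) * ∑ R : V → Fin q, (if R ρ = x then 1 else 0) *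
        (∏ v ∈ S, edgeFactor q lam (R v) (R (p v))) * h (R u) =
      (q : ℝ) ^ (Fintype.card V) *
        (lam ^ (lev u) * h x + (1 - lam ^ (lev u)) * ((∑ a, h a) / q)) := by
  have hq' : (q : ℝ) ≠ 0 := by positivity
  induction n with
  | zero =>
    intro S hS _ u hu h
    rw [Finset.card_eq_zero] at hS
    subst hS
    simp only [Finset.notMem_empty, or_false] at hu
    subst hu
    simp only [zero_add, pow_one]
    rw [← ar_sum_update u]
    simp [hρ]
  | succ n ih =>
    intro S hS hcl u hu h
    have hne : S.Nonempty := by rw [← Finset.card_pos]; omega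
    obtain ⟨v, hvS, hmax⟩ := Finset.exists_max_image S lev hne
    have hcard : (S.erase v).card = n := by rw [Finset.card_erase_of_mem hvS]; omega
    have hpne : ∀ w ∈ S, p w ≠ v := by
      intro w hw e
      have := hmax w hw
      have := (hcl w hw).2.1
      rw [e] at this
      omega
    have hcl' : ∀ w ∈ S.erase v, w ≠ ρ ∧ lev (p w) + 1 = lev w ∧ (p w = ρ ∨ p w ∈ S.erase v) := by
      intro w hw
      have hwS := Finset.mem_of_mem_erase hw
      obtain ⟨h1, h2, h3⟩ := hcl w hwS
      refine ⟨h1, h2, ?_⟩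
      rcases h3 with h3 | h3
      · exact Or.inl h3
      · exact Or.inr (Finset.mem_erase.2 ⟨hpne w hwS, h3⟩)
    have hvρ := (hcl v hvS).1
    have hstep : ∀ (R : V → Fin q) (a : Fin q),
        (if (Function.update R v a) ρ = x then (1:ℝ) else 0) *
        (∏ w ∈ S, edgeFactor q lam (Function.update R v a w) (Function.update R v a (p w)))
        = (if R ρ = x then 1 else 0) *
          (∏ w ∈ S.erase v, edgeFactor q lam (R w) (R (p w))) * edgeFactor q lam a (R (p v)) := by
      intro R a
      rw [Function.update_of_ne hvρ.symm, ← Finset.prod_erase_mul _ _ hvS, Function.update_self,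
        Function.update_of_ne (hpne v hvS), mul_assoc]
      congr 2
      refine Finset.prod_congr rfl fun w hw => ?_
      rw [Function.update_of_ne (Finset.ne_of_mem_erase hw),
        Function.update_of_ne (hpne w (Finset.mem_of_mem_erase hw))]
    rw [pow_succ, mul_assoc, ← ar_sum_update v]
    simp only [hstep]
    by_cases huv : u = v
    · subst huv
      simp only [Function.update_self, mul_assoc, ← Finset.mul_sum]
      simp only [ar_edge_sum hq]
      have hu' : p u = ρ ∨ p u ∈ S.erase u := by
        rcases (hcl u hvS).2.2 with h3 | h3
        · exact Or.inl h3
        · exact Or.inr (Finset.mem_erase.2 ⟨hpne u hvS, h3⟩)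
      have := ih (S.erase u) hcard hcl' (p u) hu'
        (fun b => lam * h b + (1 - lam) * ((∑ a, h a) / q))
      simp only [mul_assoc] at this
      rw [this, ← (hcl u hvS).2.1]
      simp only [Finset.sum_add_distrib, ← Finset.mul_sum]
      simp
      left
      field_simp
      ring
    · have hu' : u = ρ ∨ u ∈ S.erase v := by
        rcases hu with h3 | h3
        · exact Or.inl h3
        · exact Or.inr (Finset.mem_erase.2 ⟨huv, h3⟩)
      simp only [Function.update_of_ne huv]
      have := ih (S.erase v) hcard hcl' u hu' h
      rw [← this]
      congr 1
      refine Finset.sum_congr rfl fun R _ => ?_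
      rw [← Finset.sum_mul, ← Finset.mul_sum, ar_edge_sum_one hq, mul_one]

/-- The weight of the tree configuration -/
noncomputable def arW (d r q : ℕ) (lam : ℝ) (x : Fin q) (R : Vtx d r → Fin q) : ℝ :=
  (if R (root d r) = x then 1 else 0) *
    (∏ v : Vtx d r,
      if (v.1 : ℕ) = 0 then 1
      else edgeFactor q lam (R v) (R (parent v)))

lemma ar_root_of {d r : ℕ} (v : Vtx d r) (h : (v.1 : ℕ) = 0) : v = root d r := by
  obtain ⟨⟨l, hl⟩, g⟩ := v
  simp only at h
  subst h
  unfold root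
  congr 1
  funext i
  exact i.elim0

lemma ar_W_sum {d r q : ℕ} (hq : 2 ≤ q) (lam : ℝ) (x : Fin q) (u : Vtx d r) (h : Fin q → ℝ) :
    ∑ R : Vtx d r → Fin q, arW d r q lam x R * h (R u) =
      lam ^ (u.1 : ℕ) * h x + (1 - lam ^ (u.1 : ℕ)) * ((∑ a, h a) / q) := by
  have hq' : (q : ℝ) ≠ 0 := by positivity
  have key := ar_tree_sum hq lam (fun v : Vtx d r => (v.1 : ℕ)) parent (root d r) rfl x
    _ (Finset.univ.erase (root d r)) rfl ?_ u ?_ h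
  · have hc : (Finset.univ.erase (root d r)).card + 1 = Fintype.card (Vtx d r) := by
      rw [Finset.card_erase_of_mem (Finset.mem_univ _), Finset.card_univ]
      have : 0 < Fintype.card (Vtx d r) := Fintype.card_pos_iff.2 ⟨root d r⟩
      omega
    rw [hc] at key
    have := mul_left_cancel₀ (pow_ne_zero _ hq') key
    rw [← this]
    refine Finset.sum_congr rfl fun R _ => ?_
    unfold arW
    congr 2
    rw [← Finset.prod_erase_mul _ _ (Finset.mem_univ (root d r))]
    have : (((root d r).1 : Fin (r+1)) : ℕ) = 0 := rfl
    rw [if_pos this, mul_one]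
    refine Finset.prod_congr rfl fun v hv => ?_
    rw [if_neg]
    intro h0
    exact Finset.ne_of_mem_erase hv (ar_root_of v h0)
  · intro v hv
    have hne := Finset.ne_of_mem_erase hv
    refine ⟨hne, ?_, ?_⟩
    · have : (v.1 : ℕ) ≠ 0 := fun h0 => hne (ar_root_of v h0)
      show (v.1 : ℕ) - 1 + 1 = v.1
      omega
    · by_cases h : parent v = root d r
      · exact Or.inl h
      · exact Or.inr (Finset.mem_erase.2 ⟨h, Finset.mem_univ _⟩)
  · by_cases h : u = root d r
    · exact Or.inl h
    · exact Or.inr (Finset.mem_erase.2 ⟨h, Finset.mem_univ _⟩)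

lemma ar_W_total {d r q : ℕ} (hq : 2 ≤ q) (lam : ℝ) (x : Fin q) :
    ∑ R : Vtx d r → Fin q, arW d r q lam x R = 1 := by
  have hq' : (q : ℝ) ≠ 0 := by positivity
  have := ar_W_sum (d := d) (r := r) hq lam x (root d r) (fun _ => 1)
  simp only [mul_one] at this
  rw [this]; simp; field_simp; ring

lemma ar_obs_sum {d r q : ℕ} (lam t : ℝ) (x : Fin q) (H : (Leaf d r → Fin q) → ℝ) :
    ∑ RR' : (Vtx d r → Fin q) × (Leaf d r → Fin q), obsPMF d r q lam t x RR' * H RR'.2 =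
    ∑ R, arW d r q lam x R *
      ∑ s : Leaf d r → Fin q, (∏ l : Leaf d r, edgeFactor q t (s l) (R (leafVtx l))) * H s := by
  rw [Fintype.sum_prod_type]
  refine Finset.sum_congr rfl fun R _ => ?_
  rw [Finset.mul_sum]
  refine Finset.sum_congr rfl fun s _ => ?_
  simp only [obsPMF, arW]
  ring

lemma ar_leaf_sum {ι : Type*} [Fintype ι] [DecidableEq ι] {q : ℕ} (hq : 2 ≤ q) (t : ℝ)
    (b : ι → Fin q) (l0 : ι) (h : Fin q → ℝ) :
    ∑ s : ι → Fin q, (∏ l, edgeFactor q t (s l) (b l)) * h (s l0) =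
      ∑ a, edgeFactor q t a (b l0) * h a := by
  have h1 : ∀ s : ι → Fin q, (∏ l, edgeFactor q t (s l) (b l)) * h (s l0) =
      ∏ l, (edgeFactor q t (s l) (b l) * (if l = l0 then h (s l) else 1)) := by
    intro s
    rw [Finset.prod_mul_distrib]
    simp
  simp only [h1]
  rw [← Fintype.prod_sum (fun l a => edgeFactor q t a (b l) * (if l = l0 then h a else 1)),
    ← Finset.mul_prod_erase _ _ (Finset.mem_univ l0)]
  rw [Finset.prod_eq_one, mul_one]
  · simp
  · intro l hl
    simp [Finset.ne_of_mem_erase hl, ar_edge_sum_one hq]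

/-- The single leaf estimator -/
lemma ar_single {d r q : ℕ} (hq : 2 ≤ q) (lam t : ℝ) (l0 : Leaf d r) (x y : Fin q) :
    ∑ RR' : (Vtx d r → Fin q) × (Leaf d r → Fin q),
      obsPMF d r q lam t x RR' * (if RR'.2 l0 = y then 1 else 0) =
    (lam ^ r * t) * (if y = x then 1 else 0) + (1 - lam ^ r * t) / q := by
  have hq' : (q : ℝ) ≠ 0 := by positivity
  rw [ar_obs_sum lam t x (fun s => if s l0 = y then 1 else 0)]
  have h1 : ∀ R : Vtx d r → Fin q,
      ∑ s : Leaf d r → Fin q, (∏ l : Leaf d r, edgeFactor q t (s l) (R (leafVtx l))) * (if s l0 = y then (1:ℝ) else 0)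
      = edgeFactor q t (R (leafVtx l0)) y := by
    intro R
    rw [ar_leaf_sum hq t (fun l => R (leafVtx l)) l0 (fun a => if a = y then 1 else 0)]
    simp [ar_edge_symm t y]
  simp only [h1]
  rw [ar_W_sum hq lam x (leafVtx l0) (fun a => edgeFactor q t a y), ar_edge_sum_one hq]
  have : (((leafVtx l0).1 : Fin (r+1)) : ℕ) = r := rfl
  rw [this, ar_edge_symm t x y]
  unfold edgeFactor
  field_simp
  ring

/-- The symmetric channel from symmetry -/
lemma ar_symm {q : ℕ} (hq : 2 ≤ q) (G : Fin q → Fin q → ℝ) (h1 : ∀ x, ∑ y, G x y = 1)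
    (hG : ∀ (π : Equiv.Perm (Fin q)) x y, G (π x) (π y) = G x y) (x y : Fin q) :
    G x y = ((∑ z, G z z - 1) / (q - 1)) * (if y = x then 1 else 0)
      + (1 - (∑ z, G z z - 1) / (q - 1)) / q := by
  have hq' : (q : ℝ) ≠ 0 := by positivity
  have hq1 : (q : ℝ) - 1 ≠ 0 := by
    have : (2 : ℝ) ≤ q := by exact_mod_cast hq
    linarith
  have hd : ∀ z, G z z = G x x := fun z => by
    have := hG (Equiv.swap x z) x x
    simpa using this
  have hs : ∑ z, G z z = q * G x x := by simp [hd]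
  rw [hs]
  by_cases hxy : y = x
  · subst hxy
    simp
    field_simp
    ring
  · have ho : ∀ z, z ≠ x → G x z = G x y := fun z hz => by
      have := hG (Equiv.swap y z) x y
      rw [Equiv.swap_apply_of_ne_of_ne (Ne.symm hxy) (Ne.symm hz)] at this
      simpa using this
    have hr := h1 x
    rw [← Finset.add_sum_erase _ _ (Finset.mem_univ x),
      Finset.sum_congr rfl (fun z hz => ho z (Finset.ne_of_mem_erase hz))] at hr
    simp only [Finset.sum_const, Finset.card_erase_of_mem (Finset.mem_univ x), Finset.card_univ,
      Fintype.card_fin, nsmul_eq_mul] at hr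
    rw [Nat.cast_sub (by omega), Nat.cast_one] at hr
    rw [if_neg hxy]
    field_simp
    linear_combination (q : ℝ) * hr

lemma ar_edge_perm {q : ℕ} (t : ℝ) (π : Equiv.Perm (Fin q)) (a b : Fin q) :
    edgeFactor q t (π a) (π b) = edgeFactor q t a b := by
  simp [edgeFactor]

lemma ar_obs_perm {d r q : ℕ} (lam t : ℝ) (x : Fin q) (π : Equiv.Perm (Fin q))
    (R : Vtx d r → Fin q) (s : Leaf d r → Fin q) :
    obsPMF d r q lam t (π x) (π ∘ R, π ∘ s) = obsPMF d r q lam t x (R, s) := by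
  simp [obsPMF, ar_edge_perm]

lemma ar_equiv {d r q : ℕ} (hq : 2 ≤ q) (lam t : ℝ) (hr : Nonempty (Leaf d r))
    (f : (Leaf d r → Fin q) → Fin q)
    (hf : ∀ (π : Equiv.Perm (Fin q)) s, f (π ∘ s) = π (f s)) (x y : Fin q) :
    ∑ RR' : (Vtx d r → Fin q) × (Leaf d r → Fin q),
      obsPMF d r q lam t x RR' * (if f RR'.2 = y then 1 else 0) =
    ((∑ z, (∑ RR' : (Vtx d r → Fin q) × (Leaf d r → Fin q),
      obsPMF d r q lam t z RR' * (if f RR'.2 = z then 1 else 0)) - 1) / (q - 1))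
        * (if y = x then 1 else 0)
      + (1 - (∑ z, (∑ RR' : (Vtx d r → Fin q) × (Leaf d r → Fin q),
      obsPMF d r q lam t z RR' * (if f RR'.2 = z then 1 else 0)) - 1) / (q - 1)) / q := by
  refine ar_symm hq (fun x y => ∑ RR' : (Vtx d r → Fin q) × (Leaf d r → Fin q),
      obsPMF d r q lam t x RR' * (if f RR'.2 = y then 1 else 0)) ?_ ?_ x y
  · intro x
    rw [Finset.sum_comm]
    have : ∀ RR' : (Vtx d r → Fin q) × (Leaf d r → Fin q),
      ∑ y, obsPMF d r q lam t x RR' * (if f RR'.2 = y then 1 else 0) =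
        obsPMF d r q lam t x RR' * (fun _ => 1) RR'.2 := by
      intro RR'; simp
    simp only [this]
    rw [ar_obs_sum lam t x (fun _ => 1)]
    have h2 : ∀ R : Vtx d r → Fin q,
      ∑ s : Leaf d r → Fin q, (∏ l : Leaf d r, edgeFactor q t (s l) (R (leafVtx l))) * (1:ℝ) = 1 := by
      intro R
      rw [ar_leaf_sum hq t (fun l => R (leafVtx l)) hr.some (fun _ => 1)]
      simp [ar_edge_sum_one hq]
    simp only [h2]
    simp only [mul_one, ar_W_total hq]
  · intro π x y
    have e := ((Equiv.arrowCongr (Equiv.refl (Vtx d r)) π).prodCongr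
      (Equiv.arrowCongr (Equiv.refl (Leaf d r)) π)).sum_comp
      (fun RR' => obsPMF d r q lam t (π x) RR' * (if f RR'.2 = π y then 1 else 0))
    show ∑ RR', _ = ∑ RR', _
    rw [← e]
    refine Finset.sum_congr rfl fun RR' _ => ?_
    obtain ⟨R, s⟩ := RR'
    have e1 : ((Equiv.arrowCongr (Equiv.refl (Vtx d r)) π).prodCongr
      (Equiv.arrowCongr (Equiv.refl (Leaf d r)) π)) (R, s) = (π ∘ R, π ∘ s) := rfl
    rw [e1, ar_obs_perm]
    simp [hf]

/-- The centred indicator. -/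
noncomputable def arg (q : ℕ) (a b : Fin q) : ℝ := (if b = a then 1 else 0) - 1 / q

lemma ar_g_sum {q : ℕ} (hq : 2 ≤ q) (a : Fin q) : ∑ b, arg q a b = 0 := by
  have hq' : (q : ℝ) ≠ 0 := by positivity
  simp [arg, Finset.sum_sub_distrib, hq']

lemma ar_g_sum' {q : ℕ} (hq : 2 ≤ q) (b : Fin q) : ∑ a, arg q a b = 0 := by
  have hq' : (q : ℝ) ≠ 0 := by positivity
  simp [arg, Finset.sum_sub_distrib, hq']

lemma ar_g_abs {q : ℕ} (hq : 2 ≤ q) (a b : Fin q) : |arg q a b| ≤ 1 := by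
  have hq1 : (1 : ℝ) ≤ q := by exact_mod_cast (by omega : 1 ≤ q)
  have h2 : 1 / (q : ℝ) ≤ 1 := by rw [div_le_one (by linarith)]; exact hq1
  have h3 : 0 ≤ 1 / (q : ℝ) := by positivity
  unfold arg
  rw [abs_le]
  split_ifs <;> constructor <;> linarith

/-- Moments of a sum of independent centred variables on `Fin n → Fin q`. -/
lemma ar_moments {q : ℕ} (hq : 2 ≤ q) (g : Fin q → ℝ) (h0 : ∑ b, g b = 0)
    (h1 : ∀ b, |g b| ≤ 1) (n : ℕ) :
    (∑ s : Fin n → Fin q, (∑ i, g (s i)) = 0) ∧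
    (∑ s : Fin n → Fin q, (∑ i, g (s i)) ^ 2 = (q : ℝ) ^ n * (n * ((∑ b, g b ^ 2) / q))) ∧
    (∑ s : Fin n → Fin q, (∑ i, g (s i)) ^ 4 ≤ (q : ℝ) ^ n * (3 * n ^ 2)) := by
  have hq' : (0 : ℝ) < q := by positivity
  set σ := (∑ b, g b ^ 2) / q with hσ
  have hb2 : ∑ b, g b ^ 2 = q * σ := by rw [hσ]; field_simp
  have hσ1 : σ ≤ 1 := by
    rw [hσ, div_le_one hq']
    calc ∑ b, g b ^ 2 ≤ ∑ b : Fin q, (1 : ℝ) :=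
          Finset.sum_le_sum fun b _ => (sq_le_one_iff_abs_le_one _).2 (h1 b)
      _ = q := by simp
  have hσ0 : 0 ≤ σ := by rw [hσ]; positivity
  have hb4 : ∑ b, g b ^ 4 ≤ q := by
    calc ∑ b, g b ^ 4 ≤ ∑ b : Fin q, (1 : ℝ) :=
          Finset.sum_le_sum fun b _ => by
            have := (sq_le_one_iff_abs_le_one _).2 (h1 b)
            nlinarith [sq_nonneg (g b)]
      _ = q := by simp
  induction n with
  | zero => simp
  | succ n ih =>
    obtain ⟨i1, i2, i4⟩ := ih
    have key : ∀ k : ℕ, ∑ s : Fin (n+1) → Fin q, (∑ i, g (s i)) ^ k =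
        ∑ s : Fin n → Fin q, ∑ b, (g b + ∑ i, g (s i)) ^ k := by
      intro k
      rw [← (Fin.consEquiv (fun _ => Fin q)).sum_comp, Fintype.sum_prod_type, Finset.sum_comm]
      simp [Fin.consEquiv, Fin.sum_univ_succ]
    have c : ∑ s : Fin n → Fin q, (1 : ℝ) = (q : ℝ) ^ n := by simp
    refine ⟨?_, ?_, ?_⟩
    · have := key 1
      simp only [pow_one] at this
      rw [this]
      simp [Finset.sum_add_distrib, h0, ← Finset.mul_sum, i1]
    · rw [key 2]
      have : ∀ s : Fin n → Fin q, ∑ b, (g b + ∑ i, g (s i)) ^ 2 =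
          (q * σ) * 1 + q * (∑ i, g (s i)) ^ 2 := by
        intro s
        generalize ∑ i, g (s i) = z
        simp only [add_sq, Finset.sum_add_distrib, ← Finset.sum_mul, ← Finset.mul_sum, h0, hb2]
        simp
      simp only [this, Finset.sum_add_distrib, ← Finset.mul_sum, i2, c]
      push_cast
      ring
    · rw [key 4]
      have : ∀ s : Fin n → Fin q, ∑ b, (g b + ∑ i, g (s i)) ^ 4 =
          (∑ b, g b ^ 4) * 1 + (4 * ∑ b, g b ^ 3) * (∑ i, g (s i))
           + (6 * (q * σ)) * (∑ i, g (s i)) ^ 2 + q * (∑ i, g (s i)) ^ 4 := by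
        intro s
        generalize ∑ i, g (s i) = z
        have e : ∀ b, (g b + z) ^ 4 = g b ^ 4 + 4 * g b ^ 3 * z + 6 * g b ^ 2 * z ^ 2
          + 4 * g b * z ^ 3 + z ^ 4 := fun b => by ring
        simp only [e, Finset.sum_add_distrib, ← Finset.sum_mul, ← Finset.mul_sum, h0, hb2]
        simp
      simp only [this, Finset.sum_add_distrib, ← Finset.mul_sum, i1, i2, c]
      have hqn : (0 : ℝ) < (q : ℝ) ^ n := by positivity
      have a1 : (∑ b, g b ^ 4) * (q : ℝ) ^ n ≤ q * (q : ℝ) ^ n := by gcongr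
      have hss : σ * σ ≤ 1 := by nlinarith
      have a2 : (6 * (q * σ)) * ((q : ℝ) ^ n * (n * σ)) ≤ 6 * q * (q : ℝ) ^ n * n := by
        have : (6 * (q * σ)) * ((q : ℝ) ^ n * (n * σ)) = (6 * q * (q : ℝ) ^ n * n) * (σ * σ) := by
          ring
        rw [this]
        exact mul_le_of_le_one_right (by positivity) hss
      have a3 := mul_le_mul_of_nonneg_left i4 hq'.le
      have a4 : 0 < (q : ℝ) ^ n * q := by positivity
      push_cast
      rw [pow_succ]
      nlinarith

lemma ar_abs_lower {q : ℕ} (hq : 2 ≤ q) (g : Fin q → ℝ) (h0 : ∑ b, g b = 0)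
    (h1 : ∀ b, |g b| ≤ 1) (hpos : 0 < ∑ b, g b ^ 2) :
    ∃ c : ℝ, 0 < c ∧ ∀ (ι : Type) [Fintype ι] [DecidableEq ι],
      (q : ℝ) ^ (Fintype.card ι) * (c * √(Fintype.card ι)) ≤
        ∑ s : ι → Fin q, |∑ i, g (s i)| := by
  have hq' : (0 : ℝ) < q := by positivity
  set σ := (∑ b, g b ^ 2) / q with hσ
  have hσ0 : 0 < σ := by positivity
  set K := √(6 / σ) with hK
  have hK0 : 0 < K := Real.sqrt_pos.2 (by positivity)
  have hK2 : K ^ 2 = 6 / σ := Real.sq_sqrt (by positivity)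
  refine ⟨σ / (2 * K), by positivity, ?_⟩
  intro ι _ _
  have e := Fintype.equivFin ι
  have hre : ∑ s : ι → Fin q, |∑ i, g (s i)| =
      ∑ s : Fin (Fintype.card ι) → Fin q, |∑ i, g (s i)| := by
    rw [← (Equiv.arrowCongr e (Equiv.refl (Fin q))).sum_comp]
    refine Finset.sum_congr rfl fun s _ => ?_
    rw [← e.sum_comp]
    simp
  rw [hre]
  generalize Fintype.card ι = n
  rcases Nat.eq_zero_or_pos n with hn | hn
  · subst hn; simp
  have hn' : (0 : ℝ) < n := by exact_mod_cast hn
  obtain ⟨-, m2, m4⟩ := ar_moments hq g h0 h1 n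
  set w := √(n : ℝ) with hw
  have hw0 : 0 < w := Real.sqrt_pos.2 hn'
  have hw2 : w ^ 2 = n := Real.sq_sqrt hn'.le
  set t := K * w with ht
  have ht0 : 0 < t := by positivity
  have pt : ∀ z : ℝ, z ^ 2 / t - z ^ 4 / t ^ 3 ≤ |z| := by
    intro z
    have hu : (|z| / t) ^ 2 - (|z| / t) ^ 4 ≤ |z| / t := by
      have : 0 ≤ |z| / t := by positivity
      generalize |z| / t = u at *
      rcases le_total u 1 with h | h
      · nlinarith [pow_nonneg this 4]
      · nlinarith [mul_nonneg (sq_nonneg u) (by nlinarith : 0 ≤ u ^ 2 - 1)]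
    have h2 := mul_le_mul_of_nonneg_left hu ht0.le
    have e1 : t * (|z| / t) = |z| := by field_simp
    have e2 : t * ((|z| / t) ^ 2 - (|z| / t) ^ 4) = z ^ 2 / t - z ^ 4 / t ^ 3 := by
      have z2 : |z| ^ 2 = z ^ 2 := sq_abs z
      have z4 : |z| ^ 4 = z ^ 4 := by
        rw [show |z| ^ 4 = (|z| ^ 2) ^ 2 by ring, z2]; ring
      rw [div_pow, div_pow, z2, z4]
      field_simp
    rw [e1, e2] at h2
    exact h2
  calc (q : ℝ) ^ n * (σ / (2 * K) * w)
      = ((q : ℝ) ^ n * (n * σ)) / t - ((q : ℝ) ^ n * (3 * n ^ 2)) / t ^ 3 := by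
        rw [← hw2, ht]
        have : σ = 6 / K ^ 2 := by rw [hK2]; field_simp
        rw [this]
        field_simp
        ring
    _ ≤ (∑ s : Fin n → Fin q, (∑ i, g (s i)) ^ 2) / t
        - (∑ s : Fin n → Fin q, (∑ i, g (s i)) ^ 4) / t ^ 3 := by
        rw [m2]
        gcongr
    _ = ∑ s : Fin n → Fin q, ((∑ i, g (s i)) ^ 2 / t - (∑ i, g (s i)) ^ 4 / t ^ 3) := by
        rw [Finset.sum_sub_distrib, Finset.sum_div, Finset.sum_div]
    _ ≤ _ := Finset.sum_le_sum fun s _ => pt _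

/-- Existence of an equivariant plurality estimator. -/
lemma ar_plurality (ι : Type) [Fintype ι] [DecidableEq ι] [Nonempty ι] {q : ℕ} :
    ∃ f : (ι → Fin q) → Fin q,
      (∀ (π : Equiv.Perm (Fin q)) s, f (π ∘ s) = π (f s)) ∧
      ∀ s a, ∑ i, arg q a (s i) ≤ ∑ i, arg q (f s) (s i) := by
  have hm : ∀ c : ι → ℕ, ∃ i, ∀ j, c j ≤ c i := fun c => Finite.exists_max c
  choose m hm using hm
  let cnt : (ι → Fin q) → ι → ℕ := fun s i => (Finset.univ.filter fun j => s j = s i).card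
  refine ⟨fun s => s (m (cnt s)), ?_, ?_⟩
  · intro π s
    have : cnt (π ∘ s) = cnt s := by
      funext i
      simp [cnt]
    simp [this]
  · intro s a
    have hsum : ∀ b, ∑ i, arg q b (s i) =
        ((Finset.univ.filter fun j => s j = b).card : ℝ) - Fintype.card ι * (1 / q) := by
      intro b
      simp [arg, Finset.sum_sub_distrib]
    rw [hsum, hsum]
    have : (Finset.univ.filter fun j => s j = a).card ≤ cnt s (m (cnt s)) := by
      by_cases h : ∃ i, s i = a
      · obtain ⟨i, rfl⟩ := h
        exact hm (cnt s) i
      · rw [Finset.filter_false_of_mem]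
        · simp
        · intro j _ hj
          exact h ⟨j, hj⟩
    have : ((Finset.univ.filter fun j => s j = a).card : ℝ) ≤ cnt s (m (cnt s)) := by
      exact_mod_cast this
    simp only [cnt] at this ⊢
    linarith

lemma ar_max_lower {q : ℕ} (hq : 2 ≤ q) (D : Fin q → ℝ) (M : ℝ) (h0 : ∑ a, D a = 0)
    (hM : ∀ a, D a ≤ M) (a : Fin q) : |D a| / (q - 1) ≤ M := by
  have hq2 : (2 : ℝ) ≤ q := by exact_mod_cast hq
  rw [div_le_iff₀ (by linarith)]
  have hM0 : 0 ≤ M := by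
    have : ∑ a, D a ≤ ∑ a : Fin q, M := Finset.sum_le_sum fun a _ => hM a
    rw [h0] at this
    simp at this
    by_contra hneg
    push Not at hneg
    nlinarith
  rw [abs_le]
  constructor
  · rw [← Finset.add_sum_erase _ _ (Finset.mem_univ a)] at h0
    have : ∑ b ∈ Finset.univ.erase a, D b ≤ ∑ b ∈ Finset.univ.erase a, M :=
      Finset.sum_le_sum fun b _ => hM b
    simp only [Finset.sum_const, Finset.card_erase_of_mem (Finset.mem_univ a), Finset.card_univ,
      Fintype.card_fin, nsmul_eq_mul] at this
    rw [Nat.cast_sub (by omega), Nat.cast_one] at this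
    nlinarith
  · have := hM a
    nlinarith

/-- The trace of the estimator channel, as a function of the leaf parameter. -/
noncomputable def arTr (d r q : ℕ) (lam : ℝ) (f : (Leaf d r → Fin q) → Fin q) (t : ℝ) : ℝ :=
  ∑ z, ∑ RR' : (Vtx d r → Fin q) × (Leaf d r → Fin q),
      obsPMF d r q lam t z RR' * (if f RR'.2 = z then 1 else 0)

lemma ar_tr_eq {d r q : ℕ} (lam t : ℝ) (f : (Leaf d r → Fin q) → Fin q) :
    arTr d r q lam f t = ∑ z, ∑ R, arW d r q lam z R *
      ∑ s : Leaf d r → Fin q, (∏ l : Leaf d r, edgeFactor q t (s l) (R (leafVtx l))) *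
        (if f s = z then 1 else 0) := by
  unfold arTr
  refine Finset.sum_congr rfl fun z _ => ?_
  exact ar_obs_sum lam t z (fun s => if f s = z then 1 else 0)

lemma ar_tr_zero {d r q : ℕ} (hq : 2 ≤ q) (lam : ℝ) (f : (Leaf d r → Fin q) → Fin q) :
    arTr d r q lam f 0 = 1 := by
  have hq' : (q : ℝ) ≠ 0 := by positivity
  rw [ar_tr_eq]
  simp only [edgeFactor, zero_mul, zero_add, sub_zero]
  simp only [← Finset.sum_mul, ar_W_total hq, one_mul]
  rw [Finset.sum_comm]
  simp [← Finset.mul_sum]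
  simp [inv_pow, hq']

lemma ar_tr_deriv {d r q : ℕ} (hq : 2 ≤ q) (lam : ℝ) (f : (Leaf d r → Fin q) → Fin q) :
    HasDerivAt (arTr d r q lam f)
      (lam ^ r * (q / (q : ℝ) ^ (Fintype.card (Leaf d r))) *
        ∑ s : Leaf d r → Fin q, ∑ l, arg q (f s) (s l)) 0 := by
  have hq' : (q : ℝ) ≠ 0 := by positivity
  have hfun : arTr d r q lam f = fun t => ∑ z, ∑ R, arW d r q lam z R *
      ∑ s : Leaf d r → Fin q, (∏ l : Leaf d r, edgeFactor q t (s l) (R (leafVtx l))) *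
        (if f s = z then 1 else 0) := funext fun t => ar_tr_eq lam t f
  rw [hfun]
  have hedge : ∀ a b : Fin q, HasDerivAt (fun t => edgeFactor q t a b) (arg q a b) 0 := by
    intro a b
    unfold edgeFactor arg
    have h1 := (hasDerivAt_id (0:ℝ)).mul_const (if a = b then (1:ℝ) else 0)
    have h2 := ((hasDerivAt_id (0:ℝ)).const_sub 1).div_const (q : ℝ)
    have h3 := h1.add h2
    refine h3.congr_deriv ?_
    simp only [eq_comm (a := b)]
    ring
  have hprod : ∀ (b s : Leaf d r → Fin q), HasDerivAt
      (fun t => ∏ l : Leaf d r, edgeFactor q t (s l) (b l))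
      (q / (q : ℝ) ^ (Fintype.card (Leaf d r)) * ∑ l, arg q (s l) (b l)) 0 := by
    intro b s
    have h := HasDerivAt.fun_finsetProd (u := Finset.univ)
      (f := fun (l : Leaf d r) t => edgeFactor q t (s l) (b l))
      (f' := fun l => arg q (s l) (b l)) (x := (0:ℝ)) (fun l _ => hedge (s l) (b l))
    refine h.congr_deriv ?_
    rw [Finset.mul_sum]
    refine Finset.sum_congr rfl fun l _ => ?_
    simp only [edgeFactor, zero_mul, zero_add, sub_zero, Finset.prod_const,
      Finset.card_erase_of_mem (Finset.mem_univ l), Finset.card_univ, smul_eq_mul]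
    congr 1
    have hc : 0 < Fintype.card (Leaf d r) := Fintype.card_pos_iff.2 ⟨l⟩
    obtain ⟨m, hm⟩ := Nat.exists_eq_succ_of_ne_zero hc.ne'
    rw [hm]
    simp only [Nat.succ_eq_add_one, Nat.add_sub_cancel]
    rw [pow_succ, div_pow, one_pow]
    field_simp
  have hD : HasDerivAt (fun t => ∑ z, ∑ R, arW d r q lam z R *
      ∑ s : Leaf d r → Fin q, (∏ l : Leaf d r, edgeFactor q t (s l) (R (leafVtx l))) *
        (if f s = z then 1 else 0))
      (∑ z, ∑ R, arW d r q lam z R *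
      ∑ s : Leaf d r → Fin q, (q / (q : ℝ) ^ (Fintype.card (Leaf d r)) *
        ∑ l, arg q (s l) (R (leafVtx l))) * (if f s = z then 1 else 0)) 0 := by
    refine HasDerivAt.fun_sum fun z _ => HasDerivAt.fun_sum fun R _ =>
      HasDerivAt.const_mul _ (HasDerivAt.fun_sum fun s _ => HasDerivAt.mul_const ?_ _)
    exact hprod (fun l => R (leafVtx l)) s
  refine hD.congr_deriv (Eq.symm ?_)
  set C := (q / (q : ℝ) ^ (Fintype.card (Leaf d r))) with hC
  have hz : ∀ z, ∑ R, arW d r q lam z R *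
      ∑ s : Leaf d r → Fin q, (C * ∑ l, arg q (s l) (R (leafVtx l))) *
        (if f s = z then 1 else 0) =
      ∑ s : Leaf d r → Fin q, (if f s = z then 1 else 0) *
        (C * ∑ l, lam ^ r * arg q (s l) z) := by
    intro z
    simp only [Finset.mul_sum, Finset.sum_mul]
    rw [Finset.sum_comm]
    refine Finset.sum_congr rfl fun s _ => ?_
    rw [Finset.sum_comm]
    refine Finset.sum_congr rfl fun l _ => ?_
    have hw := ar_W_sum hq lam z (leafVtx l) (fun a => arg q (s l) a)
    rw [ar_g_sum hq] at hw
    have : (((leafVtx l).1 : Fin (r+1)) : ℕ) = r := rfl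
    rw [this] at hw
    simp only [zero_div, mul_zero, add_zero] at hw
    rw [← hw, Finset.mul_sum, Finset.mul_sum]
    refine Finset.sum_congr rfl fun R _ => ?_
    ring
  simp only [hz]
  rw [Finset.mul_sum]
  conv_rhs => rw [Finset.sum_comm]
  refine Finset.sum_congr rfl fun s _ => ?_
  simp only [ite_mul, one_mul, zero_mul, Finset.sum_ite_eq, Finset.mem_univ, if_true]
  simp only [Finset.mul_sum]
  refine Finset.sum_congr rfl fun l _ => ?_
  have : arg q (s l) (f s) = arg q (f s) (s l) := by simp [arg, eq_comm]
  rw [this]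
  ring

/-- Ancestral reconstruction in the Kesten–Stigum regime: if `d·λ² > 1` there exist
`λ₁ > 0` and a depth `r` (depending only on `d, q, λ`) such that for every common leaf
noise level `λ₂ ∈ [λ₁, 1]` there are `λ₃ ≥ λ₁` and an estimator `f` of the root from the
noisy leaf observations satisfying, for every root value `x` and every `y`,
`P[f(R') = y | root = x] = λ₃·1[y = x] + (1−λ₃)/q`. -/
theorem ancestral_reconstruction (d q : ℕ) (lam : ℝ)
    (hd : 2 ≤ d) (hq : 2 ≤ q)
    (hlam0 : 0 ≤ lam) (hlam1 : lam ≤ 1)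
    (hKS : 1 < (d : ℝ) * lam ^ 2) :
    ∃ lam1 : ℝ, 0 < lam1 ∧ ∃ r : ℕ, 1 ≤ r ∧
      ∀ lam2 : ℝ, lam1 ≤ lam2 → lam2 ≤ 1 →
        ∃ lam3 : ℝ, lam1 ≤ lam3 ∧
          ∃ f : (Leaf d r → Fin q) → Fin q,
            ∀ x y : Fin q,
              (∑ RR' : (Vtx d r → Fin q) × (Leaf d r → Fin q),
                  obsPMF d r q lam lam2 x RR' * (if f RR'.2 = y then 1 else 0)) =
                lam3 * (if y = x then 1 else 0) + (1 - lam3) / q := by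
  have hq2 : (2 : ℝ) ≤ q := by exact_mod_cast hq
  have hd0 : (0 : ℝ) ≤ d := by positivity
  have hlampos : 0 < lam := by
    rcases hlam0.lt_or_eq with h | h
    · exact h
    · rw [← h] at hKS; norm_num at hKS
  let a0 : Fin q := ⟨0, by omega⟩
  have hvar : 0 < ∑ b, arg q a0 b ^ 2 := by
    refine Finset.sum_pos' (fun b _ => sq_nonneg _) ⟨a0, Finset.mem_univ _, ?_⟩
    have : 1 / (q : ℝ) < 1 := by rw [div_lt_one (by linarith)]; linarith
    have h3 : arg q a0 a0 = 1 - 1 / q := by simp [arg]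
    rw [h3]
    have : 0 < 1 - 1 / (q : ℝ) := by linarith
    positivity
  obtain ⟨c, hc, hlow⟩ := ar_abs_lower hq (arg q a0) (ar_g_sum hq a0) (ar_g_abs hq a0) hvar
  have hbase : 1 < lam * √d := by
    have : 1 < (lam * √d) ^ 2 := by
      rw [mul_pow, Real.sq_sqrt hd0]; linarith
    by_contra hcon
    push Not at hcon
    have h0 : 0 ≤ lam * √d := by positivity
    nlinarith
  have hq1 : (0 : ℝ) < q - 1 := by linarith
  set C := (q : ℝ) * c / (q - 1) ^ 2 with hC
  have hC0 : 0 < C := by positivity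
  obtain ⟨r0, hr0⟩ := pow_unbounded_of_one_lt (1 / C) hbase
  set r := r0 + 1 with hr
  have hrbig : 1 < C * (lam * √d) ^ r := by
    have h1 : (lam * √d) ^ r0 ≤ (lam * √d) ^ r := pow_le_pow_right₀ hbase.le (by omega)
    have h2 : 1 / C < (lam * √d) ^ r := lt_of_lt_of_le hr0 h1
    rw [div_lt_iff₀ hC0] at h2
    linarith
  have hdpos : 0 < d := by omega
  haveI : Nonempty (Leaf d r) := ⟨fun _ => ⟨0, hdpos⟩⟩
  obtain ⟨f, hf, hfmax⟩ := ar_plurality (Leaf d r) (q := q)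
  have hcard : Fintype.card (Leaf d r) = d ^ r := by simp
  set L := lam ^ r * (q / (q : ℝ) ^ (Fintype.card (Leaf d r))) *
        ∑ s : Leaf d r → Fin q, ∑ l, arg q (f s) (s l) with hL
  have hder : HasDerivAt (arTr d r q lam f) L 0 := ar_tr_deriv hq lam f
  have hsumlow : (q : ℝ) ^ (Fintype.card (Leaf d r)) * (c * √(Fintype.card (Leaf d r))) / (q - 1)
      ≤ ∑ s : Leaf d r → Fin q, ∑ l, arg q (f s) (s l) := by
    calc _ ≤ (∑ s : Leaf d r → Fin q, |∑ i, arg q a0 (s i)|) / (q - 1) := by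
          gcongr
          exact hlow (Leaf d r)
      _ ≤ _ := by
          rw [Finset.sum_div]
          refine Finset.sum_le_sum fun s _ => ?_
          refine ar_max_lower hq (fun a => ∑ i, arg q a (s i)) _ ?_ (hfmax s) a0
          rw [Finset.sum_comm]
          simp [ar_g_sum' hq]
  have hL1 : (q : ℝ) - 1 < L := by
    have hQ : (0 : ℝ) < (q : ℝ) ^ (Fintype.card (Leaf d r)) := by positivity
    have h1 : lam ^ r * (q / (q : ℝ) ^ (Fintype.card (Leaf d r))) *
      ((q : ℝ) ^ (Fintype.card (Leaf d r)) * (c * √(Fintype.card (Leaf d r))) / (q - 1)) ≤ L := by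
      rw [hL]
      gcongr
    refine lt_of_lt_of_le ?_ h1
    have hs : √((Fintype.card (Leaf d r) : ℕ) : ℝ) = √d ^ r := by
      rw [hcard, Nat.cast_pow, Real.sqrt_eq_iff_mul_self_eq (by positivity) (by positivity),
        ← mul_pow, Real.mul_self_sqrt hd0]
    have h2 : lam ^ r * (q / (q : ℝ) ^ (Fintype.card (Leaf d r))) *
      ((q : ℝ) ^ (Fintype.card (Leaf d r)) * (c * √(Fintype.card (Leaf d r))) / (q - 1))
      = (q - 1) * (C * (lam * √d) ^ r) := by
      rw [hs, hC, mul_pow]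
      field_simp
    rw [h2]
    nlinarith
  have hslope := hder.tendsto_slope_zero_right
  have hev := hslope.eventually (lt_mem_nhds hL1)
  rw [eventually_nhdsWithin_iff, Metric.eventually_nhds_iff] at hev
  obtain ⟨ε, hε, hev⟩ := hev
  have hsmall : ∀ t, 0 < t → t < ε → t ≤ (arTr d r q lam f t - 1) / (q - 1) := by
    intro t ht0 htε
    have := hev (y := t) (by rw [Real.dist_eq, sub_zero, abs_of_pos ht0]; exact htε) ht0
    rw [zero_add, ar_tr_zero hq, smul_eq_mul, inv_mul_eq_div, lt_div_iff₀ ht0] at this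
    rw [le_div_iff₀ hq1]
    linarith
  have hlr0 : 0 < lam ^ r := by positivity
  have hlr1 : lam ^ r ≤ 1 := pow_le_one₀ hlam0 hlam1
  refine ⟨lam ^ r * (ε / 2), by positivity, r, by omega, ?_⟩
  intro t ht ht1
  have ht0 : 0 < t := lt_of_lt_of_le (by positivity) ht
  by_cases hcase : t < ε
  · refine ⟨(arTr d r q lam f t - 1) / (q - 1), le_trans ht (hsmall t ht0 hcase), f, ?_⟩
    intro x y
    exact ar_equiv hq lam t inferInstance f hf x y
  · push Not at hcase
    refine ⟨lam ^ r * t, ?_, fun s => s (fun _ => ⟨0, hdpos⟩), ?_⟩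
    · gcongr
      linarith
    · intro x y
      exact ar_single hq lam t _ x y
end
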